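/- arXiv:0912.1749 — 4 statements merged into one kernel-verified Lean document; each statement's English description precedes it below -/
import Mathlib

section
/- Let q = 2p be even with p ≥ 3, λ = 2·cos(π/q), α ∈ (1/2, 1/λ). Define τ_0 = −δ_1 and τ_k = N(τ_{k−1}) with N(z) = ((λ²−2)z + λ)/((λ−λ³)z − λ² − 2). Let k ≥ 1. (a) A point (t,v) ∈ A ∩ D satisfies 𝒯_α^{j}(t,v) ∈ D for all 0 ≤ j ≤ k(p−1) and 𝒯_α^{k(p−1)+1}(t,v) ∉ D if and only if τ_{k−1} ≤ t < τ_k. (b) If x ∈ [(α−1)λ, αλ) is G_q-irrational, n ≥ 1, (t_n, v_n) := 𝒯_α^n(x, 0) ∈ A ∩ D and τ_{k−1} ≤ t_n < τ_k, then Θ_m(x) > ℋ_q for all n−1 ≤ m ≤ n + k(p−1), while Θ_{n+k(p−1)+1}(x) < ℋ_q. -/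
/-- The digit `d(x) = ⌊|1/(λx)| + 1 - α⌋` of the α-Rosen continued fraction. -/
noncomputable def rosenD (lam α x : ℝ) : ℤ := ⌊|1 / (lam * x)| + 1 - α⌋

/-- The α-Rosen continued fraction map `T_α` on `[(α-1)λ, αλ)`. -/
noncomputable def rosenT (lam α x : ℝ) : ℝ :=
  if x = 0 then 0 else Real.sign x / x - lam * (rosenD lam α x : ℝ)

/-- `x` is `G_q`-irrational: the orbit of `x` under `T_α` never hits `0`. -/
def GIrrational (lam α x : ℝ) : Prop := ∀ n : ℕ, (rosenT lam α)^[n] x ≠ 0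

/-- The recursion `u_n = d_n(x)·λ·u_{n-1} + ε_n(x)·u_{n-2}` for the numerators and
denominators of the α-Rosen convergents, with the index shifted by one:
`rosenPQ lam α x a b n = u_{n-1}` where `u_{-1} = a`, `u_0 = b`. -/
noncomputable def rosenPQ (lam α x a b : ℝ) : ℕ → ℝ
  | 0 => a
  | 1 => b
  | n + 2 =>
      (rosenD lam α ((rosenT lam α)^[n] x) : ℝ) * lam * rosenPQ lam α x a b (n + 1)
        + Real.sign ((rosenT lam α)^[n] x) * rosenPQ lam α x a b n

/-- The approximation coefficient `Θ_n(x) = q_n² · |x - p_n/q_n|` of the α-Rosen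
expansion of `x` (with `p_{-1}=1, q_{-1}=0, p_0=0, q_0=1`). -/
noncomputable def rosenTheta (lam α x : ℝ) (n : ℕ) : ℝ :=
  (rosenPQ lam α x 0 1 (n + 1)) ^ 2 *
    |x - rosenPQ lam α x 1 0 (n + 1) / rosenPQ lam α x 0 1 (n + 1)|

/-- The natural extension map `𝒯_α(t,v) = (T_α(t), 1/(d(t)λ + ε(t)v))`. -/
noncomputable def rosenNE (lam α : ℝ) (tv : ℝ × ℝ) : ℝ × ℝ :=
  (rosenT lam α tv.1, 1 / ((rosenD lam α tv.1 : ℝ) * lam + Real.sign tv.1 * tv.2))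

/-- `l_n = T_α^n((α-1)λ)`, the orbit of the left endpoint. -/
noncomputable def lseq (lam α : ℝ) (n : ℕ) : ℝ := (rosenT lam α)^[n] ((α - 1) * lam)

/-- `r_n = T_α^n(αλ)`, the orbit of the right endpoint. -/
noncomputable def rseq (lam α : ℝ) (n : ℕ) : ℝ := (rosenT lam α)^[n] (α * lam)

/-- The heights `H_1 = 1/(λ+1)`, `H_2 = 1/λ`, `H_n = 1/(λ - H_{n-2})` of the
natural extension domain. -/
noncomputable def Hs (lam : ℝ) : ℕ → ℝ
  | 0 => 0
  | 1 => 1 / (lam + 1)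
  | 2 => 1 / lam
  | n + 3 => 1 / (lam - Hs lam (n + 1))

/-- The natural extension domain `Ω_α = ⋃_{n=1}^{2p-1} J_n × [0, H_n]` for even
`q = 2p` and `α ∈ (1/2, 1/λ)`, where `J_{2n-1} = [l_{n-1}, r_n)`,
`J_{2n} = [r_n, l_n)` and `J_{2p-1} = [l_{p-1}, r_0)`. -/
noncomputable def OmegaEven (lam α : ℝ) (p : ℕ) : Set (ℝ × ℝ) :=
  (⋃ n ∈ Finset.Icc 1 (p - 1),
      Set.Ico (lseq lam α (n - 1)) (rseq lam α n) ×ˢ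
        Set.Icc (0 : ℝ) (Hs lam (2 * n - 1))) ∪
    (⋃ n ∈ Finset.Icc 1 (p - 1),
      Set.Ico (rseq lam α n) (lseq lam α n) ×ˢ Set.Icc (0 : ℝ) (Hs lam (2 * n))) ∪
    Set.Ico (lseq lam α (p - 1)) (rseq lam α 0) ×ˢ
      Set.Icc (0 : ℝ) (Hs lam (2 * p - 1))

/-- The region `D ⊆ Ω_α` where `min{Θ_{n-1}, Θ_n} > ℋ_q = 1/2` (even `q`). -/
noncomputable def DEven (lam α : ℝ) (p : ℕ) : Set (ℝ × ℝ) :=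
  {tv ∈ OmegaEven lam α p |
    1 / 2 < tv.2 / (1 + tv.1 * tv.2) ∧ 1 / 2 < |tv.1| / (1 + tv.1 * tv.2)}

/-- The region `A`: `-δ₁ ≤ t ≤ -1/(λ+1)` and `g(t) ≤ v ≤ λ-1`, where
`g(x) = (|x| - 1/2)/((1/2)x)` and `δ₁ = 1/((α+1)λ)`. -/
noncomputable def regA (lam α : ℝ) : Set (ℝ × ℝ) :=
  {tv | -(1 / ((α + 1) * lam)) ≤ tv.1 ∧ tv.1 ≤ -(1 / (lam + 1)) ∧
    (|tv.1| - 1 / 2) / ((1 / 2) * tv.1) ≤ tv.2 ∧ tv.2 ≤ lam - 1}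

/-- The region `D₃`: `r_{p-1} ≤ t ≤ -2/(λ+4)` and `g(t) ≤ v ≤ λ/2`, where
`r_{p-1} = -(2α-1)λ/(2-(1-α)λ²)`. -/
noncomputable def regD3 (lam α : ℝ) : Set (ℝ × ℝ) :=
  {tv | -((2 * α - 1) * lam / (2 - (1 - α) * lam ^ 2)) ≤ tv.1 ∧
    tv.1 ≤ -(2 / (lam + 4)) ∧
    (|tv.1| - 1 / 2) / ((1 / 2) * tv.1) ≤ tv.2 ∧ tv.2 ≤ lam / 2}

/-- `τ_0 = -δ₁ = -1/((α+1)λ)` and `τ_k = N(τ_{k-1})` where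
`N(z) = ((λ²-2)z + λ)/((λ-λ³)z - λ² - 2)`. -/
noncomputable def tauEven (lam α : ℝ) : ℕ → ℝ
  | 0 => -(1 / ((α + 1) * lam))
  | k + 1 =>
      ((lam ^ 2 - 2) * tauEven lam α k + lam) /
        ((lam - lam ^ 3) * tauEven lam α k - lam ^ 2 - 2)

/-- Facts about the sine sequence `s n = sin (n π / (2p))`. -/
structure SineSeq (p : ℕ) (lam : ℝ) (s : ℕ → ℝ) : Prop where
  h0 : s 0 = 0
  rec' : ∀ n, s (n + 2) = lam * s (n + 1) - s n
  pos : ∀ n, 1 ≤ n → n ≤ p + 1 → 0 < s n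
  lt : ∀ n, n < p → s n < s (n + 1)
  casorati : ∀ n, s (n + 1) ^ 2 - s n * s (n + 2) = s 1 ^ 2
  diff : ∀ n, n < p → s 1 ^ 2 ≤ s (n + 1) ^ 2 - s n ^ 2
  top : s p = 1
  top' : s (p - 1) = lam / 2

lemma exists_sineSeq (p : ℕ) (hp : 3 ≤ p) (lam : ℝ)
    (hlam : lam = 2 * Real.cos (Real.pi / (2 * (p : ℝ)))) :
    ∃ s : ℕ → ℝ, SineSeq p lam s := by
  have hp' : (3 : ℝ) ≤ p := by exact_mod_cast hp
  obtain ⟨θ, hθ⟩ : ∃ θ, θ = Real.pi / (2 * (p : ℝ)) := ⟨_, rfl⟩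
  have hpi := Real.pi_pos
  have hθ0 : 0 < θ := by rw [hθ]; positivity
  have hpθ : (p : ℝ) * θ = Real.pi / 2 := by rw [hθ]; field_simp
  rw [← hθ] at hlam
  have hle : ∀ n : ℕ, n ≤ p → (n : ℝ) * θ ≤ Real.pi / 2 := by
    intro n hn
    have : (n : ℝ) ≤ p := by exact_mod_cast hn
    nlinarith
  have hpos : ∀ n : ℕ, 1 ≤ n → n ≤ p + 1 → 0 < Real.sin ((n : ℝ) * θ) := by
    intro n h1 h2
    have h1' : (1 : ℝ) ≤ n := by exact_mod_cast h1
    have h2' : (n : ℝ) ≤ p + 1 := by exact_mod_cast h2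
    apply Real.sin_pos_of_pos_of_lt_pi
    · positivity
    · nlinarith
  have hnn : ∀ n : ℕ, n ≤ p → 0 ≤ Real.sin ((n : ℝ) * θ) := by
    intro n h2
    rcases Nat.eq_zero_or_pos n with h | h
    · simp [h]
    · exact (hpos n h (by omega)).le
  have hcas : ∀ n : ℕ, n < p → Real.sin θ ^ 2 ≤
      Real.sin (((n + 1 : ℕ) : ℝ) * θ) ^ 2 - Real.sin ((n : ℝ) * θ) ^ 2 := by
    intro n hn
    have hc : 0 ≤ Real.cos (((n + 1 : ℕ) : ℝ) * θ) :=
      Real.cos_nonneg_of_neg_pi_div_two_le_of_le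
        (by have : 0 ≤ (((n + 1 : ℕ) : ℝ) * θ) := by positivity
            linarith) (hle _ hn)
    have hs1 : 0 < Real.sin θ := by simpa using hpos 1 le_rfl (by omega)
    have hsn := hnn n hn.le
    have e : Real.sin (((n + 1 : ℕ) : ℝ) * θ) ^ 2 - Real.sin ((n : ℝ) * θ) ^ 2 - Real.sin θ ^ 2
        = 2 * Real.sin θ * Real.sin ((n : ℝ) * θ) * Real.cos (((n + 1 : ℕ) : ℝ) * θ) := by
      push_cast
      rw [add_mul, one_mul, Real.sin_add, Real.cos_add]
      have a := Real.sin_sq_add_cos_sq ((n : ℝ) * θ)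
      have b := Real.sin_sq_add_cos_sq θ
      set S := Real.sin ((n : ℝ) * θ)
      set C := Real.cos ((n : ℝ) * θ)
      set x := Real.sin θ
      set y := Real.cos θ
      have hC : C ^ 2 = 1 - S ^ 2 := by linarith
      have hy : y ^ 2 = 1 - x ^ 2 := by linarith
      linear_combination x ^ 2 * hC + S ^ 2 * hy
    have : 0 ≤ 2 * Real.sin θ * Real.sin ((n : ℝ) * θ) * Real.cos (((n + 1 : ℕ) : ℝ) * θ) := by
      positivity
    linarith
  refine ⟨fun n => Real.sin ((n : ℝ) * θ), ⟨by simp, ?_, hpos, ?_, ?_, ?_, ?_, ?_⟩⟩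
  · intro n
    have e1 : ((n + 2 : ℕ) : ℝ) * θ = ((n : ℝ) + 1) * θ + θ := by push_cast; ring
    have e2 : (n : ℝ) * θ = ((n : ℝ) + 1) * θ - θ := by ring
    have e3 : ((n + 1 : ℕ) : ℝ) * θ = ((n : ℝ) + 1) * θ := by push_cast; ring
    rw [e1, e2, e3, Real.sin_add, Real.sin_sub, hlam]; ring
  · intro n hn
    apply Real.sin_lt_sin_of_lt_of_le_pi_div_two
    · have : 0 ≤ ((n : ℝ) * θ) := by positivity
      linarith
    · exact hle _ hn
    · push_cast; linarith
  · intro n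
    have e1 : ((n + 2 : ℕ) : ℝ) * θ = ((n : ℝ) + 1) * θ + θ := by push_cast; ring
    have e2 : (n : ℝ) * θ = ((n : ℝ) + 1) * θ - θ := by ring
    have e3 : ((n + 1 : ℕ) : ℝ) * θ = ((n : ℝ) + 1) * θ := by push_cast; ring
    rw [e1, e2, e3, Real.sin_add, Real.sin_sub]
    simp only [Nat.cast_one, one_mul]
    have a := Real.sin_sq_add_cos_sq (((n : ℝ) + 1) * θ)
    have b := Real.sin_sq_add_cos_sq θ
    set S := Real.sin (((n : ℝ) + 1) * θ)
    set C := Real.cos (((n : ℝ) + 1) * θ)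
    set x := Real.sin θ
    set y := Real.cos θ
    linear_combination x ^ 2 * a - S ^ 2 * b
  · intro n hn
    simpa using hcas n hn
  · rw [hpθ, Real.sin_pi_div_two]
  · have : ((p - 1 : ℕ) : ℝ) * θ = Real.pi / 2 - θ := by
      rw [Nat.cast_sub (by omega), ← hpθ]; push_cast; ring
    rw [this, Real.sin_pi_div_two_sub, hlam]; ring

lemma lam_bounds (p : ℕ) (hp : 3 ≤ p) (lam : ℝ)
    (hlam : lam = 2 * Real.cos (Real.pi / (2 * (p : ℝ)))) :
    0 < lam ∧ lam < 2 ∧ 3 ≤ lam ^ 2 := by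
  have hp' : (3 : ℝ) ≤ p := by exact_mod_cast hp
  have hpi := Real.pi_pos
  have h1 : Real.pi / (2 * (p : ℝ)) ≤ Real.pi / 6 := by
    apply div_le_div_of_nonneg_left <;> linarith
  have h0 : 0 < Real.pi / (2 * (p : ℝ)) := by positivity
  have h2 : Real.cos (Real.pi / 6) ≤ Real.cos (Real.pi / (2 * (p : ℝ))) :=
    Real.cos_le_cos_of_nonneg_of_le_pi h0.le (by linarith) h1
  have h3 : Real.cos (Real.pi / (2 * (p : ℝ))) < 1 := by
    rw [← Real.cos_zero]
    exact Real.cos_lt_cos_of_nonneg_of_le_pi le_rfl (by linarith) h0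
  rw [Real.cos_pi_div_six] at h2
  have h4 : (0 : ℝ) < √3 := by positivity
  have h5 : √3 ^ 2 = (3 : ℝ) := Real.sq_sqrt (by norm_num)
  refine ⟨by linarith, by linarith, ?_⟩
  rw [hlam]; nlinarith

lemma rosenNE_neg {lam α w v : ℝ} (d : ℤ) (hl : 0 < lam) (hw : 0 < w)
    (h1 : d * lam ≤ w + (1 - α) * lam) (h2 : w + (1 - α) * lam < (d + 1) * lam) :
    rosenNE lam α (-(1 / w), v) = (w - d * lam, 1 / (d * lam - v)) := by
  have hneg : -(1 / w) < 0 := by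
    have : 0 < 1 / w := by positivity
    linarith
  have hD : rosenD lam α (-(1 / w)) = d := by
    unfold rosenD
    have : |1 / (lam * -(1 / w))| = w / lam := by
      rw [show 1 / (lam * -(1 / w)) = -(w / lam) by field_simp, abs_neg, abs_of_pos (by positivity)]
    rw [this, Int.floor_eq_iff]
    have e : (w / lam) * lam = w := by field_simp
    constructor
    · by_contra! h
      nlinarith
    · by_contra! h
      nlinarith
  have hs : Real.sign (-(1 / w)) = -1 := Real.sign_of_neg hneg
  unfold rosenNE
  simp only [hD, hs]
  unfold rosenT
  rw [if_neg hneg.ne, hD, hs]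
  ext
  · simp only []
    field_simp
  · simp only []
    congr 1; ring

lemma rosenNE_iter_fst (lam α t v : ℝ) (n : ℕ) :
    ((rosenNE lam α)^[n] (t, v)).1 = (rosenT lam α)^[n] t := by
  induction n with
  | zero => rfl
  | succ n ih =>
    rw [Function.iterate_succ_apply', Function.iterate_succ_apply', ← ih]; rfl

/-- The linear combination of consecutive sines that governs one round. -/
noncomputable def Dd (s : ℕ → ℝ) (lam w : ℝ) (n : ℕ) : ℝ := s (n + 1) + (lam - w) * s n

lemma Dd_rec {p : ℕ} {lam : ℝ} {s : ℕ → ℝ} (hs : SineSeq p lam s) (w : ℝ) (n : ℕ) :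
    Dd s lam w (n + 2) = lam * Dd s lam w (n + 1) - Dd s lam w n := by
  unfold Dd
  rw [hs.rec' (n + 1), hs.rec' n]; ring

lemma Dd_wronski {p : ℕ} {lam : ℝ} {s : ℕ → ℝ} (hs : SineSeq p lam s) (w v : ℝ) (n : ℕ) :
    Dd s lam w n * Dd s lam v (n + 1) - Dd s lam v n * Dd s lam w (n + 1)
      = s 1 ^ 2 * (w - v) := by
  unfold Dd
  rw [← hs.casorati n]; ring

lemma s_nonneg {p : ℕ} {lam : ℝ} {s : ℕ → ℝ} (hs : SineSeq p lam s) (n : ℕ) (hn : n ≤ p + 1) :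
    0 ≤ s n := by
  rcases Nat.eq_zero_or_pos n with h | h
  · rw [h, hs.h0]
  · exact (hs.pos n h hn).le

lemma Dd_pos {p : ℕ} {lam : ℝ} {s : ℕ → ℝ} (hs : SineSeq p lam s) {w : ℝ} (hw : w ≤ lam + 1)
    {n : ℕ} (hn : n < p) : 0 < Dd s lam w n := by
  have h1 := hs.lt n hn
  have h2 := s_nonneg hs n (by omega)
  unfold Dd
  nlinarith

lemma Dd_orbit {p : ℕ} (hp : 3 ≤ p) {lam α : ℝ} {s : ℕ → ℝ} (hs : SineSeq p lam s)
    (hl0 : 0 < lam) (hl1 : 1 < lam) (hl2 : lam < 2) (hα : 1 / 2 < α) (hα' : α * lam < 1)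
    {w v : ℝ} (hw : (α + 1) * lam ≤ w) (hw' : w < lam + 1) (hv' : v ≤ lam - 1)
    (n : ℕ) (hn : n + 2 ≤ p) :
    (rosenNE lam α)^[n + 1] (-(1 / w), v) =
      (-(Dd s lam w (n + 1) / Dd s lam w n), Dd s lam v n / Dd s lam v (n + 1)) ∧
    Dd s lam w (n + 1) ≤ (1 - α) * lam * Dd s lam w n := by
  have hw0 : 0 < w := by nlinarith
  have hs1 : 0 < s 1 := hs.pos 1 le_rfl (by omega)
  have hs2 : s 2 = lam * s 1 := by have := hs.rec' 0; simp [hs.h0] at this; exact this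
  induction n with
  | zero =>
    constructor
    · rw [Function.iterate_one, rosenNE_neg 2 hl0 hw0 (by push_cast; nlinarith)
        (by push_cast; nlinarith)]
      simp only [Dd, hs.h0, zero_add, mul_zero, add_zero, hs2]
      ext
      · simp only []; push_cast; field_simp; ring
      · have h1 : 0 < 2 * lam - v := by nlinarith
        have h2 : lam * s 1 + (lam - v) * s 1 ≠ 0 := by
          have : 0 < s 1 * (2 * lam - v) := by positivity
          nlinarith
        simp only []; push_cast
        rw [div_eq_div_iff h1.ne' h2]; ring
    · simp only [Dd, hs.h0, zero_add, mul_zero, add_zero, hs2]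
      nlinarith
  | succ n ih =>
    obtain ⟨ih1, ih2⟩ := ih (by omega)
    have d0 := Dd_pos hs hw'.le (n := n) (by omega)
    have d1 := Dd_pos hs hw'.le (n := n + 1) (by omega)
    have d2 := Dd_pos hs hw'.le (n := n + 2) (by omega)
    have e0 := Dd_pos hs (w := v) (by linarith) (n := n) (by omega)
    have e1 := Dd_pos hs (w := v) (by linarith) (n := n + 1) (by omega)
    have e2 := Dd_pos hs (w := v) (by linarith) (n := n + 2) (by omega)
    have r := Dd_rec hs w n
    have r' := Dd_rec hs v n
    have key : α * lam * ((1 - α) * lam) ≤ 1 := by nlinarith [sq_nonneg (α - 1 / 2)]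
    have hα1 : 0 ≤ α * lam := by nlinarith
    have q1 : α * lam * Dd s lam w (n + 1) ≤ Dd s lam w n := by
      calc α * lam * Dd s lam w (n + 1) ≤ α * lam * ((1 - α) * lam * Dd s lam w n) := by gcongr
        _ = α * lam * ((1 - α) * lam) * Dd s lam w n := by ring
        _ ≤ 1 * Dd s lam w n := by gcongr
        _ = _ := one_mul _
    refine ⟨?_, by rw [r]; nlinarith⟩
    have hq : Dd s lam w n / Dd s lam w (n + 1) * Dd s lam w (n + 1) = Dd s lam w n := by
      field_simp
    set Q := Dd s lam w n / Dd s lam w (n + 1) with hQ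
    have hQ0 : 0 < Q := by positivity
    have hQ1 : α * lam ≤ Q := by by_contra! h; nlinarith
    have hQ2 : Q < lam := by by_contra! h; nlinarith
    rw [Function.iterate_succ_apply', ih1,
      show Dd s lam w (n + 1) / Dd s lam w n = 1 / Q by rw [hQ]; field_simp,
      rosenNE_neg 1 hl0 hQ0 (by push_cast; nlinarith) (by push_cast; nlinarith)]
    ext
    · simp only []; push_cast; rw [r, hQ]; field_simp; ring
    · simp only []; push_cast
      rw [r'] at e2 ⊢
      rw [show (1 : ℝ) * lam - Dd s lam v n / Dd s lam v (n + 1)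
        = (lam * Dd s lam v (n + 1) - Dd s lam v n) / Dd s lam v (n + 1) by field_simp]
      rw [one_div_div]

lemma lseq_eq {p : ℕ} (hp : 3 ≤ p) {lam α : ℝ} {s : ℕ → ℝ} (hs : SineSeq p lam s)
    (hl0 : 0 < lam) (hl1 : 1 < lam) (hl2 : lam < 2) (hα : 1 / 2 < α) (hα' : α * lam < 1)
    (n : ℕ) (hn : n + 2 ≤ p) :
    lseq lam α n = -(Dd s lam ((α + 1) * lam) (n + 1) / Dd s lam ((α + 1) * lam) n) := by
  have h0 : rosenT lam α (-(1 / ((α + 1) * lam))) = (α - 1) * lam := by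
    have h := rosenNE_neg (lam := lam) (α := α) (w := (α + 1) * lam) (v := 0) 2 hl0
      (by positivity) (by push_cast; nlinarith) (by push_cast; nlinarith)
    have h' := congrArg Prod.fst h
    simp only [rosenNE] at h'
    rw [h']; push_cast; ring
  have h := (Dd_orbit hp hs hl0 hl1 hl2 hα hα' (w := (α + 1) * lam) (v := 0) le_rfl
    (by nlinarith) (by linarith) n hn).1
  have h' := congrArg Prod.fst h
  rw [rosenNE_iter_fst, Function.iterate_succ_apply, h0] at h'
  exact h'

lemma Hs_odd {p : ℕ} {lam : ℝ} {s : ℕ → ℝ} (hs : SineSeq p lam s) (n : ℕ) (hn : n < p) :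
    Hs lam (2 * n + 1) = (s n + s (n + 1)) / (s (n + 1) + s (n + 2)) := by
  induction n with
  | zero =>
    have hs1 : 0 < s 1 := hs.pos 1 le_rfl (by omega)
    have hs2 : s 2 = lam * s 1 := by have := hs.rec' 0; simp [hs.h0] at this; exact this
    have hs2' : 0 < s 2 := hs.pos 2 (by omega) (by omega)
    have hl : 0 < lam := by by_contra! h; nlinarith
    simp only [zero_add, Hs, hs.h0, hs2]
    field_simp
    ring
  | succ n ih =>
    have h1 := hs.pos (n + 1) (by omega) (by omega)
    have h2 := hs.pos (n + 2) (by omega) (by omega)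
    have h3 := hs.pos (n + 3) (by omega) (by omega)
    rw [show 2 * (n + 1) + 1 = 2 * n + 3 by ring, Hs, ih (by omega)]
    have r1 := hs.rec' n
    have r2 := hs.rec' (n + 1)
    have e : lam - (s n + s (n + 1)) / (s (n + 1) + s (n + 2))
        = (s (n + 2) + s (n + 3)) / (s (n + 1) + s (n + 2)) := by
      field_simp
      linarith
    rw [e, one_div_div]

lemma Hs_even {p : ℕ} {lam : ℝ} {s : ℕ → ℝ} (hs : SineSeq p lam s) (n : ℕ) (hn : n < p) :
    Hs lam (2 * n + 2) = s (n + 1) / s (n + 2) := by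
  induction n with
  | zero =>
    have hs1 : 0 < s 1 := hs.pos 1 le_rfl (by omega)
    have hs2 : s 2 = lam * s 1 := by have := hs.rec' 0; simp [hs.h0] at this; exact this
    have hs2' : 0 < s 2 := hs.pos 2 (by omega) (by omega)
    have hl : 0 < lam := by by_contra! h; nlinarith
    simp only [zero_add, Hs, hs2]
    field_simp
  | succ n ih =>
    have h1 := hs.pos (n + 1) (by omega) (by omega)
    have h2 := hs.pos (n + 2) (by omega) (by omega)
    have h3 := hs.pos (n + 3) (by omega) (by omega)
    rw [show 2 * (n + 1) + 2 = (2 * n + 1) + 3 by ring, Hs, show 2 * n + 1 + 1 = 2 * n + 2 by ring,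
      ih (by omega)]
    have r2 := hs.rec' (n + 1)
    have e : lam - s (n + 1) / s (n + 2) = s (n + 3) / s (n + 2) := by
      field_simp
      linarith
    rw [e, one_div_div]

lemma mem_Omega {p : ℕ} (hp : 3 ≤ p) {lam α : ℝ} {s : ℕ → ℝ} (hs : SineSeq p lam s)
    (t v : ℝ) (hv : 0 ≤ v) (ht : t < rseq lam α 0) (k : ℕ) :
    ∀ n, n + k + 1 = p → lseq lam α n ≤ t → v ≤ Hs lam (2 * n + 1) →
      (t, v) ∈ OmegaEven lam α p := by
  induction k with
  | zero =>
    intro n hn h1 h2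
    right
    have : n = p - 1 := by omega
    refine ⟨⟨by rw [← this]; exact h1, ht⟩, hv, ?_⟩
    rw [show 2 * p - 1 = 2 * n + 1 by omega]; exact h2
  | succ k ih =>
    intro n hn h1 h2
    have p0 := s_nonneg hs n (by omega)
    have p1 := hs.pos (n + 1) (by omega) (by omega)
    have p2 := hs.pos (n + 2) (by omega) (by omega)
    have p3 := hs.pos (n + 3) (by omega) (by omega)
    have c0 := hs.casorati n
    have c1 := hs.casorati (n + 1)
    have hsq : 0 ≤ s 1 ^ 2 := sq_nonneg _
    by_cases hr : t < rseq lam α (n + 1)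
    · left; left
      simp only [Set.mem_iUnion]
      refine ⟨n + 1, by simp; omega, ⟨?_, hr⟩, hv, ?_⟩
      · simpa using h1
      · exact h2
    · push Not at hr
      have hH1 : Hs lam (2 * n + 1) ≤ Hs lam (2 * n + 2) := by
        rw [Hs_odd hs n (by omega), Hs_even hs n (by omega), div_le_div_iff₀ (by positivity) p2]
        nlinarith
      by_cases hl : t < lseq lam α (n + 1)
      · left; right
        simp only [Set.mem_iUnion]
        refine ⟨n + 1, by simp; omega, ⟨hr, hl⟩, hv, ?_⟩
        exact h2.trans hH1
      · push Not at hl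
        have hH2 : Hs lam (2 * n + 2) ≤ Hs lam (2 * (n + 1) + 1) := by
          rw [Hs_odd hs (n + 1) (by omega), Hs_even hs n (by omega),
            div_le_div_iff₀ p2 (by positivity)]
          simp only [show n + 1 + 1 = n + 2 from rfl, show n + 1 + 2 = n + 3 from rfl] at *
          nlinarith
        exact ih (n + 1) (by omega) hl (h2.trans (hH1.trans hH2))

lemma Dd_ineq {p : ℕ} (hp : 3 ≤ p) {lam : ℝ} {s : ℕ → ℝ} (hs : SineSeq p lam s)
    {w v : ℝ} (hw' : w < lam + 1) (hv' : v ≤ lam - 1) (hwv : w - v < 2) (n : ℕ) (hn : n < p) :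
    s 1 ^ 2 * (w - v) < 2 * (Dd s lam w n * Dd s lam v n) := by
  have hs1 : 0 < s 1 := hs.pos 1 le_rfl (by omega)
  have h1 := hs.lt n hn
  have h2 := s_nonneg hs n (by omega)
  have h3 := hs.diff n hn
  have hA : s (n + 1) - s n ≤ Dd s lam w n := by unfold Dd; nlinarith
  have hB : s (n + 1) + s n ≤ Dd s lam v n := by unfold Dd; nlinarith
  have : (s (n + 1) - s n) * (s (n + 1) + s n) ≤ Dd s lam w n * Dd s lam v n :=
    mul_le_mul hA hB (by linarith) (by linarith)
  have h4 : s 1 ^ 2 * (w - v) < s 1 ^ 2 * 2 := by gcongr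
  nlinarith

/-- Coordinates `w = -1/t` of the points of `A ∩ D`. -/
structure Good (lam α w v : ℝ) : Prop where
  hw : (α + 1) * lam ≤ w
  hw' : w < lam + 1
  hv : 0 ≤ v
  hv' : v ≤ lam - 1
  hwv : w - v < 2

/-- The standing hypotheses. -/
structure Par (p : ℕ) (lam α : ℝ) (s : ℕ → ℝ) : Prop where
  hp : 3 ≤ p
  hs : SineSeq p lam s
  hl0 : 0 < lam
  hl1 : 1 < lam
  hl2 : lam < 2
  hl3 : 3 ≤ lam ^ 2
  hα : 1 / 2 < α
  hα' : α * lam < 1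

lemma good_of_mem {p : ℕ} {lam α : ℝ} {s : ℕ → ℝ} (P : Par p lam α s) {t v : ℝ}
    (h : (t, v) ∈ regA lam α ∩ DEven lam α p) : ∃ w, t = -(1 / w) ∧ Good lam α w v := by
  obtain ⟨⟨h1, h2, h3, h4⟩, -, h5, h6⟩ := h
  simp only at h1 h2 h3 h4 h5 h6
  have hl := P.hl0
  have hl1 := P.hl1
  have hα := P.hα
  have hd : 0 < 1 / (lam + 1) := by positivity
  have ht : t < 0 := by linarith
  have hpos : 0 < 1 + t * v := by
    by_contra! hc
    have : |t| / (1 + t * v) ≤ 0 := div_nonpos_of_nonneg_of_nonpos (abs_nonneg _) hc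
    linarith
  rw [abs_of_neg ht, div_lt_div_iff₀ (by norm_num) hpos] at h6
  obtain ⟨w, hw⟩ : ∃ w, w = -(1 / t) := ⟨_, rfl⟩
  have hwpos : 0 < w := by
    rw [hw]; have := one_div_neg.mpr ht; linarith
  have htn := ht.ne
  have htw : t = -(1 / w) := by rw [hw]; field_simp
  have hwt : w * t = -1 := by rw [hw, neg_mul, one_div_mul_cancel htn]
  have hb : (1 / ((α + 1) * lam)) * ((α + 1) * lam) = 1 := by field_simp
  have hb' : (1 / (lam + 1)) * (lam + 1) = 1 := by field_simp
  have hw1 : (α + 1) * lam ≤ w := by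
    by_contra! hc
    have hx : 0 < (α + 1) * lam := by positivity
    nlinarith
  have hwv : w - v < 2 := by
    have : w * (1 * (1 + t * v)) < w * (-t * 2) := by gcongr
    nlinarith
  have hw2 : w ≤ lam + 1 := by
    by_contra! hc
    nlinarith
  have hl3 := P.hl3
  refine ⟨w, htw, hw1, by linarith, ?_, h4, hwv⟩
  have : 3 / 2 * lam ≤ (α + 1) * lam := by gcongr; linarith
  have : 4 / 3 ≤ lam := by nlinarith
  linarith

lemma round_mem {p : ℕ} {lam α : ℝ} {s : ℕ → ℝ} (P : Par p lam α s) {w v : ℝ}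
    (G : Good lam α w v) (n : ℕ) (hn : n + 2 ≤ p) :
    (rosenNE lam α)^[n + 1] (-(1 / w), v) ∈ DEven lam α p := by
  obtain ⟨hp, hs, hl0, hl1, hl2, hl3, hα, hα'⟩ := P
  obtain ⟨hw, hw', hv, hv', hwv⟩ := G
  rw [(Dd_orbit hp hs hl0 hl1 hl2 hα hα' hw hw' hv' n hn).1]
  have hs1 : 0 < s 1 := hs.pos 1 le_rfl (by omega)
  have hwv0 : 0 < w - v := by nlinarith
  have a0 := Dd_pos hs hw'.le (n := n) (by omega)
  have a1 := Dd_pos hs hw'.le (n := n + 1) (by omega)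
  have b0 := Dd_pos hs (w := v) (by linarith) (n := n) (by omega)
  have b1 := Dd_pos hs (w := v) (by linarith) (n := n + 1) (by omega)
  have i0 := Dd_ineq hp hs hw' hv' hwv n (by omega)
  have i1 := Dd_ineq hp hs hw' hv' hwv (n + 1) (by omega)
  have wr := Dd_wronski hs w v n
  have l0 := lseq_eq hp hs hl0 hl1 hl2 hα hα' n hn
  have wr0 := Dd_wronski hs w ((α + 1) * lam) n
  have wr1 := Dd_wronski hs v (lam - 1) n
  have c0 := Dd_pos hs (w := (α + 1) * lam) (by linarith) (n := n) (by omega)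
  have c1 := Dd_pos hs (w := (α + 1) * lam) (by linarith) (n := n + 1) (by omega)
  have e0 := Dd_pos hs (w := lam - 1) (by linarith) (n := n) (by omega)
  have e1 := Dd_pos hs (w := lam - 1) (by linarith) (n := n + 1) (by omega)
  have hodd := Hs_odd hs n (by omega)
  have hE0 : Dd s lam (lam - 1) n = s n + s (n + 1) := by unfold Dd; ring
  have hE1 : Dd s lam (lam - 1) (n + 1) = s (n + 1) + s (n + 2) := by unfold Dd; ring
  rw [← hE0, ← hE1] at hodd
  generalize Dd s lam (lam - 1) n = E0 at *
  generalize Dd s lam (lam - 1) (n + 1) = E1 at *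
  generalize Dd s lam ((α + 1) * lam) n = C0 at *
  generalize Dd s lam ((α + 1) * lam) (n + 1) = C1 at *
  generalize Dd s lam w n = A0 at *
  generalize Dd s lam w (n + 1) = A1 at *
  generalize Dd s lam v n = B0 at *
  generalize Dd s lam v (n + 1) = B1 at *
  have hsq : 0 < s 1 ^ 2 := by positivity
  have q : 0 < A0 * B1 - B0 * A1 := by rw [wr]; positivity
  refine ⟨mem_Omega hp hs _ _ (by positivity) ?_ (p - 1 - n) n (by omega) ?_ ?_, ?_, ?_⟩
  · have h1 : 0 < A1 / A0 := by positivity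
    have h2 : 0 < α * lam := by positivity
    simp only [rseq, Function.iterate_zero, id]
    linarith
  · rw [l0, neg_le_neg_iff, div_le_div_iff₀ a0 c0]
    nlinarith
  · rw [hodd, div_le_div_iff₀ b1 e1]
    nlinarith
  · simp only
    rw [show B0 / B1 / (1 + -(A1 / A0) * (B0 / B1)) = B0 * A0 / (A0 * B1 - B0 * A1) by
      rw [show 1 + -(A1 / A0) * (B0 / B1) = (A0 * B1 - B0 * A1) / (A0 * B1) by field_simp; ring]
      field_simp]
    rw [div_lt_div_iff₀ (by norm_num) q]
    linarith
  · simp only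
    rw [abs_neg, abs_of_pos (by positivity),
      show A1 / A0 / (1 + -(A1 / A0) * (B0 / B1)) = A1 * B1 / (A0 * B1 - B0 * A1) by
      rw [show 1 + -(A1 / A0) * (B0 / B1) = (A0 * B1 - B0 * A1) / (A0 * B1) by field_simp; ring]
      field_simp]
    rw [div_lt_div_iff₀ (by norm_num) q]
    linarith

/-- One round in the coordinate `w = -1/t` (and also in the coordinate `v`). -/
noncomputable def Rm (lam z : ℝ) : ℝ :=
  (lam + (lam - z) * (lam ^ 2 - 2)) / (2 + (lam - z) * lam)

lemma round_end {p : ℕ} {lam α : ℝ} {s : ℕ → ℝ} (P : Par p lam α s) {w v : ℝ}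
    (G : Good lam α w v) :
    (rosenNE lam α)^[p - 1] (-(1 / w), v) = (-(1 / Rm lam w), Rm lam v) := by
  obtain ⟨hp, hs, hl0, hl1, hl2, hl3, hα, hα'⟩ := P
  obtain ⟨hw, hw', hv, hv', hwv⟩ := G
  obtain ⟨n, rfl⟩ : ∃ n, p = n + 2 := ⟨p - 2, by omega⟩
  have h := (Dd_orbit hp hs hl0 hl1 hl2 hα hα' hw hw' hv' n (by omega)).1
  rw [show n + 2 - 1 = n + 1 by omega, h]
  have h1 : s (n + 2) = 1 := hs.top
  have h2 : s (n + 1) = lam / 2 := hs.top'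
  have h3 : s n = lam ^ 2 / 2 - 1 := by
    have := hs.rec' n
    rw [h1, h2] at this; linarith
  have e0 : ∀ z, Dd s lam z n = (lam + (lam - z) * (lam ^ 2 - 2)) / 2 := by
    intro z; unfold Dd; rw [h2, h3]; ring
  have e1 : ∀ z, Dd s lam z (n + 1) = (2 + (lam - z) * lam) / 2 := by
    intro z; unfold Dd; rw [show n + 1 + 1 = n + 2 from rfl, h1, h2]; ring
  simp only [e0, e1, Rm, one_div_div]
  ext
  · simp only []
    rw [div_div_div_cancel_right₀ (by norm_num)]
  · simp only []
    rw [div_div_div_cancel_right₀ (by norm_num)]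

lemma Rm_good {p : ℕ} {lam α : ℝ} {s : ℕ → ℝ} (P : Par p lam α s) {w v : ℝ}
    (G : Good lam α w v) :
    lam < Rm lam w ∧ Rm lam w < w ∧ 0 ≤ Rm lam v ∧ Rm lam v ≤ lam - 1 ∧
      Rm lam w - Rm lam v < 2 := by
  obtain ⟨hp, hs, hl0, hl1, hl2, hl3, hα, hα'⟩ := P
  obtain ⟨hw, hw', hv, hv', hwv⟩ := G
  have hαl : lam / 2 < α * lam := by nlinarith
  have d1 : 0 < 2 + (lam - w) * lam := by nlinarith
  have d2 : 0 < 2 + (lam - v) * lam := by nlinarith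
  have a1 : lam < Rm lam w := by
    unfold Rm; rw [lt_div_iff₀ d1]
    nlinarith
  have a2 : Rm lam w < w := by
    unfold Rm; rw [div_lt_iff₀ d1]
    have : 0 < lam * ((w - lam + 1) * (lam + 1 - w)) := by
      apply mul_pos hl0; apply mul_pos <;> nlinarith
    nlinarith
  have b1 : v ≤ Rm lam v := by
    unfold Rm; rw [le_div_iff₀ d2]
    have : 0 ≤ lam * ((lam - 1 - v) * (lam + 1 - v)) := by
      apply mul_nonneg hl0.le; apply mul_nonneg <;> linarith
    nlinarith
  have b2 : Rm lam v ≤ lam - 1 := by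
    unfold Rm; rw [div_le_iff₀ d2]
    have : 0 ≤ (2 - lam) * (lam - 1 - v) := by
      apply mul_nonneg <;> linarith
    nlinarith
  exact ⟨a1, a2, by linarith, b2, by linarith⟩

lemma Rm_good' {p : ℕ} {lam α : ℝ} {s : ℕ → ℝ} (P : Par p lam α s) {w v : ℝ}
    (G : Good lam α w v) (h : (α + 1) * lam ≤ Rm lam w) :
    Good lam α (Rm lam w) (Rm lam v) := by
  obtain ⟨h1, h2, h3, h4, h5⟩ := Rm_good P G
  exact ⟨h, h2.trans G.hw', h3, h4, h5⟩

/-- The next approximation coefficient is below `1/2`. -/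
def Exits (tv : ℝ × ℝ) : Prop :=
  0 < 1 + tv.1 * tv.2 ∧ |tv.1| / (1 + tv.1 * tv.2) < 1 / 2

lemma Exits.not_mem {p : ℕ} {lam α : ℝ} {tv : ℝ × ℝ} (h : Exits tv) : tv ∉ DEven lam α p := by
  rintro ⟨-, -, h2⟩
  exact absurd h.2 (not_lt.mpr h2.le)

lemma round_exit {p : ℕ} {lam α : ℝ} {s : ℕ → ℝ} (P : Par p lam α s) {w v : ℝ}
    (G : Good lam α w v) (h : Rm lam w < (α + 1) * lam) :
    Exits ((rosenNE lam α)^[p - 1 + 1] (-(1 / w), v)) := by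
  rw [Function.iterate_succ_apply', round_end P G]
  obtain ⟨h1, h2, h3, h4, h5⟩ := Rm_good P G
  have hl0 := P.hl0
  have hα := P.hα
  have hα' := P.hα'
  have hl1 := P.hl1
  generalize Rm lam w = a at *
  generalize Rm lam v = b at *
  have hα1 : α * lam ≤ lam := by linarith
  rw [rosenNE_neg 1 hl0 (by linarith) (by push_cast; linarith) (by push_cast; linarith)]
  have hb : 0 < lam - b := by linarith
  have ha : 0 < a - lam := by linarith
  have e : 1 + (a - lam) * (1 / (lam - b)) = (a - b) / (lam - b) := by field_simp; ring
  unfold Exits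
  simp only [Int.cast_one, one_mul]
  rw [e]
  have hab : 0 < a - b := by linarith
  refine ⟨by positivity, ?_⟩
  rw [abs_of_pos ha, div_div_eq_mul_div, div_lt_div_iff₀ hab (by norm_num)]
  nlinarith [sq_nonneg (a - lam - (lam - b))]

/-- The thresholds in the coordinate `w = -1/t`. -/
noncomputable def Wseq (lam α : ℝ) : ℕ → ℝ
  | 0 => (α + 1) * lam
  | k + 1 => ((lam ^ 2 + 2) * Wseq lam α k - (lam ^ 3 - lam)) /
      (lam * Wseq lam α k - (lam ^ 2 - 2))

lemma Wseq_bounds {p : ℕ} {lam α : ℝ} {s : ℕ → ℝ} (P : Par p lam α s) (k : ℕ) :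
    (α + 1) * lam ≤ Wseq lam α k ∧ Wseq lam α k < lam + 1 ∧
      Wseq lam α k ≤ Wseq lam α (k + 1) ∧ 0 < lam * Wseq lam α k - (lam ^ 2 - 2) := by
  obtain ⟨hp, hs, hl0, hl1, hl2, hl3, hα, hα'⟩ := P
  have gen : ∀ W, (α + 1) * lam ≤ W → W < lam + 1 → 0 < lam * W - (lam ^ 2 - 2) ∧
      W ≤ ((lam ^ 2 + 2) * W - (lam ^ 3 - lam)) / (lam * W - (lam ^ 2 - 2)) ∧
      ((lam ^ 2 + 2) * W - (lam ^ 3 - lam)) / (lam * W - (lam ^ 2 - 2)) < lam + 1 := by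
    intro W h1 h2
    have hWl : lam < W := by nlinarith
    have d : 0 < lam * W - (lam ^ 2 - 2) := by nlinarith
    refine ⟨d, ?_, ?_⟩
    · rw [le_div_iff₀ d]
      have : 0 ≤ lam * ((lam + 1 - W) * (W - lam + 1)) := by
        apply mul_nonneg hl0.le; apply mul_nonneg <;> linarith
      nlinarith
    · rw [div_lt_iff₀ d]
      have : 0 < (2 - lam) * (lam + 1 - W) := by
        apply mul_pos <;> linarith
      nlinarith
  have hb : (α + 1) * lam ≤ Wseq lam α k ∧ Wseq lam α k < lam + 1 := by
    induction k with
    | zero => exact ⟨le_rfl, by simp only [Wseq]; linarith⟩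
    | succ k ih =>
      obtain ⟨g1, g2, g3⟩ := gen _ ih.1 ih.2
      exact ⟨ih.1.trans g2, g3⟩
  obtain ⟨g1, g2, g3⟩ := gen _ hb.1 hb.2
  exact ⟨hb.1, hb.2, g2, g1⟩

lemma tau_eq {p : ℕ} {lam α : ℝ} {s : ℕ → ℝ} (P : Par p lam α s) (k : ℕ) :
    tauEven lam α k = -(1 / Wseq lam α k) := by
  induction k with
  | zero => rfl
  | succ k ih =>
    obtain ⟨h1, h2, h3, h4⟩ := Wseq_bounds P k
    obtain ⟨h1', -, -, -⟩ := Wseq_bounds P (k + 1)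
    have hl0 := P.hl0
    have hα := P.hα
    have hW : 0 < Wseq lam α k := lt_of_lt_of_le (by positivity) h1
    have hW' : 0 < Wseq lam α (k + 1) := lt_of_lt_of_le (by positivity) h1'
    have hn : 0 < (lam ^ 2 + 2) * Wseq lam α k - (lam ^ 3 - lam) := by
      by_contra! hc
      have : Wseq lam α (k + 1) ≤ 0 := div_nonpos_of_nonpos_of_nonneg hc h4.le
      linarith
    simp only [tauEven, Wseq, ih]
    generalize Wseq lam α k = W at *
    have e1 : (lam ^ 2 - 2) * -(1 / W) + lam = (lam * W - (lam ^ 2 - 2)) / W := by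
      field_simp; ring
    have e2 : (lam - lam ^ 3) * -(1 / W) - lam ^ 2 - 2
        = -(((lam ^ 2 + 2) * W - (lam ^ 3 - lam)) / W) := by
      field_simp; ring
    rw [e1, e2, one_div_div, div_neg, div_div_div_cancel_right₀ hW.ne']

lemma neg_inv_le_iff {a b : ℝ} (ha : 0 < a) (hb : 0 < b) : -(1 / a) ≤ -(1 / b) ↔ a ≤ b := by
  rw [neg_le_neg_iff, one_div_le_one_div hb ha]

lemma neg_inv_lt_iff {a b : ℝ} (ha : 0 < a) (hb : 0 < b) : -(1 / a) < -(1 / b) ↔ a < b := by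
  rw [neg_lt_neg_iff, one_div_lt_one_div hb ha]

lemma Wseq_le_Rm {p : ℕ} {lam α : ℝ} {s : ℕ → ℝ} (P : Par p lam α s) {w : ℝ}
    (hw' : w < lam + 1) (k : ℕ) :
    Wseq lam α k ≤ Rm lam w ↔ Wseq lam α (k + 1) ≤ w := by
  obtain ⟨-, -, -, h4⟩ := Wseq_bounds P k
  obtain ⟨hp, hs, hl0, hl1, hl2, hl3, hα, hα'⟩ := P
  have d1 : 0 < 2 + (lam - w) * lam := by nlinarith
  simp only [Wseq, Rm]
  rw [le_div_iff₀ d1, div_le_iff₀ h4]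
  constructor <;> intro h <;> nlinarith

lemma stay_fwd {p : ℕ} {lam α : ℝ} {s : ℕ → ℝ} (P : Par p lam α s) (m : ℕ) :
    ∀ w v : ℝ, Good lam α w v → Wseq lam α m ≤ w → w < Wseq lam α (m + 1) →
      (∀ j, 1 ≤ j → j ≤ (m + 1) * (p - 1) →
        (rosenNE lam α)^[j] (-(1 / w), v) ∈ DEven lam α p) ∧
      Exits ((rosenNE lam α)^[(m + 1) * (p - 1) + 1] (-(1 / w), v)) := by
  have hp := P.hp
  have hround : ∀ w v : ℝ, Good lam α w v → ∀ j, 1 ≤ j → j ≤ p - 1 →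
      (rosenNE lam α)^[j] (-(1 / w), v) ∈ DEven lam α p := by
    intro w v G j h1 h2
    have := round_mem P G (j - 1) (by omega)
    rwa [show j - 1 + 1 = j by omega] at this
  induction m with
  | zero =>
    intro w v G h1 h2
    have h3 : Rm lam w < (α + 1) * lam := by
      have := (Wseq_le_Rm P G.hw' 0).not.mpr (by simpa using h2)
      simpa [Wseq] using this
    refine ⟨fun j hj1 hj2 => hround w v G j hj1 (by simpa using hj2), ?_⟩
    simpa using round_exit P G h3
  | succ m ih =>
    intro w v G h1 h2
    have h3 : Wseq lam α m ≤ Rm lam w := (Wseq_le_Rm P G.hw' m).mpr h1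
    have h4 : Rm lam w < Wseq lam α (m + 1) := by
      have := (Wseq_le_Rm P G.hw' (m + 1)).not.mpr (by simpa using h2)
      simpa using this
    have G' := Rm_good' P G ((Wseq_bounds P m).1.trans h3)
    obtain ⟨i1, i2⟩ := ih _ _ G' h3 h4
    rw [← round_end P G] at i1 i2
    constructor
    · intro j hj1 hj2
      by_cases hj : j ≤ p - 1
      · exact hround w v G j hj1 hj
      · have := i1 (j - (p - 1)) (by omega) (by
          have : (m + 1 + 1) * (p - 1) = (m + 1) * (p - 1) + (p - 1) := by ring
          omega)
        rwa [← Function.iterate_add_apply, show j - (p - 1) + (p - 1) = j by omega] at this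
    · rw [← Function.iterate_add_apply] at i2
      rwa [show (m + 1 + 1) * (p - 1) + 1 = (m + 1) * (p - 1) + 1 + (p - 1) by ring]

lemma stay_bwd {p : ℕ} {lam α : ℝ} {s : ℕ → ℝ} (P : Par p lam α s) (m : ℕ) :
    ∀ w v : ℝ, Good lam α w v →
      (∀ j, j ≤ (m + 1) * (p - 1) →
        (rosenNE lam α)^[j] (-(1 / w), v) ∈ DEven lam α p) →
      (rosenNE lam α)^[(m + 1) * (p - 1) + 1] (-(1 / w), v) ∉ DEven lam α p →
      Wseq lam α m ≤ w ∧ w < Wseq lam α (m + 1) := by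
  have hp := P.hp
  induction m with
  | zero =>
    intro w v G h1 h2
    refine ⟨G.hw, ?_⟩
    by_contra! hc
    have h3 := (Wseq_le_Rm P G.hw' 0).mpr hc
    have G' := Rm_good' P G h3
    have := round_mem P G' 0 (by omega)
    rw [← round_end P G, ← Function.iterate_add_apply] at this
    apply h2
    rwa [show (0 + 1) * (p - 1) + 1 = 0 + 1 + (p - 1) by ring]
  | succ m ih =>
    intro w v G h1 h2
    have hm : (m + 1 + 1) * (p - 1) = (m + 1) * (p - 1) + (p - 1) := by ring
    have h3 : (α + 1) * lam ≤ Rm lam w := by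
      by_contra! hc
      refine (round_exit P G hc).not_mem (h1 (p - 1 + 1) ?_)
      have : (m + 1) * (p - 1) = m * (p - 1) + (p - 1) := by ring
      omega
    have G' := Rm_good' P G h3
    have := ih _ _ G' (fun j hj => by
      rw [← round_end P G, ← Function.iterate_add_apply]
      exact h1 _ (by omega)) (by
      rw [← round_end P G, ← Function.iterate_add_apply]
      rwa [show (m + 1) * (p - 1) + 1 + (p - 1) = (m + 1 + 1) * (p - 1) + 1 by ring])
    refine ⟨(Wseq_le_Rm P G.hw' m).mp this.1, ?_⟩
    have h5 := (Wseq_le_Rm P G.hw' (m + 1)).not.mp (by simpa using this.2)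
    simpa using h5

lemma part_a {p : ℕ} {lam α : ℝ} {s : ℕ → ℝ} (P : Par p lam α s) (m : ℕ) (t v : ℝ)
    (h : (t, v) ∈ regA lam α ∩ DEven lam α p) :
    (((∀ j : ℕ, j ≤ (m + 1) * (p - 1) → (rosenNE lam α)^[j] (t, v) ∈ DEven lam α p) ∧
          (rosenNE lam α)^[(m + 1) * (p - 1) + 1] (t, v) ∉ DEven lam α p) ↔
        (tauEven lam α m ≤ t ∧ t < tauEven lam α (m + 1))) ∧
    (tauEven lam α m ≤ t ∧ t < tauEven lam α (m + 1) →
      (∀ j : ℕ, j ≤ (m + 1) * (p - 1) → (rosenNE lam α)^[j] (t, v) ∈ DEven lam α p) ∧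
          Exits ((rosenNE lam α)^[(m + 1) * (p - 1) + 1] (t, v))) := by
  obtain ⟨w, rfl, G⟩ := good_of_mem P h
  have hl0 := P.hl0
  have hα := P.hα
  have hx : 0 < (α + 1) * lam := by positivity
  have hW : ∀ k, 0 < Wseq lam α k := fun k => lt_of_lt_of_le hx (Wseq_bounds P k).1
  have hw : 0 < w := lt_of_lt_of_le hx G.hw
  rw [tau_eq P, tau_eq P, neg_inv_le_iff (hW _) hw, neg_inv_lt_iff hw (hW _)]
  have key : Wseq lam α m ≤ w ∧ w < Wseq lam α (m + 1) →
      (∀ j : ℕ, j ≤ (m + 1) * (p - 1) → (rosenNE lam α)^[j] (-(1 / w), v) ∈ DEven lam α p) ∧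
          Exits ((rosenNE lam α)^[(m + 1) * (p - 1) + 1] (-(1 / w), v)) := by
    rintro ⟨h1, h2⟩
    obtain ⟨a, b⟩ := stay_fwd P m w v G h1 h2
    refine ⟨fun j hj => ?_, b⟩
    rcases Nat.eq_zero_or_pos j with h0 | h0
    · subst h0; exact h.2
    · exact a j h0 hj
  refine ⟨⟨fun ⟨a, b⟩ => stay_bwd P m w v G a b, fun hh => ?_⟩, key⟩
  exact ⟨(key hh).1, (key hh).2.not_mem⟩

lemma lseq_step {p : ℕ} {lam α : ℝ} {s : ℕ → ℝ} (P : Par p lam α s) (i : ℕ) (hi : i + 2 ≤ p) :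
    ∃ wl, 0 < wl ∧ lseq lam α i = -(1 / wl) ∧ lseq lam α (i + 1) = wl - lam ∧
      (i + 2 = p → lam < wl) := by
  have P' := P
  obtain ⟨hp, hs, hl0, hl1, hl2, hl3, hα, hα'⟩ := P
  have c0 := Dd_pos hs (w := (α + 1) * lam) (by linarith) (n := i) (by omega)
  have c1 := Dd_pos hs (w := (α + 1) * lam) (by linarith) (n := i + 1) (by omega)
  have l0 := lseq_eq hp hs hl0 hl1 hl2 hα hα' i hi
  refine ⟨Dd s lam ((α + 1) * lam) i / Dd s lam ((α + 1) * lam) (i + 1), by positivity,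
    by rw [l0, one_div_div], ?_⟩
  by_cases h : i + 2 = p
  · have G : Good lam α ((α + 1) * lam) (lam - 1) :=
      ⟨le_rfl, by linarith, by linarith, le_rfl, by linarith⟩
    obtain ⟨r1, r2, -, -, -⟩ := Rm_good P' G
    have e := congrArg Prod.fst (round_end P' G)
    have e' := congrArg Prod.fst
      (Dd_orbit hp hs hl0 hl1 hl2 hα hα' G.hw G.hw' G.hv' i hi).1
    rw [show p - 1 = i + 1 by omega, e'] at e
    simp only at e
    have hwl : Dd s lam ((α + 1) * lam) i / Dd s lam ((α + 1) * lam) (i + 1)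
        = Rm lam ((α + 1) * lam) := by
      have e2 : Dd s lam ((α + 1) * lam) (i + 1) / Dd s lam ((α + 1) * lam) i
        = 1 / Rm lam ((α + 1) * lam) := by linarith
      rw [← one_div_div, e2, one_div_one_div]
    refine ⟨?_, fun _ => by rw [hwl]; exact r1⟩
    have st : lseq lam α (i + 1) = rosenT lam α (lseq lam α i) := by
      unfold lseq; rw [Function.iterate_succ_apply']
    rw [st, l0, ← one_div_div, hwl]
    have hα1 : α * lam ≤ lam := by linarith
    have h := rosenNE_neg (lam := lam) (α := α) (w := Rm lam ((α + 1) * lam)) (v := 0) 1 hl0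
      (by linarith) (by push_cast; linarith) (by push_cast; linarith)
    have h' := congrArg Prod.fst h
    simp only [rosenNE] at h'
    rw [h']; push_cast; ring
  · refine ⟨?_, fun hh => absurd hh h⟩
    rw [lseq_eq hp hs hl0 hl1 hl2 hα hα' (i + 1) (by omega), Dd_rec hs]
    rw [sub_div, mul_div_assoc, div_self c1.ne']
    ring

/-- A coarse invariant region for the natural extension. -/
def CoarseInv (p : ℕ) (lam α : ℝ) (s : ℕ → ℝ) (t v : ℝ) : Prop :=
  (α - 1) * lam ≤ t ∧ t < α * lam ∧ 0 ≤ v ∧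
    ∃ i, i + 1 ≤ p ∧ lseq lam α i ≤ t ∧ v ≤ s (i + 1) / s (i + 2)

lemma rosenT_range {lam α t : ℝ} (hl : 0 < lam) (ht : t ≠ 0) :
    (α - 1) * lam ≤ rosenT lam α t ∧ rosenT lam α t < α * lam := by
  have e : Real.sign t / t = |1 / (lam * t)| * lam := by
    rw [abs_div, abs_one, abs_mul, abs_of_pos hl]
    rcases lt_or_gt_of_ne ht with h | h
    · rw [Real.sign_of_neg h, abs_of_neg h]; field_simp
    · rw [Real.sign_of_pos h, abs_of_pos h]; field_simp
  unfold rosenT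
  rw [if_neg ht, e]
  have h1 := Int.floor_le (|1 / (lam * t)| + 1 - α)
  have h2 := Int.lt_floor_add_one (|1 / (lam * t)| + 1 - α)
  unfold rosenD
  constructor <;> nlinarith

lemma rosenT_ne {lam α t : ℝ} (ht : t ≠ 0) :
    rosenT lam α t = Real.sign t / t - lam * rosenD lam α t := by
  unfold rosenT
  rw [if_neg ht]

lemma rosenD_pos {p : ℕ} {lam α : ℝ} {s : ℕ → ℝ} (P : Par p lam α s) {t : ℝ}
    (h1 : (α - 1) * lam ≤ t) (h2 : t < α * lam) (ht : t ≠ 0) : 1 ≤ rosenD lam α t := by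
  have hl0 := P.hl0
  have hα := P.hα
  have hα' := P.hα'
  unfold rosenD
  rw [Int.le_floor]
  push_cast
  have ha : 0 < |t| := abs_pos.mpr ht
  have hb : |t| ≤ α * lam := by
    rw [abs_le]; constructor <;> nlinarith
  have : α ≤ |1 / (lam * t)| := by
    rw [abs_div, abs_one, abs_mul, abs_of_pos hl0, le_div_iff₀ (by positivity)]
    have : α * (lam * |t|) ≤ α * (lam * (α * lam)) := by gcongr
    nlinarith
  linarith

lemma coarseInv_step {p : ℕ} {lam α : ℝ} {s : ℕ → ℝ} (P : Par p lam α s) {t v : ℝ}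
    (h : CoarseInv p lam α s t v) (ht : t ≠ 0) :
    0 < (rosenD lam α t : ℝ) * lam + Real.sign t * v ∧
      CoarseInv p lam α s (rosenT lam α t)
        (1 / ((rosenD lam α t : ℝ) * lam + Real.sign t * v)) := by
  obtain ⟨h1, h2, hv, i, hi, hli, hvi⟩ := h
  have hd := rosenD_pos P h1 h2 ht
  have P' := P
  obtain ⟨hp, hs, hl0, hl1, hl2, hl3, hα, hα'⟩ := P
  have hr := rosenT_range (α := α) hl0 ht
  have hs1 : 0 < s 1 := hs.pos 1 le_rfl (by omega)
  have hs2 : s 2 = lam * s 1 := by have := hs.rec' 0; simp [hs.h0] at this; exact this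
  have h12 : s (0 + 1) / s (0 + 2) = 1 / lam := by
    simp only [zero_add, hs2]; field_simp
  have hd' : (1 : ℝ) ≤ rosenD lam α t := by exact_mod_cast hd
  have hdl : lam ≤ (rosenD lam α t : ℝ) * lam := by nlinarith
  have hp1 := hs.pos (i + 1) (by omega) (by omega)
  have hp2 := hs.pos (i + 2) (by omega) (by omega)
  have hvl : v < lam := by
    refine lt_of_le_of_lt hvi ?_
    rw [div_lt_iff₀ hp2]
    by_cases hip : i + 1 = p
    · have a1 : s (i + 1) = 1 := by rw [hip]; exact hs.top
      have a0 : s i = lam / 2 := by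
        have := hs.top'; rwa [show p - 1 = i by omega] at this
      rw [hs.rec' i, a1, a0]; nlinarith
    · have := hs.pos (i + 3) (by omega) (by omega)
      have r := hs.rec' (i + 1)
      rw [show i + 1 + 2 = i + 3 from rfl, show i + 1 + 1 = i + 2 from rfl] at r
      linarith
  have simple : lam ≤ (rosenD lam α t : ℝ) * lam + Real.sign t * v →
      0 < (rosenD lam α t : ℝ) * lam + Real.sign t * v ∧
      CoarseInv p lam α s (rosenT lam α t)
        (1 / ((rosenD lam α t : ℝ) * lam + Real.sign t * v)) := by
    intro hq
    have hq0 : 0 < (rosenD lam α t : ℝ) * lam + Real.sign t * v := by linarith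
    refine ⟨hq0, hr.1, hr.2, by positivity, 0, by omega, hr.1, ?_⟩
    rw [h12]
    exact one_div_le_one_div_of_le hl0 hq
  rcases lt_or_gt_of_ne ht with hneg | hpos
  · by_cases hd2 : 2 ≤ rosenD lam α t
    · apply simple
      have : (2 : ℝ) ≤ rosenD lam α t := by exact_mod_cast hd2
      rw [Real.sign_of_neg hneg]; nlinarith
    · have hd1 : rosenD lam α t = 1 := by omega
      have hip : i + 2 ≤ p := by
        by_contra hc
        obtain ⟨wl, w0, e1, e2, e3⟩ := lseq_step P' (p - 2) (by omega)
        have := e3 (by omega)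
        rw [show p - 2 + 1 = i by omega] at e2
        linarith
      obtain ⟨wl, w0, e1, e2, -⟩ := lseq_step P' i hip
      have eT : rosenT lam α t = -(1 / t) - lam := by
        unfold rosenT
        rw [if_neg ht, hd1, Real.sign_of_neg hneg]; push_cast; ring
      rw [hd1, Real.sign_of_neg hneg]
      push_cast
      have hq : 0 < 1 * lam + -1 * v := by linarith
      refine ⟨hq, hr.1, hr.2, by positivity, i + 1, by omega, ?_, ?_⟩
      · rw [e2, eT]
        rw [e1] at hli
        have hw : 0 < -(1 / t) := by
          have := one_div_neg.mpr hneg; linarith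
        have htw : t = -(1 / -(1 / t)) := by field_simp
        rw [htw, neg_inv_le_iff w0 hw] at hli
        linarith
      · have hp3 := hs.pos (i + 3) (by omega) (by omega)
        have r := hs.rec' (i + 1)
        rw [show i + 1 + 2 = i + 3 from rfl, show i + 1 + 1 = i + 2 from rfl] at r
        rw [show i + 1 + 2 = i + 3 from rfl, show i + 1 + 1 = i + 2 from rfl,
          div_le_div_iff₀ hq hp3]
        rw [le_div_iff₀ hp2] at hvi
        nlinarith
  · apply simple
    rw [Real.sign_of_pos hpos]; linarith

lemma orbit_facts {p : ℕ} {lam α : ℝ} {s : ℕ → ℝ} (P : Par p lam α s) {x : ℝ}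
    (hx : x ∈ Set.Ico ((α - 1) * lam) (α * lam)) (hirr : GIrrational lam α x) (m : ℕ) :
    0 < rosenPQ lam α x 0 1 (m + 1) ∧
    (rosenNE lam α)^[m] (x, 0) =
      ((rosenT lam α)^[m] x, rosenPQ lam α x 0 1 m / rosenPQ lam α x 0 1 (m + 1)) ∧
    x * (rosenPQ lam α x 0 1 (m + 1) + (rosenT lam α)^[m] x * rosenPQ lam α x 0 1 m) =
      rosenPQ lam α x 1 0 (m + 1) + (rosenT lam α)^[m] x * rosenPQ lam α x 1 0 m ∧
    |rosenPQ lam α x 1 0 m * rosenPQ lam α x 0 1 (m + 1) -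
      rosenPQ lam α x 1 0 (m + 1) * rosenPQ lam α x 0 1 m| = 1 ∧
    CoarseInv p lam α s ((rosenT lam α)^[m] x)
      (rosenPQ lam α x 0 1 m / rosenPQ lam α x 0 1 (m + 1)) := by
  induction m with
  | zero =>
    have hs1 := P.hs.pos 1 le_rfl (by omega)
    have hs2 := P.hs.pos 2 (by omega) (by have := P.hp; omega)
    refine ⟨by simp [rosenPQ], by simp [rosenPQ], by simp [rosenPQ], by simp [rosenPQ], ?_⟩
    refine ⟨hx.1, hx.2, by simp [rosenPQ], 0, by have := P.hp; omega, hx.1, ?_⟩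
    simp only [rosenPQ]
    simp only [zero_add, zero_div]
    positivity
  | succ m ih =>
    obtain ⟨i1, i2, i3, i4, i5⟩ := ih
    have ht := hirr m
    obtain ⟨j1, j2⟩ := coarseInv_step P i5 ht
    have eT : rosenT lam α ((rosenT lam α)^[m] x) = Real.sign ((rosenT lam α)^[m] x) /
        ((rosenT lam α)^[m] x) - lam * rosenD lam α ((rosenT lam α)^[m] x) := rosenT_ne ht
    have hsg : Real.sign ((rosenT lam α)^[m] x) = 1 ∨ Real.sign ((rosenT lam α)^[m] x) = -1 := by
      rcases lt_or_gt_of_ne ht with h | h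
      · right; exact Real.sign_of_neg h
      · left; exact Real.sign_of_pos h
    have q2 : rosenPQ lam α x 0 1 (m + 1 + 1) =
        (rosenD lam α ((rosenT lam α)^[m] x) : ℝ) * lam * rosenPQ lam α x 0 1 (m + 1)
        + Real.sign ((rosenT lam α)^[m] x) * rosenPQ lam α x 0 1 m := by
      simp only [rosenPQ]
    have p2 : rosenPQ lam α x 1 0 (m + 1 + 1) =
        (rosenD lam α ((rosenT lam α)^[m] x) : ℝ) * lam * rosenPQ lam α x 1 0 (m + 1)
        + Real.sign ((rosenT lam α)^[m] x) * rosenPQ lam α x 1 0 m := by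
      simp only [rosenPQ]
    rw [Function.iterate_succ_apply', Function.iterate_succ_apply', i2, q2, p2]
    simp only [rosenNE]
    rw [eT] at j2 ⊢
    clear eT q2 p2 i2 i5
    generalize rosenPQ lam α x 0 1 (m + 1) = Q1 at *
    generalize rosenPQ lam α x 0 1 m = Q0 at *
    generalize rosenPQ lam α x 1 0 (m + 1) = P1 at *
    generalize rosenPQ lam α x 1 0 m = P0 at *
    generalize (rosenD lam α ((rosenT lam α)^[m] x) : ℝ) = d at *
    generalize Real.sign ((rosenT lam α)^[m] x) = e at *
    generalize (rosenT lam α)^[m] x = t at *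
    have hQ : d * lam * Q1 + e * Q0 = (d * lam + e * (Q0 / Q1)) * Q1 := by field_simp
    have hv : 1 / (d * lam + e * (Q0 / Q1)) = Q1 / (d * lam * Q1 + e * Q0) := by
      rw [hQ]; field_simp
    refine ⟨by rw [hQ]; positivity, by rw [hv], ?_, ?_, by rw [← hv]; exact j2⟩
    · have a1 : d * lam * Q1 + e * Q0 + (e / t - lam * d) * Q1 = e / t * (Q1 + t * Q0) := by
        field_simp; ring
      have a2 : d * lam * P1 + e * P0 + (e / t - lam * d) * P1 = e / t * (P1 + t * P0) := by
        field_simp; ring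
      rw [a1, a2, ← i3]; ring
    · have : P1 * (d * lam * Q1 + e * Q0) - (d * lam * P1 + e * P0) * Q1
          = -e * (P0 * Q1 - P1 * Q0) := by ring
      rw [this, abs_mul, i4]
      rcases hsg with h | h <;> rw [h] <;> simp

lemma theta_eq {p : ℕ} {lam α : ℝ} {s : ℕ → ℝ} (P : Par p lam α s) {x : ℝ}
    (hx : x ∈ Set.Ico ((α - 1) * lam) (α * lam)) (hirr : GIrrational lam α x) (m : ℕ)
    (h : 1 + ((rosenNE lam α)^[m] (x, 0)).1 * ((rosenNE lam α)^[m] (x, 0)).2 ≠ 0) :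
    rosenTheta lam α x m = |((rosenNE lam α)^[m] (x, 0)).1| /
      |1 + ((rosenNE lam α)^[m] (x, 0)).1 * ((rosenNE lam α)^[m] (x, 0)).2| := by
  obtain ⟨i1, i2, i3, i4, -⟩ := orbit_facts P hx hirr m
  rw [i2] at h ⊢
  unfold rosenTheta
  simp only at h ⊢
  generalize rosenPQ lam α x 0 1 (m + 1) = Q1 at *
  generalize rosenPQ lam α x 0 1 m = Q0 at *
  generalize rosenPQ lam α x 1 0 (m + 1) = P1 at *
  generalize rosenPQ lam α x 1 0 m = P0 at *
  generalize (rosenT lam α)^[m] x = t at *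
  have e : 1 + t * (Q0 / Q1) = (Q1 + t * Q0) / Q1 := by field_simp
  rw [e] at h ⊢
  have hne : Q1 + t * Q0 ≠ 0 := fun h0 => h (by rw [h0, zero_div])
  have e2 : x - P1 / Q1 = t * (P0 * Q1 - P1 * Q0) / (Q1 * (Q1 + t * Q0)) := by
    have hx' : x = (P1 + t * P0) / (Q1 + t * Q0) := by
      rw [eq_div_iff hne, i3]
    rw [hx']
    field_simp
    ring
  rw [e2, abs_div, abs_mul, abs_mul, i4, abs_div, abs_of_pos i1]
  have : |Q1 + t * Q0| ≠ 0 := abs_ne_zero.mpr hne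
  field_simp

lemma theta_prev {p : ℕ} {lam α : ℝ} {s : ℕ → ℝ} (P : Par p lam α s) {x : ℝ}
    (hx : x ∈ Set.Ico ((α - 1) * lam) (α * lam)) (hirr : GIrrational lam α x) (m : ℕ)
    (h : 0 < 1 + ((rosenNE lam α)^[m + 1] (x, 0)).1 * ((rosenNE lam α)^[m + 1] (x, 0)).2) :
    rosenTheta lam α x m = ((rosenNE lam α)^[m + 1] (x, 0)).2 /
      (1 + ((rosenNE lam α)^[m + 1] (x, 0)).1 * ((rosenNE lam α)^[m + 1] (x, 0)).2) := by
  obtain ⟨i1, i2, i3, i4, i5⟩ := orbit_facts P hx hirr m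
  have ht := hirr m
  obtain ⟨j1, -⟩ := coarseInv_step P i5 ht
  have th := theta_eq P hx hirr m
  rw [Function.iterate_succ_apply', i2] at h ⊢
  rw [i2] at th
  have eT : rosenT lam α ((rosenT lam α)^[m] x) = Real.sign ((rosenT lam α)^[m] x) /
      ((rosenT lam α)^[m] x) - lam * rosenD lam α ((rosenT lam α)^[m] x) := rosenT_ne ht
  have hsg : Real.sign ((rosenT lam α)^[m] x) / ((rosenT lam α)^[m] x)
      = 1 / |(rosenT lam α)^[m] x| ∧ Real.sign ((rosenT lam α)^[m] x) ≠ 0 ∧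
      Real.sign ((rosenT lam α)^[m] x) * |(rosenT lam α)^[m] x| = (rosenT lam α)^[m] x ∧
      Real.sign ((rosenT lam α)^[m] x) ^ 2 = 1 := by
    rcases lt_or_gt_of_ne ht with h | h
    · rw [Real.sign_of_neg h, abs_of_neg h]
      refine ⟨by rw [div_neg, neg_div], by norm_num, by ring, by norm_num⟩
    · rw [Real.sign_of_pos h, abs_of_pos h]
      refine ⟨rfl, by norm_num, by ring, by norm_num⟩
  obtain ⟨g1, g2, g3, g4⟩ := hsg
  have ha : 0 < |(rosenT lam α)^[m] x| := abs_pos.mpr ht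
  simp only [rosenNE] at h th ⊢
  rw [eT, g1] at h ⊢
  clear eT g1 i1 i2 i3 i4 i5
  generalize rosenPQ lam α x 0 1 m / rosenPQ lam α x 0 1 (m + 1) = v at *
  generalize (rosenD lam α ((rosenT lam α)^[m] x) : ℝ) = d at *
  generalize Real.sign ((rosenT lam α)^[m] x) = e at *
  generalize (rosenT lam α)^[m] x = t at *
  generalize |t| = a at *
  obtain ⟨B, hB⟩ : ∃ B, B = d * lam + e * v := ⟨_, rfl⟩
  rw [← hB] at j1 h ⊢
  have key : 1 + (1 / a - lam * d) * (1 / B) = (1 + t * v) / (a * B) := by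
    rw [← g3]; field_simp; rw [hB]; ring
  rw [key] at h ⊢
  have hpos : 0 < 1 + t * v := by
    by_contra! hc
    have : (1 + t * v) / (a * B) ≤ 0 :=
      div_nonpos_of_nonpos_of_nonneg hc (by positivity)
    linarith
  rw [th hpos.ne', abs_of_pos hpos]
  field_simp

lemma pos_of_mem_D {p : ℕ} {lam α : ℝ} {tv : ℝ × ℝ} (h : tv ∈ DEven lam α p) :
    0 < 1 + tv.1 * tv.2 := by
  obtain ⟨-, -, h6⟩ := h
  by_contra! hc
  have : |tv.1| / (1 + tv.1 * tv.2) ≤ 0 := div_nonpos_of_nonneg_of_nonpos (abs_nonneg _) hc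
  linarith

/-- **Theorem 3.19** (flushing).  For even `q = 2p`, `p ≥ 3`, `α ∈ (1/2, 1/λ)` and
`k ≥ 1`:
(a) a point `(t,v) ∈ A ∩ D` stays in `D` for exactly `k` rounds — that is,
`𝒯_α^j(t,v) ∈ D` for all `0 ≤ j ≤ k(p-1)` and `𝒯_α^{k(p-1)+1}(t,v) ∉ D` — if and
only if `τ_{k-1} ≤ t < τ_k`;
(b) if `x` is `G_q`-irrational, `n ≥ 1`, `(t_n,v_n) = 𝒯_α^n(x,0) ∈ A ∩ D` and
`τ_{k-1} ≤ t_n < τ_k`, then `Θ_m(x) > ℋ_q = 1/2` for all `n-1 ≤ m ≤ n+k(p-1)`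
while `Θ_{n+k(p-1)+1}(x) < ℋ_q`. -/
theorem flushing_from_A (p : ℕ) (hp : 3 ≤ p) (lam : ℝ)
    (hlam : lam = 2 * Real.cos (Real.pi / (2 * (p : ℝ))))
    (α : ℝ) (hα : α ∈ Set.Ioo (1 / 2 : ℝ) (1 / lam))
    (k : ℕ) (hk : 1 ≤ k) :
    (∀ t v : ℝ, (t, v) ∈ regA lam α ∩ DEven lam α p →
      (((∀ j : ℕ, j ≤ k * (p - 1) → (rosenNE lam α)^[j] (t, v) ∈ DEven lam α p) ∧
          (rosenNE lam α)^[k * (p - 1) + 1] (t, v) ∉ DEven lam α p) ↔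
        (tauEven lam α (k - 1) ≤ t ∧ t < tauEven lam α k))) ∧
    (∀ x ∈ Set.Ico ((α - 1) * lam) (α * lam), GIrrational lam α x →
      ∀ n : ℕ, 1 ≤ n →
        (rosenNE lam α)^[n] (x, 0) ∈ regA lam α ∩ DEven lam α p →
        tauEven lam α (k - 1) ≤ ((rosenNE lam α)^[n] (x, 0)).1 →
        ((rosenNE lam α)^[n] (x, 0)).1 < tauEven lam α k →
        (∀ m : ℕ, n - 1 ≤ m → m ≤ n + k * (p - 1) → 1 / 2 < rosenTheta lam α x m) ∧
          rosenTheta lam α x (n + k * (p - 1) + 1) < 1 / 2) := by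
  obtain ⟨s, hs⟩ := exists_sineSeq p hp lam hlam
  obtain ⟨hl0, hl2, hl3⟩ := lam_bounds p hp lam hlam
  have hα' : α * lam < 1 := by
    have := hα.2
    rwa [lt_div_iff₀ hl0] at this
  have P : Par p lam α s := ⟨hp, hs, hl0, by nlinarith, hl2, hl3, hα.1, hα'⟩
  obtain ⟨m, rfl⟩ : ∃ m, k = m + 1 := ⟨k - 1, by omega⟩
  simp only [Nat.add_sub_cancel]
  refine ⟨fun t v h => (part_a P m t v h).1, ?_⟩
  intro x hx hirr n hn hmem h1 h2
  obtain ⟨a, b⟩ := (part_a P m _ _ hmem).2 ⟨h1, h2⟩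
  simp only [Prod.mk.eta, ← Function.iterate_add_apply] at a b
  constructor
  · intro i hi1 hi2
    by_cases hin : n ≤ i
    · have hD := a (i - n) (by omega)
      rw [show i - n + n = i by omega] at hD
      have hpos := pos_of_mem_D hD
      rw [theta_eq P hx hirr i hpos.ne', abs_of_pos hpos]
      exact hD.2.2
    · have hD := a 0 (by omega)
      rw [show 0 + n = i + 1 by omega] at hD
      rw [theta_prev P hx hirr i (pos_of_mem_D hD)]
      exact hD.2.1
  · rw [show (m + 1) * (p - 1) + 1 + n = n + (m + 1) * (p - 1) + 1 by ring] at b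
    rw [theta_eq P hx hirr _ b.1.ne', abs_of_pos b.1]
    exact b.2
end

section
/- Let q = 2p be even with p ≥ 3, λ = 2·cos(π/q), and α ∈ ((−λ²+4λ+4)/(8λ), 1/λ). Then there exists a positive integer K such that every point (t,v) ∈ D_3 satisfies 𝒯_α^{k(p−1)}(t,v) ∉ D for some 1 ≤ k ≤ K (i.e., all points of D_3 are flushed out of D after at most K rounds of p−1 steps). -/
theorem aux_step (lam α x v : ℝ) (m : ℤ) (hlam : 0 < lam) (hx : x < 0)
    (h1 : (α - 1) * lam ≤ -1 / x - m * lam) (h2 : -1 / x - m * lam < α * lam) :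
    rosenNE lam α (x, v) = (-1 / x - m * lam, 1 / (m * lam - v)) := by
  have hd : rosenD lam α x = m := by
    unfold rosenD
    have e : |1 / (lam * x)| = (-1 / x) / lam := by
      rw [abs_of_neg (div_neg_of_pos_of_neg one_pos (mul_neg_of_pos_of_neg hlam hx))]
      field_simp
    rw [e, Int.floor_eq_iff]
    have e2 : (-1 / x) / lam * lam = -1 / x := by field_simp
    constructor
    · by_contra hc
      push Not at hc
      nlinarith [mul_lt_mul_of_pos_right hc hlam]
    · by_contra hc
      push Not at hc
      nlinarith [mul_le_mul_of_nonneg_right hc hlam.le]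
  unfold rosenNE
  simp only [hd, rosenT, if_neg hx.ne, Real.sign_of_neg hx]
  ext
  · simp; ring
  · simp; ring

theorem aux_iter (θ lam α : ℝ) (hl : lam = 2 * Real.cos θ) (hlam : 0 < lam) (hlam2 : lam < 2)
    (hα : 0 < α) (n : ℕ) : ∀ (x w : ℝ), (∀ k : ℕ, 1 ≤ k → k ≤ n + 1 → 0 < Real.sin (k * θ)) →
    (α - 1) * lam ≤ x →
    Real.sin ((n + 1) * θ) * x + Real.sin (n * θ) < 0 →
    Real.sin ((n + 1) * θ) * w + Real.sin (n * θ) < 0 →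
    ∃ X W : ℝ, (rosenNE lam α)^[n] (x, -1 / w) = (X, -1 / W) ∧ X < 0 ∧ W < 0 ∧
      X * (-Real.sin (n * θ) * x - Real.sin ((n - 1) * θ)) =
        Real.sin ((n + 1) * θ) * x + Real.sin (n * θ) ∧
      W * (-Real.sin (n * θ) * w - Real.sin ((n - 1) * θ)) =
        Real.sin ((n + 1) * θ) * w + Real.sin (n * θ) := by
  induction n with
  | zero =>
    intro x w hs hx h1 h2
    have := hs 1 le_rfl le_rfl
    simp at this h1 h2
    refine ⟨x, w, rfl, ?_, ?_, ?_, ?_⟩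
    · by_contra hc
      push Not at hc
      nlinarith [mul_nonneg this.le hc]
    · by_contra hc
      push Not at hc
      nlinarith [mul_nonneg this.le hc]
    · simp [mul_comm]
    · simp [mul_comm]
  | succ n ih =>
    intro x w hs hx h1 h2
    have hrec : ∀ a : ℝ, Real.sin ((a + 1) * θ) = lam * Real.sin (a * θ) - Real.sin ((a - 1) * θ) := by
      intro a
      rw [show (a + 1) * θ = a * θ + θ by ring, show (a - 1) * θ = a * θ - θ by ring,
        Real.sin_add, Real.sin_sub, hl]
      ring
    have r1 := hrec n
    have r2 := hrec (n + 1)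
    rw [show (n : ℝ) + 1 - 1 = n by ring] at r2
    push_cast at h1 h2 ⊢
    rw [show (n : ℝ) + 1 - 1 = n by ring]
    have p1 : 0 < Real.sin ((n + 1 : ℝ) * θ) := by
      have := hs (n + 1) (by omega) (by omega)
      push_cast at this; exact this
    have p2 : 0 < Real.sin ((n + 1 + 1 : ℝ) * θ) := by
      have := hs (n + 2) (by omega) (by omega)
      push_cast at this
      rw [show (n : ℝ) + 1 + 1 = n + 2 by ring]; exact this
    have p0 : 0 ≤ Real.sin ((n : ℝ) * θ) := by
      rcases Nat.eq_zero_or_pos n with h | h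
      · simp [h]
      · exact (hs n h (by omega)).le
    generalize Real.sin ((n + 1 + 1 : ℝ) * θ) = s2 at *
    have key : ∀ y : ℝ, s2 * y + Real.sin ((n + 1 : ℝ) * θ) < 0 → y < 0 ∧
        Real.sin ((n + 1) * θ) * (-1 / y - lam) + Real.sin (n * θ) < 0 := by
      intro y hy
      have hy0 : y < 0 := by
        by_contra hc
        push Not at hc
        nlinarith [mul_nonneg p2.le hc]
      refine ⟨hy0, ?_⟩
      have : Real.sin ((n + 1) * θ) * (-1 / y - lam) + Real.sin (n * θ)
          = (s2 * y + Real.sin ((n + 1 : ℝ) * θ)) / (-y) := by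
        rw [r2]
        have := hy0.ne
        field_simp
        ring
      rw [this]
      exact div_neg_of_neg_of_pos hy (by linarith)
    obtain ⟨hx0, kx⟩ := key x h1
    obtain ⟨hw0, kw⟩ := key w h2
    have fneg : -1 / x - lam < 0 := by
      by_contra hc
      push Not at hc
      nlinarith [mul_nonneg p1.le hc]
    have hfx : x ≤ -1 / x - lam := by
      have : -1 / x - lam - x = (x ^ 2 + lam * x + 1) / (-x) := by
        have := hx0.ne
        field_simp
        ring
      have h3 : 0 ≤ (x ^ 2 + lam * x + 1) / (-x) :=
        div_nonneg (by nlinarith [sq_nonneg (x + lam / 2)]) (by linarith)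
      linarith
    have st := aux_step lam α x (-1 / w) 1 hlam hx0 (by push_cast; linarith)
      (by push_cast; nlinarith [mul_pos hα hlam])
    have e : (1 : ℝ) / (((1 : ℤ) : ℝ) * lam - -1 / w) = -1 / (-1 / w - lam) := by
      rw [← neg_div_neg_eq]; push_cast; congr 1; ring
    rw [e] at st
    push_cast at st
    rw [one_mul] at st
    obtain ⟨X, W, hit, hX, hW, eX, eW⟩ := ih (-1 / x - lam) (-1 / w - lam)
      (fun k a b => hs k a (by omega)) (by linarith) kx kw
    refine ⟨X, W, by rw [Function.iterate_succ_apply, st, hit], hX, hW, ?_, ?_⟩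
    · have hq : -1 / x * x = -1 := div_mul_cancel₀ _ hx0.ne
      linear_combination (-x) * eX - (X * Real.sin (n * θ) + Real.sin ((n + 1) * θ)) * hq
        - X * x * r1 - x * r2
    · have hq : -1 / w * w = -1 := div_mul_cancel₀ _ hw0.ne
      linear_combination (-w) * eW - (W * Real.sin (n * θ) + Real.sin ((n + 1) * θ)) * hq
        - W * w * r1 - w * r2

set_option maxHeartbeats 2000000 in
theorem aux_round (p : ℕ) (hp : 3 ≤ p) (lam : ℝ)
    (hlam : lam = 2 * Real.cos (Real.pi / (2 * (p : ℝ)))) (α : ℝ)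
    (h3 : 3 ≤ lam ^ 2) (h0 : 0 < lam) (h2 : lam < 2) (hα : 1 / 2 < α)
    (r t v : ℝ) (hr1 : -1 ≤ r * ((α + 1) * lam)) (hr2 : 0 < (lam + 1) * r + 1)
    (hrt : r ≤ t) (ht : t * (lam + 4) ≤ -2) (hv : v ≤ lam / 2) :
    ∃ t' v' : ℝ, (rosenNE lam α)^[p - 1] (t, v) = (t', v') ∧ t' < 0 ∧ v' ≤ lam / 2 ∧
      t + ((lam + 1) * r + 1) ≤ t' := by
  obtain ⟨m, rfl⟩ : ∃ m, p = m + 2 := ⟨p - 2, by omega⟩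
  set θ := Real.pi / (2 * ((m + 2 : ℕ) : ℝ)) with hθ
  have hθ0 : 0 < θ := by positivity
  have hpθ : ((m : ℝ) + 2) * θ = Real.pi / 2 := by
    rw [hθ]; push_cast; field_simp
  have hcos : Real.cos θ = lam / 2 := by linarith
  have s1 : Real.sin (((m : ℝ) + 1) * θ) = lam / 2 := by
    rw [show ((m : ℝ) + 1) * θ = Real.pi / 2 - θ by linarith, Real.sin_pi_div_two_sub, hcos]
  have s0 : Real.sin ((m : ℝ) * θ) = lam ^ 2 / 2 - 1 := by
    rw [show (m : ℝ) * θ = Real.pi / 2 - 2 * θ by linarith, Real.sin_pi_div_two_sub,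
      Real.cos_two_mul, hcos]; ring
  have sm : Real.sin (((m : ℝ) - 1) * θ) = lam ^ 3 / 2 - 3 * lam / 2 := by
    rw [show ((m : ℝ) - 1) * θ = Real.pi / 2 - 3 * θ by linarith, Real.sin_pi_div_two_sub,
      Real.cos_three_mul, hcos]; ring
  have hpos : ∀ k : ℕ, 1 ≤ k → k ≤ m + 1 → 0 < Real.sin (k * θ) := by
    intro k hk1 hk2
    have a : (1 : ℝ) ≤ k := by exact_mod_cast hk1
    have b : (k : ℝ) ≤ m + 1 := by exact_mod_cast hk2
    apply Real.sin_pos_of_pos_of_lt_pi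
    · positivity
    · nlinarith [Real.pi_pos]
  have ht0 : t < 0 := by nlinarith
  have hinv : -1 / t ≤ lam / 2 + 2 := by
    rw [div_le_iff_of_neg ht0]; linarith
  have hα0 : 0 < (α + 1) * lam := by positivity
  have hdig : (α - 1) * lam ≤ -1 / t - ((2 : ℤ) : ℝ) * lam := by
    have : (α + 1) * lam ≤ -1 / t := by
      rw [le_div_iff_of_neg ht0]; nlinarith
    push_cast; linarith
  have st := aux_step lam α t v 2 h0 ht0 hdig (by push_cast; nlinarith)
  have e : (1 : ℝ) / (((2 : ℤ) : ℝ) * lam - v) = -1 / (v - 2 * lam) := by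
    rw [← neg_div_neg_eq]; push_cast; congr 1; ring
  rw [e] at st
  push_cast at st hdig
  obtain ⟨X, W, hit, hX, hW, eX, eW⟩ := aux_iter θ lam α hlam h0 h2 (by linarith) m
    (-1 / t - 2 * lam) (v - 2 * lam) hpos hdig
    (by rw [s1, s0]; nlinarith [mul_pos (sub_pos.2 h2) (sub_pos.2 h2)])
    (by rw [s1, s0]; nlinarith [mul_pos (sub_pos.2 h2) (sub_pos.2 h2)])
  rw [s1, s0, sm] at eX eW
  refine ⟨X, -1 / W, ?_, hX, ?_, ?_⟩
  · rw [show m + 2 - 1 = m + 1 by omega, Function.iterate_succ_apply, st, hit]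
  · -- the second coordinate stays below lam / 2
    have hW2 : W * lam ≤ -2 := by
      have hden : 0 < -(lam ^ 2 / 2 - 1) * (v - 2 * lam) - (lam ^ 3 / 2 - 3 * lam / 2) := by
        nlinarith [mul_nonneg (show 0 ≤ lam ^ 2 / 2 - 1 by linarith) (sub_nonneg.2 hv), pow_pos h0 3]
      by_contra hc
      push Not at hc
      have := mul_lt_mul_of_pos_right hc hden
      have h4 : 0 < 4 - lam ^ 2 := by nlinarith
      have h5 := mul_nonneg h4.le (show 0 ≤ lam - v by linarith)
      have eW' : W * lam * (-(lam ^ 2 / 2 - 1) * (v - 2 * lam) - (lam ^ 3 / 2 - 3 * lam / 2)) =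
          lam * (lam / 2 * (v - 2 * lam) + (lam ^ 2 / 2 - 1)) := by linear_combination lam * eW
      rw [eW'] at this
      linarith
    rw [div_le_iff_of_neg hW]; linarith
  · -- expansion in the first coordinate
    have hc : 0 < lam ^ 3 - lam := by linarith [mul_nonneg h0.le (sub_nonneg.2 h3)]
    have eX2 : X * ((lam ^ 3 - lam) * t + (lam ^ 2 - 2)) = -(lam ^ 2 + 2) * t - lam := by
      have := ht0.ne
      field_simp at eX
      linear_combination eX
    set E := -((lam ^ 3 - lam) * t + (lam ^ 2 - 2)) with hE
    have hE0 : 0 < E := by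
      have : 0 < E * (lam + 4) := by
        have : 0 < (2 - lam) * (4 + 2 * lam - lam ^ 2) := mul_pos (by linarith)
          (by linarith [mul_pos h0 (sub_pos.2 h2)])
        rw [hE]
        linarith [mul_le_mul_of_nonneg_left ht hc.le]
      exact pos_of_mul_pos_left this (by linarith)
    have h1 : 1 ≤ lam := by
      by_contra hc'
      push Not at hc'
      linarith [mul_pos h0 (sub_pos.2 hc')]
    have hll : 0 ≤ lam * (lam - 1) := mul_nonneg h0.le (by linarith)
    have hδt : (lam + 1) * r + 1 ≤ (lam + 1) * t + 1 := by linarith [mul_le_mul_of_nonneg_left hrt (show 0 ≤ lam + 1 by linarith)]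
    have hE1 : E ≤ 1 := by
      have h7 : -1 ≤ (lam + 1) * t := by linarith
      have h8 := mul_le_mul_of_nonneg_left h7 hll
      rw [hE]
      linarith
    have hd : (X - t) * E = lam * ((lam - 1) * t + 1) * ((lam + 1) * t + 1) := by
      rw [hE]; linear_combination (-1) * eX2
    have hA : 1 ≤ lam * ((lam - 1) * t + 1) := by
      have h9 : -1 ≤ (lam + 1) * t := by linarith
      have h10 : 1 * (lam + 1) ≤ lam * ((lam - 1) * t + 1) * (lam + 1) := by
        linarith [mul_le_mul_of_nonneg_left h9 hll]
      exact le_of_mul_le_mul_right h10 (by linarith)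
    have hB : (lam + 1) * r + 1 ≤ (X - t) * E := by
      rw [hd]
      linarith [mul_le_mul_of_nonneg_right hA (show 0 ≤ (lam + 1) * t + 1 by linarith)]
    have hXt : 0 ≤ X - t := by
      by_contra hc'
      push Not at hc'
      linarith [mul_neg_of_neg_of_pos hc' hE0]
    linarith [mul_le_of_le_one_right hXt hE1]

/-- **Lemma 3.20** (flushing from `D₃`).  For even `q = 2p`, `p ≥ 3` and
`α ∈ ((-λ²+4λ+4)/(8λ), 1/λ)`, there is a positive integer `K` such that every
point of `D₃` is flushed out of `D` after at most `K` rounds of `p-1` steps. -/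
theorem flushing_from_D3 (p : ℕ) (hp : 3 ≤ p) (lam : ℝ)
    (hlam : lam = 2 * Real.cos (Real.pi / (2 * (p : ℝ))))
    (α : ℝ)
    (hα : α ∈ Set.Ioo ((-lam ^ 2 + 4 * lam + 4) / (8 * lam)) (1 / lam)) :
    ∃ K : ℕ, 0 < K ∧
      ∀ t v : ℝ, (t, v) ∈ regD3 lam α →
        ∃ k : ℕ, 1 ≤ k ∧ k ≤ K ∧ (rosenNE lam α)^[k * (p - 1)] (t, v) ∉ DEven lam α p := by
  obtain ⟨ha1, ha2⟩ := hα
  have hp' : (3 : ℝ) ≤ p := by exact_mod_cast hp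
  have hθ0 : 0 < Real.pi / (2 * (p : ℝ)) := by positivity
  have hθ6 : Real.pi / (2 * (p : ℝ)) ≤ Real.pi / 6 :=
    div_le_div_of_nonneg_left Real.pi_pos.le (by norm_num) (by linarith)
  have hc1 : √3 / 2 ≤ Real.cos (Real.pi / (2 * (p : ℝ))) := by
    rw [← Real.cos_pi_div_six]
    exact Real.cos_le_cos_of_nonneg_of_le_pi hθ0.le (by linarith [Real.pi_pos]) hθ6
  have hc2 : Real.cos (Real.pi / (2 * (p : ℝ))) < 1 := by
    rw [← Real.cos_zero]
    exact Real.cos_lt_cos_of_nonneg_of_le_pi le_rfl (by linarith [Real.pi_pos]) hθ0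
  have hs : √3 ≤ lam := by linarith
  have hs0 : 0 < √3 := by positivity
  have h0 : 0 < lam := by linarith
  have h2 : lam < 2 := by linarith
  have h3 : 3 ≤ lam ^ 2 := by nlinarith [Real.sq_sqrt (show (0 : ℝ) ≤ 3 by norm_num)]
  have hα : 1 / 2 < α := by
    refine lt_of_le_of_lt ?_ ha1
    rw [div_le_div_iff₀ (by norm_num) (by linarith)]
    nlinarith
  have hαl : α * lam < 1 := by rwa [lt_div_iff₀ h0] at ha2
  have hα1 : α < 1 := by nlinarith
  have hden : 0 < 2 - (1 - α) * lam ^ 2 := by nlinarith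
  set r := -((2 * α - 1) * lam / (2 - (1 - α) * lam ^ 2)) with hr
  have hrd : r * (2 - (1 - α) * lam ^ 2) = -((2 * α - 1) * lam) := by
    rw [hr, neg_mul, div_mul_cancel₀ _ hden.ne']
  have hr1 : -1 ≤ r * ((α + 1) * lam) := by
    have h : -1 * (2 - (1 - α) * lam ^ 2) ≤
        r * ((α + 1) * lam) * (2 - (1 - α) * lam ^ 2) := by
      have : r * ((α + 1) * lam) * (2 - (1 - α) * lam ^ 2)
        = -((2 * α - 1) * lam) * ((α + 1) * lam) := by rw [← hrd]; ring
      rw [this]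
      nlinarith [mul_pos (show 0 < α by linarith) h0]
    exact le_of_mul_le_mul_right h hden
  have hr2 : 0 < (lam + 1) * r + 1 := by
    have h : 0 < ((lam + 1) * r + 1) * (2 - (1 - α) * lam ^ 2) := by
      have : ((lam + 1) * r + 1) * (2 - (1 - α) * lam ^ 2)
        = (lam + 1) * (-((2 * α - 1) * lam)) + (2 - (1 - α) * lam ^ 2) := by rw [← hrd]; ring
      rw [this]
      nlinarith
    exact pos_of_mul_pos_left h hden.le
  obtain ⟨N, hN⟩ := exists_nat_gt (-r / ((lam + 1) * r + 1))
  rw [div_lt_iff₀ hr2] at hN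
  refine ⟨N + 1, by omega, ?_⟩
  intro t v htv
  by_contra hcon
  push Not at hcon
  obtain ⟨g1, g2, -, g4⟩ := htv
  simp only at g1 g2 g4
  have inv : ∀ k : ℕ, k ≤ N + 1 → ∃ a b : ℝ, (rosenNE lam α)^[k * (p - 1)] (t, v) = (a, b) ∧
      a * (lam + 4) ≤ -2 ∧ b ≤ lam / 2 ∧ r + k * ((lam + 1) * r + 1) ≤ a := by
    intro k
    induction k with
    | zero =>
      intro _
      refine ⟨t, v, by simp, ?_, g4, by simpa using g1⟩
      have : t * (lam + 4) ≤ -(2 / (lam + 4)) * (lam + 4) :=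
        mul_le_mul_of_nonneg_right g2 (by linarith)
      have e : -(2 / (lam + 4)) * (lam + 4) = -2 := by field_simp
      linarith
    | succ k ih =>
      intro hk
      obtain ⟨a, b, hab, k1, k2, k3⟩ := ih (by omega)
      have hra : r ≤ a := by
        have : 0 ≤ (k : ℝ) * ((lam + 1) * r + 1) := by positivity
        linarith
      obtain ⟨a', b', hr', j1, j2, j3⟩ := aux_round p hp lam hlam α h3 h0 h2 hα r a b hr1 hr2
        hra k1 k2
      have hit : (rosenNE lam α)^[(k + 1) * (p - 1)] (t, v) = (a', b') := by
        rw [show (k + 1) * (p - 1) = (p - 1) + k * (p - 1) by ring,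
          Function.iterate_add_apply, hab, hr']
      refine ⟨a', b', hit, ?_, j2, by push_cast; linarith⟩
      have hD := hcon (k + 1) (by omega) hk
      rw [hit] at hD
      obtain ⟨-, -, hD3⟩ := hD
      simp only at hD3
      rw [abs_of_neg j1] at hD3
      have hpos : 0 < 1 + a' * b' := by
        by_contra hc
        push Not at hc
        have := div_nonpos_of_nonneg_of_nonpos (show 0 ≤ -a' by linarith) hc
        linarith
      rw [lt_div_iff₀ hpos] at hD3
      have := mul_le_mul_of_nonpos_left j2 j1.le
      linarith
  obtain ⟨a, b, -, k1, -, k3⟩ := inv N (by omega)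
  have ha : 0 < a := by linarith
  have := mul_pos ha (show 0 < lam + 4 by linarith)
  linarith
end

section
/- Let q = 2h+3 be odd with h ≥ 1, λ = 2·cos(π/q), ρ = (λ−2+√(λ²−4λ+8))/2, and α ∈ [1/2, ρ/λ]. Then there exist a strictly decreasing sequence of real numbers (c_k)_{k≥1} with lim_{k→∞} c_k = ℋ_q and a positive integer K such that for every G_q-irrational x ∈ [(α−1)λ, αλ) and all integers n ≥ 1 and k > K one has min{Θ_{n−1}(x), Θ_n(x), …, Θ_{n+k(2h+1)}(x)} < c_k. -/
noncomputable def rosenU (lam x : ℝ) : ℝ := 1 / (lam - x)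

lemma lam_bounds_s17 (h : ℕ) (hh : 1 ≤ h) (lam : ℝ)
    (hlam : lam = 2 * Real.cos (Real.pi / (2 * (h : ℝ) + 3))) : 8/5 < lam ∧ lam < 2 := by
  have hh' : (1:ℝ) ≤ h := by exact_mod_cast hh
  have hpi := Real.pi_pos
  constructor
  · have h1 : Real.cos (Real.pi/5) ≤ Real.cos (Real.pi / (2 * (h : ℝ) + 3)) := by
      apply Real.cos_le_cos_of_nonneg_of_le_pi
      · positivity
      · linarith
      · apply div_le_div_of_nonneg_left <;> linarith
    rw [Real.cos_pi_div_five] at h1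
    have h5 : (2.2:ℝ) < √5 := by
      apply Real.lt_sqrt_of_sq_lt; norm_num
    rw [hlam]; linarith
  · have h1 : Real.cos (Real.pi / (2 * (h : ℝ) + 3)) < Real.cos 0 := by
      apply Real.cos_lt_cos_of_nonneg_of_le_pi
      · exact le_rfl
      · apply div_le_self hpi.le; linarith
      · positivity
    rw [Real.cos_zero] at h1
    linarith

lemma trig_facts (h : ℕ) (hh : 1 ≤ h) (lam : ℝ)
    (hlam : lam = 2 * Real.cos (Real.pi / (2 * (h : ℝ) + 3))) :
    ∃ B : ℕ → ℝ, B 0 = 0 ∧ B (h+1) = 1 ∧ (∀ a ≤ h, B a < B (a+1)) ∧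
      (∀ a ≤ h, B (a+1) = 1 / (lam - B a)) ∧
      (∀ x, 0 ≤ x → x ≤ 1 / lam → (rosenU lam)^[h] x =
        ((lam-1) - (lam^2-lam-1) * x) / (1 - (lam-1)*x)) := by
  obtain ⟨hl1, hl2⟩ := lam_bounds_s17 h hh lam hlam
  have hpi := Real.pi_pos
  set θ := Real.pi / (2 * (h : ℝ) + 3) with hθ
  have hθ0 : 0 < θ := by positivity
  have hq : (2 * (h:ℝ) + 3) * θ = Real.pi := by rw [hθ]; field_simp
  -- recursion
  have hrec : ∀ a : ℝ, Real.sin ((a+2)*θ) = lam * Real.sin ((a+1)*θ) - Real.sin (a*θ) := by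
    intro a
    have e1 : (a+2)*θ = (a+1)*θ + θ := by ring
    have e2 : a*θ = (a+1)*θ - θ := by ring
    rw [e1, e2, Real.sin_add, Real.sin_sub, hlam]; ring
  have hpos : ∀ a : ℕ, a ≤ h + 1 → 0 < Real.sin (((a:ℝ)+1)*θ) := by
    intro a ha
    have ha' : (a:ℝ) ≤ h + 1 := by exact_mod_cast ha
    apply Real.sin_pos_of_pos_of_lt_pi
    · positivity
    · rw [← hq]; apply mul_lt_mul_of_pos_right _ hθ0; 
      have : (0:ℝ) ≤ h := by positivity
      linarith
  have hsq : ∀ a : ℝ, Real.sin ((a+1)*θ)^2 - Real.sin (a*θ) * Real.sin ((a+2)*θ) = Real.sin θ ^2 := by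
    intro a
    have e1 : (a+2)*θ = (a+1)*θ + θ := by ring
    have e2 : a*θ = (a+1)*θ - θ := by ring
    rw [e1, e2, Real.sin_add, Real.sin_sub]
    have h1 := Real.sin_sq_add_cos_sq ((a+1)*θ)
    have h2 := Real.sin_sq_add_cos_sq θ
    linear_combination (Real.sin θ ^2) * h1 - (Real.sin ((a+1)*θ)^2) * h2
  have hsθ : 0 < Real.sin θ := by simpa using hpos 0 (by omega)
  have hmid : Real.sin (((h:ℝ)+2)*θ) = Real.sin (((h:ℝ)+1)*θ) := by
    rw [← Real.sin_pi_sub, ← hq]; congr 1; ring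
  set B : ℕ → ℝ := fun a => Real.sin ((a:ℝ)*θ) / Real.sin (((a:ℝ)+1)*θ) with hB
  have hB0 : B 0 = 0 := by simp [hB]
  have hBh : B (h+1) = 1 := by
    have := hpos h (by omega)
    simp only [hB]; push_cast
    rw [show ((h:ℝ)+1+1) = (h:ℝ)+2 by ring, hmid]
    exact div_self this.ne'
  have hmono : ∀ a ≤ h, B a < B (a+1) := by
    intro a ha
    have p1 := hpos a (by omega)
    have p2 := hpos (a+1) (by omega)
    simp only [hB]; push_cast at p2 ⊢
    rw [div_lt_div_iff₀ p1 p2]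
    have := hsq a
    rw [show ((a:ℝ)+1+1) = (a:ℝ)+2 by ring]
    nlinarith [sq_pos_of_pos hsθ]
  have hBrec : ∀ a ≤ h, B (a+1) = 1 / (lam - B a) := by
    intro a ha
    have p1 := hpos a (by omega)
    have p2 := hpos (a+1) (by omega)
    have := hrec a
    simp only [hB]; push_cast at p2 ⊢
    rw [show ((a:ℝ)+1+1) = (a:ℝ)+2 by ring] at *
    have e : lam - Real.sin ((a:ℝ)*θ) / Real.sin (((a:ℝ)+1)*θ) = Real.sin (((a:ℝ)+2)*θ) / Real.sin (((a:ℝ)+1)*θ) := by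
      rw [this, eq_div_iff p1.ne', sub_mul, div_mul_cancel₀ _ p1.ne']
    rw [e, one_div_div]
  have hBle : ∀ b, b ≤ h+1 → B (h+1-b) ≤ 1 := by
    intro b
    induction b with
    | zero => intro _; simp [hBh]
    | succ b ih => 
      intro hb
      have h1 := ih (by omega)
      have h2 := hmono (h+1-(b+1)) (by omega)
      rw [show h+1-(b+1)+1 = h+1-b by omega] at h2
      linarith
  have hBle' : ∀ a ≤ h+1, B a ≤ 1 := by
    intro a ha
    have := hBle (h+1-a) (by omega)
    rwa [show h+1-(h+1-a) = a by omega] at this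
  refine ⟨B, hB0, hBh, hmono, hBrec, ?_⟩
  intro x hx0 hx1
  have hx1' : x < 1 := by
    have : 1/lam < 1 := by rw [div_lt_one] <;> linarith
    linarith
  have hden : ∀ a ≤ h+1, 0 < Real.sin (((a:ℝ)+1)*θ) - Real.sin ((a:ℝ)*θ) * x := by
    intro a ha
    have p1 := hpos a (by omega)
    have := hBle' a ha
    simp only [hB] at this
    rw [div_le_one p1] at this
    rcases le_or_gt (Real.sin ((a:ℝ)*θ)) 0 with h0 | h0
    · nlinarith
    · nlinarith
  have hform : ∀ a ≤ h, (rosenU lam)^[a] x = (Real.sin ((a:ℝ)*θ) - Real.sin (((a:ℝ)-1)*θ)*x) / 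
      (Real.sin (((a:ℝ)+1)*θ) - Real.sin ((a:ℝ)*θ)*x) := by
    intro a
    induction a with
    | zero => 
      intro _
      simp
      field_simp
    | succ a ih =>
      intro ha
      rw [Function.iterate_succ_apply', ih (by omega), rosenU]
      have d1 := hden a (by omega)
      have d2 := hden (a+1) (by omega)
      have r1 := hrec a
      have r2 := hrec (a-1)
      push_cast at *
      rw [show ((a:ℝ)+1+1) = (a:ℝ)+2 by ring, show ((a:ℝ)+1-1) = (a:ℝ) by ring] at *
      rw [show ((a:ℝ)-1+1) = (a:ℝ) by ring, show ((a:ℝ)-1+2) = (a:ℝ)+1 by ring] at r2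
      have e : lam - (Real.sin ((a:ℝ)*θ) - Real.sin (((a:ℝ)-1)*θ)*x) / 
      (Real.sin (((a:ℝ)+1)*θ) - Real.sin ((a:ℝ)*θ)*x) = (Real.sin (((a:ℝ)+2)*θ) - Real.sin (((a:ℝ)+1)*θ)*x) / 
      (Real.sin (((a:ℝ)+1)*θ) - Real.sin ((a:ℝ)*θ)*x) := by
        rw [eq_div_iff d1.ne', sub_mul, div_mul_cancel₀ _ d1.ne', r1]
        linear_combination x * r2
      rw [e, one_div_div]
  rw [hform h le_rfl]
  have p := hpos h (by omega)
  have r1 := hrec h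
  have r2 := hrec ((h:ℝ)-1)
  rw [show ((h:ℝ)-1+1) = (h:ℝ) by ring, show ((h:ℝ)-1+2) = (h:ℝ)+1 by ring] at r2
  rw [hmid] at r1
  have d := hden h (by omega)
  have s1 : Real.sin ((h:ℝ)*θ) = (lam-1) * Real.sin (((h:ℝ)+1)*θ) := by linarith
  have s2 : Real.sin (((h:ℝ)-1)*θ) = (lam^2-lam-1) * Real.sin (((h:ℝ)+1)*θ) := by
    have : Real.sin (((h:ℝ)-1)*θ) = lam * Real.sin ((h:ℝ)*θ) - Real.sin (((h:ℝ)+1)*θ) := by linarith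
    rw [this, s1]; ring
  rw [s1, s2, show (lam-1) * Real.sin (((h:ℝ)+1)*θ) - (lam^2-lam-1) * Real.sin (((h:ℝ)+1)*θ) * x = Real.sin (((h:ℝ)+1)*θ) * ((lam-1) - (lam^2-lam-1) * x) by ring,
    show Real.sin (((h:ℝ)+1)*θ) - (lam-1) * Real.sin (((h:ℝ)+1)*θ) * x = Real.sin (((h:ℝ)+1)*θ) * (1 - (lam-1)*x) by ring]
  exact mul_div_mul_left _ _ p.ne'

noncomputable def rosenF (lam x : ℝ) : ℝ := (lam^2-lam+1-(lam-1)*x)/(lam+1-x)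

lemma B_bounds (h : ℕ) (B : ℕ → ℝ) (hB0 : B 0 = 0) (hBh : B (h+1) = 1)
    (hmono : ∀ a ≤ h, B a < B (a+1)) : ∀ a ≤ h+1, 0 ≤ B a ∧ B a ≤ 1 := by
  have h1 : ∀ a ≤ h+1, 0 ≤ B a := by
    intro a
    induction a with
    | zero => intro _; simp [hB0]
    | succ a ih => intro ha; have := ih (by omega); have := hmono a (by omega); linarith
  have h2 : ∀ b, b ≤ h+1 → B (h+1-b) ≤ 1 := by
    intro b
    induction b with
    | zero => intro _; simp [hBh]
    | succ b ih => 
      intro hb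
      have h1 := ih (by omega)
      have h2 := hmono (h+1-(b+1)) (by omega)
      rw [show h+1-(b+1)+1 = h+1-b by omega] at h2
      linarith
  intro a ha
  refine ⟨h1 a ha, ?_⟩
  have := h2 (h+1-a) (by omega)
  rwa [show h+1-(h+1-a) = a by omega] at this

lemma iter_bounds (h : ℕ) (lam : ℝ) (hl1 : 8/5 < lam) (hl2 : lam < 2) (B : ℕ → ℝ)
    (hB0 : B 0 = 0) (hBh : B (h+1) = 1) (hmono : ∀ a ≤ h, B a < B (a+1))
    (hBrec : ∀ a ≤ h, B (a+1) = 1 / (lam - B a)) (z : ℝ) (hz0 : 0 ≤ z) (hz1 : z ≤ 1 / lam) :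
    ∀ a ≤ h, 0 ≤ (rosenU lam)^[a] z ∧ (rosenU lam)^[a] z ≤ B (a+1) := by
  have hb := B_bounds h B hB0 hBh hmono
  intro a
  induction a with
  | zero => 
    intro _
    refine ⟨hz0, ?_⟩
    rw [hBrec 0 (by omega), hB0]; simpa using hz1
  | succ a ih =>
    intro ha
    obtain ⟨i1, i2⟩ := ih (by omega)
    have := hb (a+1) (by omega)
    rw [Function.iterate_succ_apply', rosenU, hBrec (a+1) ha]
    constructor
    · apply div_nonneg <;> linarith
    · apply one_div_le_one_div_of_le <;> linarith

lemma iter_mono (h : ℕ) (lam : ℝ) (hl1 : 8/5 < lam) (hl2 : lam < 2) (B : ℕ → ℝ)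
    (hB0 : B 0 = 0) (hBh : B (h+1) = 1) (hmono : ∀ a ≤ h, B a < B (a+1))
    (hBrec : ∀ a ≤ h, B (a+1) = 1 / (lam - B a)) (z : ℝ) (hz0 : 0 ≤ z) (hz1 : z ≤ 1 / lam) :
    ∀ b a, a + b ≤ h → (rosenU lam)^[a] z ≤ (rosenU lam)^[a+b] z := by
  have hb := B_bounds h B hB0 hBh hmono
  have hi := iter_bounds h lam hl1 hl2 B hB0 hBh hmono hBrec z hz0 hz1
  intro b a
  induction b with
  | zero => intro _; exact le_rfl
  | succ b ih =>
    intro hab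
    have h1 := ih (by omega)
    have h2 := hi (a+b) (by omega)
    have h3 := hb (a+b+1) (by omega)
    refine h1.trans ?_
    rw [show a + (b+1) = (a+b)+1 by omega, Function.iterate_succ_apply']
    generalize (rosenU lam)^[a+b] z = y at *
    rw [rosenU, le_div_iff₀ (by linarith)]
    nlinarith [sq_nonneg (y-1)]

structure NegSeq (lam : ℝ) (N : ℕ) (s v : ℕ → ℝ) (d : ℕ → ℤ) : Prop where
  spos : ∀ m ≤ N, 0 < s m
  shalf : ∀ m ≤ N, s m ≤ lam / 2
  v0 : ∀ m ≤ N, 0 ≤ v m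
  v1 : ∀ m ≤ N, v m ≤ 1
  srec : ∀ m < N, s m = 1 / (d m * lam - s (m+1))
  vrec : ∀ m < N, v (m+1) = 1 / (d m * lam - v m)
  d1 : ∀ m < N, d m = 1 ∨ d m = 2

lemma run_lemma (h : ℕ) (lam : ℝ) (hl1 : 8/5 < lam) (hl2 : lam < 2) (B : ℕ → ℝ)
    (hB0 : B 0 = 0) (hBh : B (h+1) = 1) (hmono : ∀ a ≤ h, B a < B (a+1))
    (hBrec : ∀ a ≤ h, B (a+1) = 1 / (lam - B a)) (N : ℕ) (s v : ℕ → ℝ) (d : ℕ → ℤ)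
    (H : NegSeq lam N s v d) : ∀ c ≤ h, ∀ m, m + c + 1 ≤ N → s m < B (c+1) →
      ∃ a ≤ c, d (m+a) = 2 ∧ s m = (rosenU lam)^[a] (s (m+a)) ∧ 
        v (m+a) = (rosenU lam)^[a] (v m) := by
  have hb := B_bounds h B hB0 hBh hmono
  intro c
  induction c with
  | zero =>
    intro _ m hm hs
    refine ⟨0, le_rfl, ?_, rfl, rfl⟩
    rcases H.d1 m (by omega) with h1 | h1
    · exfalso
      have e := H.srec m (by omega)
      have p := H.spos (m+1) (by omega)
      have q := H.shalf (m+1) (by omega)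
      rw [hBrec 0 (by omega), hB0, e, h1] at hs
      rw [one_div_lt_one_div] at hs <;> push_cast at * <;> linarith
    · exact h1
  | succ c ih =>
    intro hc m hm hs
    rcases H.d1 m (by omega) with h1 | h1
    · have e := H.srec m (by omega)
      have p := H.spos (m+1) (by omega)
      have q := H.shalf (m+1) (by omega)
      have hbc := hb (c+1) (by omega)
      rw [hBrec (c+1) (by omega), e, h1] at hs
      rw [one_div_lt_one_div (by push_cast; linarith) (by linarith)] at hs
      obtain ⟨a, ha, h2, h3, h4⟩ := ih (by omega) (m+1) (by omega) (by push_cast at hs; linarith)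
      refine ⟨a+1, by omega, ?_, ?_, ?_⟩
      · rw [← h2]; congr 1; omega
      · rw [Function.iterate_succ_apply', show m + (a+1) = m+1+a by omega, ← h3, e, h1, rosenU]
        simp
      · rw [Function.iterate_succ_apply, show m + (a+1) = m+1+a by omega, h4, H.vrec m (by omega), h1, rosenU]
        simp
    · exact ⟨0, by omega, h1, rfl, rfl⟩

lemma step_lemma (h : ℕ) (lam : ℝ) (hl1 : 8/5 < lam) (hl2 : lam < 2) (B : ℕ → ℝ)
    (hB0 : B 0 = 0) (hBh : B (h+1) = 1) (hmono : ∀ a ≤ h, B a < B (a+1))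
    (hBrec : ∀ a ≤ h, B (a+1) = 1 / (lam - B a)) 
    (hU : ∀ x, 0 ≤ x → x ≤ 1 / lam → (rosenU lam)^[h] x =
        ((lam-1) - (lam^2-lam-1) * x) / (1 - (lam-1)*x))
    (N : ℕ) (s v : ℕ → ℝ) (d : ℕ → ℤ)
    (H : NegSeq lam N s v d) (i : ℕ) (hi : d i = 2) (hiN : i + h + 2 ≤ N) :
    ∃ i', i' ≤ i + h + 1 ∧ d i' = 2 ∧ 
      ((s (i+1) = rosenF lam (s (i'+1)) ∧ v i' = rosenF lam (v i)) ∨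
       (1 / (lam - s (i+1)) ≤ rosenF lam (s (i'+1)) ∧ 1 / (lam - v i') ≤ rosenF lam (v i))) := by
  obtain ⟨a, ha, h2, h3, h4⟩ := run_lemma h lam hl1 hl2 B hB0 hBh hmono hBrec N s v d H h le_rfl
    (i+1) (by omega) (by have := H.shalf (i+1) (by omega); rw [hBh]; linarith)
  have hF : ∀ x, 0 ≤ x → x ≤ 1 → (rosenU lam)^[h] (1/(2*lam - x)) = rosenF lam x := by
    intro x hx0 hx1
    rw [hU _ (by apply div_nonneg <;> linarith) (by apply one_div_le_one_div_of_le <;> linarith), rosenF]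
    have p1 : 0 < 2*lam - x := by linarith
    have p2 : 0 < lam + 1 - x := by linarith
    have p3 : 1 - (lam-1) * (1/(2*lam-x)) = (lam+1-x) / (2*lam-x) := by
      rw [eq_div_iff p1.ne', sub_mul, mul_assoc, one_div_mul_cancel p1.ne']; ring
    have p4 : (lam-1) - (lam^2-lam-1) * (1/(2*lam-x)) = (lam^2-lam+1-(lam-1)*x) / (2*lam-x) := by
      rw [eq_div_iff p1.ne', sub_mul, mul_assoc, one_div_mul_cancel p1.ne']; ring
    rw [p3, p4]
    exact div_div_div_cancel_right₀ p1.ne' _ _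
  have hle : ∀ x, 0 ≤ x → x ≤ 1 → a < h → 1 / (lam - (rosenU lam)^[a] (1/(2*lam - x))) ≤ rosenF lam x := by
    intro x hx0 hx1 hah
    rw [← hF x hx0 hx1]
    have := iter_mono h lam hl1 hl2 B hB0 hBh hmono hBrec (1/(2*lam-x)) 
      (by apply div_nonneg <;> linarith) (by apply one_div_le_one_div_of_le <;> linarith) (h-(a+1)) (a+1) (by omega)
    rw [show a+1+(h-(a+1)) = h by omega, Function.iterate_succ_apply', rosenU] at this
    exact this
  have es : s (i+1+a) = 1 / (2*lam - s (i+1+a+1)) := by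
    rw [H.srec (i+1+a) (by omega), h2]; norm_num
  have ev : v (i+1) = 1 / (2*lam - v i) := by
    rw [H.vrec i (by omega), hi]; norm_num
  have b1 := H.spos (i+1+a+1) (by omega)
  have b2 := H.shalf (i+1+a+1) (by omega)
  have b3 := H.v0 i (by omega)
  have b4 := H.v1 i (by omega)
  refine ⟨i+1+a, by omega, h2, ?_⟩
  rw [es] at h3
  rw [ev] at h4
  rcases Nat.lt_or_ge a h with hah | hah
  · right
    rw [h3, h4]
    exact ⟨hle _ b1.le (by linarith) hah, hle _ b3 b4 hah⟩
  · left
    have : a = h := by omega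
    subst this
    rw [h3, h4]
    exact ⟨hF _ b1.le (by linarith), hF _ b3 b4⟩

lemma F_le (lam : ℝ) (hl1 : 8/5 < lam) (hl2 : lam < 2) (P x e : ℝ) (hP1 : P ≤ 1)
    (hx1 : x ≤ 1) (he : 0 ≤ e) (hx : x ≤ P + e) :
    rosenF lam x ≤ rosenF lam P + (2-lam) * e / (lam * (lam + 1 - P)) := by
  have e1 : rosenF lam x - rosenF lam P = (2-lam)*(x-P) / ((lam+1-x)*(lam+1-P)) := by
    have : lam+1-x ≠ 0 := by linarith
    have : lam+1-P ≠ 0 := by linarith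
    unfold rosenF
    field_simp
    ring
  have e2 : (2-lam)*(x-P) / ((lam+1-x)*(lam+1-P)) ≤ (2-lam) * e / (lam * (lam + 1 - P)) := by
    have q1 : 0 < lam + 1 - x := by linarith
    have q2 : 0 < lam + 1 - P := by linarith
    have q3 : 0 < lam := by linarith
    calc (2-lam)*(x-P) / ((lam+1-x)*(lam+1-P)) ≤ (2-lam)*e / ((lam+1-x)*(lam+1-P)) := by
          gcongr <;> linarith
      _ ≤ (2-lam) * e / (lam * (lam + 1 - P)) := by
          apply div_le_div_of_nonneg_left
          · apply mul_nonneg <;> linarith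
          · positivity
          · gcongr; linarith
  linarith

lemma rho_facts (lam ρ : ℝ) (hl1 : 8/5 < lam) (hl2 : lam < 2)
    (hρ : ρ = (lam - 2 + Real.sqrt (lam ^ 2 - 4 * lam + 8)) / 2) :
    4/5 < ρ ∧ ρ < 1 ∧ ρ^2 + (2-lam)*ρ - 1 = 0 ∧ lam/2 ≤ ρ ∧ 
      Real.sqrt (lam ^ 2 - 4 * lam + 8) = ρ + 1/ρ := by
  have hnn : 0 ≤ lam ^ 2 - 4 * lam + 8 := by nlinarith
  have hs := Real.sq_sqrt hnn
  have hs2 : 2 ≤ Real.sqrt (lam ^ 2 - 4 * lam + 8) := by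
    apply Real.le_sqrt_of_sq_le; nlinarith
  have hs4 : Real.sqrt (lam ^ 2 - 4 * lam + 8) < 4 - lam := by
    rw [Real.sqrt_lt' (by linarith)]; nlinarith
  set D := Real.sqrt (lam ^ 2 - 4 * lam + 8)
  have hD : D = 2*ρ + 2 - lam := by linarith
  have hq : ρ^2 + (2-lam)*ρ - 1 = 0 := by rw [hD] at hs; nlinarith
  refine ⟨by linarith, by linarith, hq, by linarith, ?_⟩
  have : ρ ≠ 0 := by intro h0; rw [h0] at hq; norm_num at hq
  have : 1/ρ = ρ + (2-lam) := by field_simp; linarith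
  rw [this]; linarith

/-- contraction facts -/
lemma F_contr (lam ρ : ℝ) (hl1 : 8/5 < lam) (hl2 : lam < 2) (h1 : 4/5 < ρ) (h2 : ρ < 1)
    (hq : ρ^2 + (2-lam)*ρ - 1 = 0) (x e : ℝ) (hx1 : x ≤ 1) (he : 0 ≤ e) :
    (x ≤ (lam - 1/ρ) + e → rosenF lam x ≤ (lam - ρ) + (2-lam)*e) ∧
    (x ≤ (lam - ρ) + e → ∀ y, y < lam → 1/(lam - y) ≤ rosenF lam x → y ≤ (lam - 1/ρ) + (2-lam)*e) := by
  have hinv : 1/ρ = ρ + (2-lam) := by field_simp; linarith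
  constructor
  · intro hx
    have hF : rosenF lam (lam - 1/ρ) = lam - ρ := by
      rw [rosenF, div_eq_iff (by rw [hinv]; linarith), hinv]; nlinarith
    have hge : 1 ≤ 1/ρ := by rw [le_div_iff₀ (by linarith)]; linarith
    have := F_le lam hl1 hl2 (lam - 1/ρ) x e (by linarith) hx1 he hx
    rw [hF] at this
    refine this.trans ?_
    gcongr
    apply div_le_self
    · apply mul_nonneg <;> linarith
    · rw [hinv]; nlinarith
  · intro hx y hy hyF
    have hF : rosenF lam (lam - ρ) = ρ := by
      rw [rosenF, div_eq_iff (by linarith)]; nlinarith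
    have := F_le lam hl1 hl2 (lam - ρ) x e (by nlinarith) hx1 he hx
    rw [hF] at this
    have hle : 1/(lam - y) ≤ ρ + (2-lam) * e / (lam * (lam + 1 - (lam - ρ))) := hyF.trans this
    set k := (2-lam)*e with hk
    have hk0 : 0 ≤ k := by apply mul_nonneg <;> linarith
    have hkk : k / (lam * (lam + 1 - (lam - ρ))) ≤ k * (2/5) := by
      rw [div_le_iff₀ (by nlinarith)]
      have : 1 ≤ (2/5) * (lam * (lam + 1 - (lam-ρ))) := by nlinarith
      nlinarith
    have h3 : 1/(lam - y) ≤ ρ + k*(2/5) := by linarith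
    rw [div_le_iff₀ (by linarith)] at h3
    by_contra hcon
    push Not at hcon
    have h4 : lam - y < 1/ρ - k := by linarith
    have h5 : 1 < (ρ + k*(2/5)) * (1/ρ - k) := by
      refine lt_of_le_of_lt h3 ?_
      apply mul_lt_mul_of_pos_left h4; nlinarith
    have h6 : (ρ + k*(2/5)) * (1/ρ - k) = 1 - ρ*k + (2/5)*k*(1/ρ) - (2/5)*k^2 := by
      have : ρ * (1/ρ) = 1 := by rw [mul_one_div_cancel]; linarith
      linear_combination this
    have h7 : 1/ρ ≤ 5/4 := by rw [div_le_iff₀ (by linarith)]; linarith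
    nlinarith [mul_le_mul_of_nonneg_left h7 hk0, mul_le_mul_of_nonneg_left h1.le hk0]

lemma F_gt (lam x : ℝ) (hl1 : 8/5 < lam) (hl2 : lam < 2) (hx : x ≤ 1) : lam - 1 < rosenF lam x := by
  rw [rosenF, lt_div_iff₀ (by linarith)]; nlinarith

lemma F_half (lam x : ℝ) (hl1 : 8/5 < lam) (hl2 : lam < 2) (hx : x ≤ 1) (hF : rosenF lam x ≤ lam/2) :
    x ≤ lam - 1 := by
  rw [rosenF, div_le_iff₀ (by linarith)] at hF
  nlinarith

lemma abstract_main (h : ℕ) (lam : ℝ) (hl1 : 8/5 < lam) (hl2 : lam < 2) (B : ℕ → ℝ)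
    (hB0 : B 0 = 0) (hBh : B (h+1) = 1) (hmono : ∀ a ≤ h, B a < B (a+1))
    (hBrec : ∀ a ≤ h, B (a+1) = 1 / (lam - B a)) 
    (hU : ∀ x, 0 ≤ x → x ≤ 1 / lam → (rosenU lam)^[h] x =
        ((lam-1) - (lam^2-lam-1) * x) / (1 - (lam-1)*x))
    (ρ : ℝ) (h1 : 4/5 < ρ) (h2 : ρ < 1) (hq : ρ^2 + (2-lam)*ρ - 1 = 0)
    (N : ℕ) (s v : ℕ → ℝ) (d : ℕ → ℤ)
    (H : NegSeq lam N s v d) (j : ℕ) (hj : h + 1 + (h+1)*(2*j) ≤ N) :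
    ∃ i < N, d i = 2 ∧ s (i+1) + v i ≤ (lam - ρ) + (lam - 1/ρ) + 2 * (2-lam)^j := by
  have hinv : 1/ρ = ρ + (2-lam) := by field_simp; linarith
  have step := step_lemma h lam hl1 hl2 B hB0 hBh hmono hBrec hU N s v d H
  have contr := F_contr lam ρ hl1 hl2 h1 h2 hq
  have hκ : ∀ j : ℕ, 0 ≤ (2-lam)^j := fun j => pow_nonneg (by linarith) j
  have hA : 0 ≤ lam - ρ := by linarith
  have hBB : 0 ≤ lam - 1/ρ := by rw [hinv]; linarith
  have hAB : lam - 1/ρ ≤ lam - ρ := by rw [hinv]; linarith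
  have hX : ∀ j i, d i = 2 → i + 1 + (h+1)*j ≤ N → s (i+1) ≤ (lam - ρ) + (2-lam)^j ∧ 
      (s (i+1) ≤ lam - 1 → s (i+1) ≤ (lam - 1/ρ) + (2-lam)^j) := by
    intro j
    induction j with
    | zero =>
      intro i _ hi
      have := H.shalf (i+1) (by omega)
      simp only [pow_zero]
      constructor
      · linarith
      · intro _; linarith
    | succ j ih =>
      intro i hd hi
      rw [Nat.mul_succ] at hi
      have b0 := H.shalf (i+1) (by omega)
      obtain ⟨i', hi', hd', hc⟩ := step i hd (by omega)
      obtain ⟨x1, x2⟩ := ih i' hd' (by omega)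
      have b1 := H.shalf (i'+1) (by omega)
      rw [pow_succ']
      rcases hc with ⟨c1, _⟩ | ⟨c1, _⟩
      · have g := F_gt lam (s (i'+1)) hl1 hl2 (by linarith)
        refine ⟨?_, fun hcon => by rw [c1] at hcon; linarith⟩
        rw [c1]
        exact (contr _ _ (by linarith) (hκ j)).1 (x2 (F_half lam _ hl1 hl2 (by linarith) (by rw [← c1]; exact b0)))
      · have := (contr _ _ (by linarith) (hκ j)).2 x1 (s (i+1)) (by linarith) c1
        exact ⟨by linarith, fun _ => this⟩
  have hY : ∀ j, h + 1 + (h+1)*j ≤ N → ∃ i ≤ h + (h+1)*j, d i = 2 ∧ 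
      (v i ≤ (lam - 1/ρ) + (2-lam)^j ∨ (v i ≤ (lam - ρ) + (2-lam)^j ∧ s (i+1) ≤ lam - 1)) := by
    intro j
    induction j with
    | zero =>
      intro hN
      obtain ⟨a, ha, hda, _, _⟩ := run_lemma h lam hl1 hl2 B hB0 hBh hmono hBrec N s v d H h le_rfl
        0 (by omega) (by have := H.shalf 0 (by omega); rw [hBh]; linarith)
      rw [Nat.zero_add] at hda
      refine ⟨a, by omega, hda, Or.inl ?_⟩
      have := H.v1 a (by omega)
      simp only [pow_zero]; linarith
    | succ j ih =>
      intro hN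
      rw [Nat.mul_succ] at hN
      obtain ⟨i, hi, hd, hv⟩ := ih (by omega)
      obtain ⟨i', hi', hd', hc⟩ := step i hd (by omega)
      refine ⟨i', by rw [Nat.mul_succ]; omega, hd', ?_⟩
      have b0 := H.shalf (i+1) (by omega)
      have b1 := H.shalf (i'+1) (by omega)
      have b2 := H.v1 i (by omega)
      have b3 := H.v1 i' (by omega)
      rw [pow_succ']
      rcases hc with ⟨c1, c2⟩ | ⟨c1, c2⟩
      · right
        have g := F_gt lam (s (i'+1)) hl1 hl2 (by linarith)
        have hv' : v i ≤ (lam - 1/ρ) + (2-lam)^j := by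
          rcases hv with hv | hv
          · exact hv
          · exfalso; linarith [hv.2]
        refine ⟨?_, F_half lam _ hl1 hl2 (by linarith) (by rw [← c1]; exact b0)⟩
        rw [c2]
        exact (contr _ _ b2 (hκ j)).1 hv'
      · left
        have hv' : v i ≤ (lam - ρ) + (2-lam)^j := by
          rcases hv with hv | hv
          · linarith
          · exact hv.1
        exact (contr _ _ b2 (hκ j)).2 hv' (v i') (by linarith) c2
  have e : (h+1)*(2*j) = (h+1)*j + (h+1)*j := by ring
  obtain ⟨i, hi, hd, hv⟩ := hY j (by omega)
  obtain ⟨x1, x2⟩ := hX j i hd (by omega)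
  refine ⟨i, by omega, hd, ?_⟩
  rcases hv with hv | ⟨hv, hs⟩
  · linarith
  · linarith [x2 hs]

lemma T_eq (lam α y : ℝ) (hy : y ≠ 0) :
    rosenT lam α y = Real.sign y / y - lam * (rosenD lam α y : ℝ) := by
  rw [rosenT, if_neg hy]

lemma T_range (lam α y : ℝ) (hlam : 0 < lam) (hy : y ≠ 0) :
    (α - 1) * lam ≤ rosenT lam α y ∧ rosenT lam α y < α * lam := by
  rw [T_eq _ _ _ hy]
  have e : Real.sign y / y = lam * |1/(lam*y)| := by
    rcases lt_or_gt_of_ne hy with h | h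
    · rw [Real.sign_of_neg h, abs_of_neg (by apply div_neg_of_pos_of_neg <;> nlinarith)]; field_simp
    · rw [Real.sign_of_pos h, abs_of_pos (by positivity)]; field_simp
  have f1 := Int.floor_le (|1/(lam*y)| + 1 - α)
  have f2 := Int.lt_floor_add_one (|1/(lam*y)| + 1 - α)
  rw [e, rosenD]
  constructor <;> nlinarith

lemma D_pos (lam α y : ℝ) (hlam : 0 < lam) (hy : y ≠ 0) (hα : α * lam ≤ 1) (hy1 : |y| ≤ 1) :
    1 ≤ rosenD lam α y := by
  rw [rosenD, Int.le_floor]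
  have : α ≤ |1/(lam*y)| := by
    have hp : 0 < |y| := abs_pos.mpr hy
    rw [abs_div, abs_mul, abs_one, abs_of_pos hlam, le_div_iff₀ (by positivity)]
    calc α * (lam * |y|) = (α * lam) * |y| := by ring
      _ ≤ 1 * 1 := by gcongr
      _ = 1 := by norm_num
  push_cast; linarith

lemma orbit_range (lam α x : ℝ) (hlam : 0 < lam) 
    (hx : x ∈ Set.Ico ((α - 1) * lam) (α * lam)) (hG : GIrrational lam α x) (n : ℕ) :
    (α - 1) * lam ≤ (rosenT lam α)^[n] x ∧ (rosenT lam α)^[n] x < α * lam := by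
  cases n with
  | zero => exact hx
  | succ n => rw [Function.iterate_succ_apply']; exact T_range lam α _ hlam (hG n)

lemma PQ_x (lam α x : ℝ) (hG : GIrrational lam α x) (n : ℕ) :
    x * (rosenPQ lam α x 0 1 (n+1) + (rosenT lam α)^[n] x * rosenPQ lam α x 0 1 n) =
      rosenPQ lam α x 1 0 (n+1) + (rosenT lam α)^[n] x * rosenPQ lam α x 1 0 n := by
  induction n with
  | zero => simp [rosenPQ]
  | succ n ih =>
    have h0 := hG n
    rw [Function.iterate_succ_apply', T_eq _ _ _ h0, rosenPQ, rosenPQ]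
    generalize (rosenT lam α)^[n] x = t at *
    have key : ∀ a b D : ℝ, D * lam * a + Real.sign t * b + (Real.sign t / t - lam * D) * a 
        = (Real.sign t / t) * (a + t * b) := by
      intro a b D; field_simp; ring
    rw [key, key, ← ih]; ring

lemma PQ_det (lam α x : ℝ) (hG : GIrrational lam α x) (n : ℕ) :
    |rosenPQ lam α x 1 0 n * rosenPQ lam α x 0 1 (n+1) - 
      rosenPQ lam α x 1 0 (n+1) * rosenPQ lam α x 0 1 n| = 1 := by
  induction n with
  | zero => simp [rosenPQ]
  | succ n ih =>
    have h0 := hG n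
    rw [rosenPQ, rosenPQ]
    generalize (rosenT lam α)^[n] x = t at *
    have hs : |Real.sign t| = 1 := by
      rcases lt_or_gt_of_ne h0 with h | h
      · rw [Real.sign_of_neg h]; simp
      · rw [Real.sign_of_pos h]; simp
    rw [show ∀ a b c d D : ℝ, a * (D * lam * b + Real.sign t * c) - (D * lam * a + Real.sign t * d) * b 
      = Real.sign t * (- (d * b - a * c)) by intros; ring, abs_mul, hs, abs_neg, one_mul, ih]

lemma Theta_eq (lam α x : ℝ) (hG : GIrrational lam α x) (n : ℕ) 
    (hQ : 0 < rosenPQ lam α x 0 1 (n+1)) 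
    (hv : 0 < 1 + (rosenT lam α)^[n] x * (rosenPQ lam α x 0 1 n / rosenPQ lam α x 0 1 (n+1))) :
    rosenTheta lam α x n = |(rosenT lam α)^[n] x| / 
      (1 + (rosenT lam α)^[n] x * (rosenPQ lam α x 0 1 n / rosenPQ lam α x 0 1 (n+1))) := by
  have h1 := PQ_x lam α x hG n
  have h2 := PQ_det lam α x hG n
  rw [rosenTheta]
  generalize (rosenT lam α)^[n] x = t at *
  generalize rosenPQ lam α x 0 1 (n+1) = a at *
  generalize rosenPQ lam α x 0 1 n = b at *
  generalize rosenPQ lam α x 1 0 (n+1) = p at *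
  generalize rosenPQ lam α x 1 0 n = r at *
  have e : 1 + t * (b/a) = (a + t*b)/a := by field_simp
  rw [e] at hv ⊢
  have hpos : 0 < a + t*b := by
    have := mul_pos hv hQ
    rwa [div_mul_cancel₀ _ hQ.ne'] at this
  have e2 : x - p/a = t * (r*a - p*b) / (a * (a+t*b)) := by
    have : x = (p + t*r)/(a+t*b) := by rw [eq_div_iff hpos.ne']; exact h1
    rw [this, div_sub_div _ _ hpos.ne' hQ.ne', mul_comm a (a+t*b)]
    congr 1; ring
  rw [e2, abs_div, abs_mul, h2, abs_of_pos (mul_pos hQ hpos)]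
  field_simp

lemma orbit_inv (h : ℕ) (lam : ℝ) (hl1 : 8/5 < lam) (hl2 : lam < 2) (B : ℕ → ℝ)
    (hB0 : B 0 = 0) (hBh : B (h+1) = 1) (hmono : ∀ a ≤ h, B a < B (a+1))
    (hBrec : ∀ a ≤ h, B (a+1) = 1 / (lam - B a)) 
    (t v : ℕ → ℝ) (d : ℕ → ℤ) (ht0 : ∀ n, t n ≠ 0) (ht1 : ∀ n, |t n| < 1) (hd : ∀ n, 1 ≤ d n)
    (hv0 : v 0 = 0) (ht : ∀ n, t (n+1) = Real.sign (t n) / t n - lam * d n)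
    (hv : ∀ n, v (n+1) = 1 / (d n * lam + Real.sign (t n) * v n)) :
    ∀ n, 0 ≤ v n ∧ (t n < 0 → ∃ r ≤ h, v n ≤ B (r+1) ∧ - t n < B (h+1-r)) := by
  have hb := B_bounds h B hB0 hBh hmono
  have hB1 : B 1 = 1/lam := by have := hBrec 0 (by omega); rw [hB0] at this; simpa using this
  intro n
  induction n with
  | zero =>
    rw [hv0]
    refine ⟨le_rfl, fun hneg => ⟨0, by omega, (hb 1 (by omega)).1, ?_⟩⟩
    have := ht1 0
    rw [abs_of_neg hneg] at this
    simpa [hBh] using this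
  | succ n ih =>
    obtain ⟨i1, i2⟩ := ih
    have hdn : (1:ℝ) ≤ d n := by exact_mod_cast hd n
    have small : 0 ≤ v (n+1) → v (n+1) ≤ 1/lam → 0 ≤ v (n+1) ∧ (t (n+1) < 0 → ∃ r ≤ h, v (n+1) ≤ B (r+1) ∧ - t (n+1) < B (h+1-r)) := by
      intro h0 h1
      refine ⟨h0, fun hneg => ⟨0, by omega, by rw [Nat.zero_add, hB1]; exact h1, ?_⟩⟩
      have := ht1 (n+1)
      rw [abs_of_neg hneg] at this
      simpa [hBh] using this
    rcases lt_or_gt_of_ne (ht0 n) with hneg | hpos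
    · obtain ⟨r, hr, hr1, hr2⟩ := i2 hneg
      have hbr := hb (r+1) (by omega)
      have hvn := hv n
      have htn := ht n
      rw [Real.sign_of_neg hneg] at hvn htn
      rcases (hd n).lt_or_eq with hd2 | hd1
      · have hd2' : (2:ℝ) ≤ d n := by exact_mod_cast hd2
        apply small
        · rw [hvn]; apply div_nonneg
          · norm_num
          · nlinarith
        · rw [hvn]; apply one_div_le_one_div_of_le
          · linarith
          · nlinarith
      · rw [← hd1] at hvn htn
        push_cast at hvn htn
        refine ⟨?_, ?_⟩
        · rw [hvn]; apply div_nonneg <;> linarith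
        · intro hneg'
          have hB' := hBrec (h-r) (by omega)
          have hbb := hb (h-r) (by omega)
          rw [show h - r + 1 = h+1-r by omega] at hB'
          have hs' : - t (n+1) < B (h-r) := by
            rw [hB', lt_div_iff₀ (by linarith)] at hr2
            have e : t n * t (n+1) = -1 - lam * t n := by rw [htn, mul_sub, mul_div_cancel₀ _ (ht0 n)]; ring
            have : - t n * (-t (n+1)) < (-t n) * B (h-r) := by nlinarith
            exact lt_of_mul_lt_mul_left this (by linarith)
          have hrh : r < h := by
            by_contra hcon
            have : h - r = 0 := by omega
            rw [this, hB0] at hs'; linarith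
          refine ⟨r+1, by omega, ?_, ?_⟩
          · rw [hBrec (r+1) (by omega), hvn]
            apply one_div_le_one_div_of_le <;> linarith
          · rw [show h+1-(r+1) = h - r by omega]; exact hs'
    · have hvn := hv n
      rw [Real.sign_of_pos hpos] at hvn
      apply small
      · rw [hvn]; apply div_nonneg
        · norm_num
        · nlinarith
      · rw [hvn]; apply one_div_le_one_div_of_le
        · linarith
        · nlinarith

/-- The second coordinate of the natural extension, along an orbit. -/
noncomputable def rosenV (lam : ℝ) (t : ℕ → ℝ) (d : ℕ → ℤ) : ℕ → ℝ
  | 0 => 0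
  | n+1 => 1 / (d n * lam + Real.sign (t n) * rosenV lam t d n)

lemma prev_theta (lam T V D : ℝ) (hW : 0 < D * lam + Real.sign T * V) (hT : T ≠ 0) (hTV : 0 < 1 + T * V) :
    |T| / (1 + T * V) = 1 / (D * lam + Real.sign T * V) /
      (1 + 1 / (D * lam + Real.sign T * V) * (Real.sign T / T - lam * D)) := by
  obtain ⟨W, hWd⟩ : ∃ W, W = D * lam + Real.sign T * V := ⟨_, rfl⟩
  have hc : lam * D = W - Real.sign T * V := by rw [hWd]; ring
  rw [← hWd] at hW ⊢
  rw [hc]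
  have e0 : Real.sign T / T = 1 / |T| := by
    rcases lt_or_gt_of_ne hT with h | h
    · rw [Real.sign_of_neg h, abs_of_neg h]; field_simp
    · rw [Real.sign_of_pos h, abs_of_pos h]
  have e1 : Real.sign T = T / |T| := by
    rcases lt_or_gt_of_ne hT with h | h
    · rw [Real.sign_of_neg h, abs_of_neg h]; field_simp
    · rw [Real.sign_of_pos h, abs_of_pos h]; field_simp
  have hp : 0 < |T| := abs_pos.mpr hT
  rw [e0, e1]
  have e2 : 1 + 1 / W * (1 / |T| - (W - T / |T| * V)) = (1 + T * V) / (W * |T|) := by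
    field_simp; ring
  rw [e2]
  field_simp

set_option maxHeartbeats 2000000 in
/-- The core: a window contains a small approximation coefficient. -/
lemma core (h : ℕ) (hh : 1 ≤ h) (lam : ℝ)
    (hlam : lam = 2 * Real.cos (Real.pi / (2 * (h : ℝ) + 3)))
    (ρ : ℝ) (hρ : ρ = (lam - 2 + Real.sqrt (lam ^ 2 - 4 * lam + 8)) / 2)
    (α : ℝ) (hα : α ∈ Set.Icc (1 / 2 : ℝ) (ρ / lam)) (x : ℝ)
    (hx : x ∈ Set.Ico ((α - 1) * lam) (α * lam)) (hG : GIrrational lam α x)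
    (n N j : ℕ) (hn : 1 ≤ n) (hj1 : 1 ≤ j) (hj : h + 1 + (h+1)*(2*j) ≤ N) :
    ∃ m, n - 1 ≤ m ∧ m ≤ n + N ∧ rosenTheta lam α x m ≤ 1 / (ρ + 1/ρ - 2 * (2-lam)^j) := by
  obtain ⟨hl1, hl2⟩ := lam_bounds_s17 h hh lam hlam
  obtain ⟨h1, h2, hq, h3, -⟩ := rho_facts lam ρ hl1 hl2 hρ
  obtain ⟨B, hB0, hBh, hmono, hBrec, hU⟩ := trig_facts h hh lam hlam
  obtain ⟨hα1, hα2⟩ := hα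
  rw [le_div_iff₀ (by linarith)] at hα2
  set t : ℕ → ℝ := fun n => (rosenT lam α)^[n] x with htdef
  set Q : ℕ → ℝ := rosenPQ lam α x 0 1 with hQdef
  set d : ℕ → ℤ := fun n => rosenD lam α (t n) with hddef
  set v : ℕ → ℝ := rosenV lam t d with hvdef
  have ht0 : ∀ n, t n ≠ 0 := hG
  have hr : ∀ n, (α - 1) * lam ≤ t n ∧ t n < α * lam := orbit_range lam α x (by linarith) hx hG
  have ht1 : ∀ n, |t n| < 1 := by
    intro n
    obtain ⟨a, b⟩ := hr n
    rw [abs_lt]; constructor <;> nlinarith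
  have hd : ∀ n, 1 ≤ d n := fun n =>
    D_pos lam α (t n) (by linarith) (ht0 n) (by linarith) (ht1 n).le
  have ht : ∀ n, t (n+1) = Real.sign (t n) / t n - lam * d n := by
    intro n
    simp only [htdef, hddef]
    rw [Function.iterate_succ_apply', T_eq _ _ _ (hG n)]
  have hQr : ∀ n, Q (n+2) = d n * lam * Q (n+1) + Real.sign (t n) * Q n := fun n => rfl
  have hv0 : v 0 = 0 := rfl
  have hv : ∀ n, v (n+1) = 1 / (d n * lam + Real.sign (t n) * v n) := fun n => rfl
  have inv := orbit_inv h lam hl1 hl2 B hB0 hBh hmono hBrec t v d ht0 ht1 hd hv0 ht hv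
  have hb := B_bounds h B hB0 hBh hmono
  have hv1 : ∀ n, t n < 0 → v n ≤ 1 := by
    intro n hneg
    obtain ⟨r, hr, hr1, _⟩ := (inv n).2 hneg
    exact hr1.trans (hb (r+1) (by omega)).2
  have hden : ∀ n, 0 < d n * lam + Real.sign (t n) * v n := by
    intro n
    have hdn : (1:ℝ) ≤ d n := by exact_mod_cast hd n
    have i1 := (inv n).1
    rcases lt_or_gt_of_ne (ht0 n) with hneg | hpos
    · have := hv1 n hneg
      rw [Real.sign_of_neg hneg]; nlinarith
    · rw [Real.sign_of_pos hpos]; nlinarith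
  have hQ : ∀ n, 0 < Q (n+1) ∧ Q n = v n * Q (n+1) := by
    intro n
    induction n with
    | zero => rw [hv0]; simp [hQdef, rosenPQ]
    | succ n ih =>
      obtain ⟨a1, a2⟩ := ih
      have e : Q (n+1+1) = Q (n+1) * (d n * lam + Real.sign (t n) * v n) := by
        rw [show n+1+1 = n+2 from rfl, hQr n, a2]; ring
      have p := hden n
      rw [e, hv n]
      refine ⟨mul_pos a1 p, ?_⟩
      field_simp
  have h1tv : ∀ n, 0 < 1 + t n * v n := by
    intro n
    have i1 := (inv n).1
    rcases lt_or_gt_of_ne (ht0 n) with hneg | hpos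
    · have a := hv1 n hneg
      have b := (abs_lt.mp (ht1 n)).1
      nlinarith
    · nlinarith [mul_nonneg hpos.le i1]
  have hTh : ∀ n, rosenTheta lam α x n = |t n| / (1 + t n * v n) := by
    intro n
    have e : v n = rosenPQ lam α x 0 1 n / rosenPQ lam α x 0 1 (n+1) := by
      rw [eq_div_iff (hQ n).1.ne']; exact (hQ n).2.symm
    have p := h1tv n
    rw [e] at p ⊢
    exact Theta_eq lam α x hG n (hQ n).1 p
  have hκ0 : 0 ≤ (2-lam)^j := pow_nonneg (by linarith) j
  have hκ1 : (2-lam)^j ≤ 2 - lam := pow_le_of_le_one (by linarith) (by linarith) (by omega)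
  have hinv : 1/ρ = ρ + (2-lam) := by field_simp; linarith
  have hE : 0 < ρ + 1/ρ - 2 * (2-lam)^j := by rw [hinv]; nlinarith
  set E := ρ + 1/ρ - 2 * (2-lam)^j with hEdef
  by_cases hposex : ∃ m, n ≤ m ∧ m ≤ n + N ∧ 0 < t m
  · obtain ⟨m, hm1, hm2, hm⟩ := hposex
    have hvm := (inv m).1
    have htρ : t m < ρ := by have := (hr m).2; linarith
    have key : ∀ a b : ℝ, 0 ≤ a → a ≤ b → a < ρ → a / (1 + a * b) ≤ 1/E := by
      intro a b ha hab haρ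
      have hb0 : 0 ≤ b := ha.trans hab
      rw [div_le_div_iff₀ (by positivity) hE]
      have hEle : E ≤ ρ + 1/ρ := by rw [hEdef]; linarith
      have h5 : a * (ρ + 1/ρ) ≤ 1 + a * a := by
        have h6 : a * (ρ + 1/ρ) = a * (ρ^2+1) / ρ := by field_simp
        rw [h6, div_le_iff₀ (by linarith)]
        nlinarith [mul_nonneg (sub_nonneg.mpr haρ.le) (show 0 ≤ 1 - ρ * a by nlinarith)]
      nlinarith [mul_le_mul_of_nonneg_left hEle ha, mul_le_mul_of_nonneg_left hab ha]
    rcases le_total (t m) (v m) with hc | hc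
    · refine ⟨m, by omega, hm2, ?_⟩
      rw [hTh m, abs_of_pos hm]
      exact key _ _ hm.le hc htρ
    · obtain ⟨m', rfl⟩ : ∃ m', m = m' + 1 := ⟨m-1, by omega⟩
      refine ⟨m', by omega, by omega, ?_⟩
      have e : rosenTheta lam α x m' = v (m'+1) / (1 + v (m'+1) * t (m'+1)) := by
        rw [hTh m', hv m', ht m']
        have p1 := hden m'
        have p2 := h1tv m'
        have p3 := ht0 m'
        exact prev_theta lam (t m') (v m') (d m') p1 p3 p2
      rw [e]
      exact key _ _ hvm hc (lt_of_le_of_lt hc htρ)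
  · have hneg : ∀ m, n ≤ m → m ≤ n + N → t m < 0 := by
      intro m hm1 hm2
      rcases lt_or_gt_of_ne (ht0 m) with hc | hc
      · exact hc
      · exact absurd ⟨m, hm1, hm2, hc⟩ hposex
    have hrel : ∀ m, n ≤ m → m < n + N → (-t m) * (d m * lam + t (m+1)) = 1 := by
      intro m hm1 hm2
      have hm := hneg m hm1 hm2.le
      rw [ht m, Real.sign_of_neg hm]
      have := ht0 m
      field_simp
      ring
    have good : ∀ m, n ≤ m → m < n + N → E ≤ d m * lam + t (m+1) - v m → 
        rosenTheta lam α x m ≤ 1/E := by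
      intro m hm1 hm2 hle
      have hm := hneg m hm1 hm2.le
      have hre := hrel m hm1 hm2
      rw [hTh m, abs_of_neg hm, div_le_div_iff₀ (h1tv m) hE]
      nlinarith [mul_le_mul_of_nonneg_left hle (show 0 ≤ -t m by linarith)]
    by_cases hbig : ∃ m, n ≤ m ∧ m < n + N ∧ 3 ≤ d m
    · obtain ⟨m, hm1, hm2, hm⟩ := hbig
      refine ⟨m, by omega, by omega, good m hm1 hm2 ?_⟩
      have hm' : (3:ℝ) ≤ d m := by exact_mod_cast hm
      have a1 := hv1 m (hneg m hm1 hm2.le)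
      have a2 := (abs_lt.mp (ht1 (m+1))).1
      have a3 : E ≤ 4 - lam := by rw [hEdef, hinv]; linarith
      nlinarith
    · have H : NegSeq lam N (fun m => - t (n+m)) (fun m => v (n+m)) (fun m => d (n+m)) := by
        refine ⟨?_, ?_, ?_, ?_, ?_, ?_, ?_⟩
        · intro m hm; have := hneg (n+m) (by omega) (by omega); linarith
        · intro m hm; have := (hr (n+m)).1; nlinarith
        · intro m hm; exact (inv (n+m)).1
        · intro m hm; exact hv1 _ (hneg (n+m) (by omega) (by omega))
        · intro m hm
          have := hrel (n+m) (by omega) (by omega)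
          rw [sub_neg_eq_add, ← add_assoc]
          exact eq_one_div_of_mul_eq_one_left this
        · intro m hm
          rw [← add_assoc, hv (n+m), Real.sign_of_neg (hneg (n+m) (by omega) (by omega))]
          congr 1; ring
        · intro m hm
          have a1 := hd (n+m)
          have a2 : ¬ 3 ≤ d (n+m) := fun hc => hbig ⟨n+m, by omega, by omega, hc⟩
          omega
      obtain ⟨i, hiN, hdi, hi⟩ := abstract_main h lam hl1 hl2 B hB0 hBh hmono hBrec hU ρ h1 h2 hq N _ _ _ H j hj
      refine ⟨n+i, by omega, by omega, good (n+i) (by omega) (by omega) ?_⟩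
      rw [hdi]
      rw [← add_assoc] at hi
      rw [hEdef]
      push_cast
      linarith

/-- **Theorem 4.3(i)** (Tong's spectrum for odd α-Rosen fractions,
`α ∈ [1/2, ρ/λ]`).  For odd `q = 2h+3`, `h ≥ 1`, `λ = 2cos(π/q)` and
`ρ = (λ-2+√(λ²-4λ+8))/2`, there are constants `c_k` strictly decreasing (for
`k ≥ 1`) to `ℋ_q = 1/√(λ²-4λ+8)` and a positive integer `K` such that for every
`G_q`-irrational `x`, all `n ≥ 1` and `k > K`,
`min{Θ_{n-1}, Θ_n, …, Θ_{n+k(2h+1)}} < c_k`. -/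
theorem tong_odd_small_alpha (h : ℕ) (hh : 1 ≤ h) (lam : ℝ)
    (hlam : lam = 2 * Real.cos (Real.pi / (2 * (h : ℝ) + 3)))
    (ρ Hq : ℝ) (hρ : ρ = (lam - 2 + Real.sqrt (lam ^ 2 - 4 * lam + 8)) / 2)
    (hHq : Hq = 1 / Real.sqrt (lam ^ 2 - 4 * lam + 8))
    (α : ℝ) (hα : α ∈ Set.Icc (1 / 2 : ℝ) (ρ / lam)) :
    ∃ c : ℕ → ℝ,
      (∀ k : ℕ, 1 ≤ k → c (k + 1) < c k) ∧
      Filter.Tendsto c Filter.atTop (nhds Hq) ∧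
      ∃ K : ℕ, 0 < K ∧
        ∀ x ∈ Set.Ico ((α - 1) * lam) (α * lam), GIrrational lam α x →
          ∀ n k : ℕ, 1 ≤ n → K < k →
            ∃ m : ℕ, n - 1 ≤ m ∧ m ≤ n + k * (2 * h + 1) ∧
              rosenTheta lam α x m < c k := by
  obtain ⟨hl1, hl2⟩ := lam_bounds_s17 h hh lam hlam
  obtain ⟨h1, h2, hq, h3, hL⟩ := rho_facts lam ρ hl1 hl2 hρ
  have hinv : 1/ρ = ρ + (2-lam) := by field_simp; linarith
  have hκ0 : ∀ j, 0 < (2-lam)^j := fun j => pow_pos (by linarith) j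
  have hE : ∀ j : ℕ, 1 ≤ j → 0 < ρ + 1/ρ - 2 * (2-lam)^j := by
    intro j hj
    have hκ1 : (2-lam)^j ≤ 2 - lam := pow_le_of_le_one (by linarith) (by linarith) (by omega)
    rw [hinv]; nlinarith
  refine ⟨fun k => 1 / (ρ + 1/ρ - 2 * (2-lam)^(k/4+1)) + 1 / ((k:ℝ) + 1), ?_, ?_, 20, by norm_num, ?_⟩
  · intro k _
    apply add_lt_add_of_le_of_lt
    · apply one_div_le_one_div_of_le (hE _ (by omega))
      have : (2-lam)^((k+1)/4+1) ≤ (2-lam)^(k/4+1) := 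
        pow_le_pow_of_le_one (by linarith) (by linarith) (by omega)
      linarith
    · apply one_div_lt_one_div_of_lt
      · positivity
      · push_cast; linarith
  · have hk : Filter.Tendsto (fun k : ℕ => k/4+1) Filter.atTop Filter.atTop := by
      apply Filter.tendsto_atTop_mono (f := fun k : ℕ => k/4) (fun k => by omega)
      exact Filter.tendsto_atTop_atTop.mpr fun b => ⟨4*b, fun a ha => by omega⟩
    have hp : Filter.Tendsto (fun k : ℕ => (2-lam)^(k/4+1)) Filter.atTop (nhds 0) :=
      (tendsto_pow_atTop_nhds_zero_of_lt_one (by linarith) (by linarith)).comp hk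
    have hq2 : Filter.Tendsto (fun k : ℕ => ρ + 1/ρ - 2 * (2-lam)^(k/4+1)) Filter.atTop 
        (nhds (ρ + 1/ρ - 2 * 0)) := (hp.const_mul 2).const_sub _
    have hne : ρ + 1/ρ - 2 * 0 ≠ 0 := by rw [hinv]; nlinarith
    have := ((tendsto_const_nhds (x := (1:ℝ))).div hq2 hne).add tendsto_one_div_add_atTop_nhds_zero_nat
    rw [hHq, hL]
    simpa using this
  · intro x hx hG n k hn hk
    have hjN : h + 1 + (h+1)*(2*(k/4+1)) ≤ k * (2*h+1) := by
      have e : h + 1 + (h+1)*(2*(k/4+1)) = (2*(k/4+1)+1) * (h+1) := by ring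
      rw [e]
      exact Nat.mul_le_mul (by omega) (by omega)
    obtain ⟨m, hm1, hm2, hm⟩ := core h hh lam hlam ρ hρ α hα x hx hG n (k*(2*h+1)) (k/4+1) hn (by omega) hjN
    refine ⟨m, hm1, hm2, lt_of_le_of_lt hm ?_⟩
    have : (0:ℝ) < 1 / ((k:ℝ)+1) := by positivity
    simp only
    linarith
end

section
/- Let q = 2h+3 be odd (h ≥ 0), λ = 2·cos(π/q), ρ = (λ−2+√(λ²−4λ+8))/2, ℋ_q = 1/√(λ²−4λ+8), and α_L = ℋ_q/(λ(1−ℋ_q)). Then ρ/λ < α_L < 1/λ, and for every α ∈ [α_L, 1/λ] the Lenstra constant satisfies ℒ_α = αλ/(αλ+1); in particular ℒ_α ≥ ℋ_q for α ∈ [α_L, 1/λ], with ℒ_α > ℋ_q if and only if α > α_L. -/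
/-- The natural extension domain `Ω_α = ⋃_{n=1}^{2h+2} J_n × [0, H_n]` for odd
`q = 2h+3` and `α ∈ (ρ/λ, 1/λ]`, where `J_{2n-1} = [l_{n-1}, r_n)` for
`n = 1, …, h+1`, `J_{2n} = [r_n, l_n)` for `n = 1, …, h`, and
`J_{2h+2} = [r_{h+1}, r_0)`. -/
noncomputable def OmegaOdd (lam α : ℝ) (h : ℕ) : Set (ℝ × ℝ) :=
  (⋃ n ∈ Finset.Icc 1 (h + 1),
      Set.Ico (lseq lam α (n - 1)) (rseq lam α n) ×ˢ
        Set.Icc (0 : ℝ) (Hs lam (2 * n - 1))) ∪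
    (⋃ n ∈ Finset.Icc 1 h,
      Set.Ico (rseq lam α n) (lseq lam α n) ×ˢ Set.Icc (0 : ℝ) (Hs lam (2 * n))) ∪
    Set.Ico (rseq lam α (h + 1)) (rseq lam α 0) ×ˢ
      Set.Icc (0 : ℝ) (Hs lam (2 * h + 2))

/-- The Lenstra constant `ℒ_α`: the supremum of all `c > 0` such that the curve
`v = c/(1 - ct)` stays inside `Ω_α` for all `t ∈ [l_0, r_0)`. -/
noncomputable def lenstraOdd (lam α : ℝ) (h : ℕ) : ℝ :=
  sSup {c : ℝ | 0 < c ∧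
    ∀ t ∈ Set.Ico ((α - 1) * lam) (α * lam), (t, c / (1 - c * t)) ∈ OmegaOdd lam α h}

/-- Abstract data used in the proof. -/
structure RData (h : ℕ) (lam x : ℝ) (b : ℕ → ℝ) : Prop where
  b0 : b 0 = 0
  b1 : b 1 = 1
  rec' : ∀ n, b (n + 2) = lam * b (n + 1) - b n
  sym : b (h + 2) = b (h + 1)
  mono : ∀ n, n ≤ h → b n < b (n + 1)
  lam1 : 1 ≤ lam
  lam2 : lam < 2
  lam3 : 1 ≤ h → 3 / 2 ≤ lam
  x0 : 0 < x
  x1 : x ≤ 1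
  g : 1 < x ^ 2 + (2 - lam) * x

namespace RData

variable {h : ℕ} {lam x : ℝ} {b : ℕ → ℝ}

lemma xhalf (D : RData h lam x b) : lam / 2 < x := by
  have := D.g; have := D.lam1; have := D.lam2; have := D.x0
  by_contra hc
  push Not at hc
  nlinarith [sq_nonneg (lam / 2 - 1), mul_nonneg (sub_nonneg.2 hc) this.le]

lemma xlam (D : RData h lam x b) : lam - 1 < x := by
  have := D.g; have := D.lam1; have := D.lam2; have := D.x0
  by_contra hc
  push Not at hc
  nlinarith [mul_nonneg (sub_nonneg.2 hc) this.le]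

lemma pos (D : RData h lam x b) : ∀ n, n ≤ h → 0 < b (n + 1) := by
  intro n
  induction n with
  | zero => intro _; rw [zero_add, D.b1]; norm_num
  | succ k ih => intro hk; exact (ih (by omega)).trans (D.mono (k + 1) hk)

lemma nonneg (D : RData h lam x b) (n : ℕ) (hn : n ≤ h + 1) : 0 ≤ b n := by
  rcases n with _ | n
  · rw [D.b0]
  · exact (D.pos n (by omega)).le

lemma mono' (D : RData h lam x b) (n : ℕ) (hn : n ≤ h + 1) : b n ≤ b (n + 1) := by
  rcases Nat.lt_or_ge h n with h1 | h1
  · obtain rfl : n = h + 1 := by omega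
    exact D.sym.ge
  · exact (D.mono n h1).le

lemma cassini (D : RData h lam x b) (n : ℕ) : b (n + 1) ^ 2 - b (n + 2) * b n = 1 := by
  induction n with
  | zero => rw [zero_add, D.b0, D.b1]; norm_num
  | succ k ih => rw [D.rec' (k + 1)]; rw [← ih, D.rec' k]; ring

lemma ocagne (D : RData h lam x b) (n : ℕ) :
    b (n + 1) * b (n + 2) - b n * b (n + 3) = lam := by
  have := D.cassini n
  rw [D.rec' (n + 1)]
  have h2 := D.rec' n
  rw [h2] at this ⊢
  linear_combination lam * this

/-- denominators of `r`. -/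
lemma rden (D : RData h lam x b) (n : ℕ) (hn : n ≤ h) : 0 < b (n + 1) * x - b n := by
  have h1 := D.pos n hn
  have h2 := D.mono' (n + 1) (by omega)
  have h3 := D.rec' n
  have h4 := mul_pos h1 (sub_pos.2 D.xlam)
  have : b (n + 1 + 1) = b (n + 2) := rfl
  nlinarith

/-- denominators of `l`. -/
lemma lden (D : RData h lam x b) (n : ℕ) (hn : n ≤ h) : 0 < b (n + 1) - b n * x := by
  have h2 := D.mono n hn
  have h3 := mul_nonneg (D.nonneg n (by omega)) (sub_nonneg.2 D.x1)
  nlinarith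

lemma two_mul_le (D : RData h lam x b) (n : ℕ) (hn : n ≤ h) :
    2 * (b (n + 1) + b n) ≤ lam * (b (n + 2) + b (n + 1)) := by
  have e1 := D.rec' n
  have e2 := D.rec' (n + 1)
  have m1 : b (n + 1) ≤ b (n + 2) := D.mono' (n + 1) (by omega)
  have m0 : b n ≤ b (n + 1) := D.mono' n (by omega)
  have e2' : b (n + 3) = lam * b (n + 2) - b (n + 1) := e2
  suffices b n ≤ b (n + 3) by linarith
  rcases Nat.lt_or_ge n h with h1 | h1
  · have m2 : b (n + 2) ≤ b (n + 3) := D.mono' (n + 2) (by omega)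
    linarith
  · obtain rfl : n = h := by omega
    have := D.sym
    rw [e2', this]
    have : b n = lam * b (n + 1) - b (n + 1) := by linarith
    linarith

lemma odd_ineq (D : RData h lam x b) (n : ℕ) (hn : n ≤ h) :
    x ≤ (b (n + 1) + b n) * (b (n + 1) * x - b n) := by
  have c := D.cassini n
  have p := D.nonneg n (by omega)
  have t := D.two_mul_le n hn
  have p1 := D.pos n hn
  have m1 : b (n + 1) ≤ b (n + 2) := D.mono' (n + 1) (by omega)
  have xh := D.xhalf
  have key : 0 ≤ x * (b (n + 2) + b (n + 1)) - (b (n + 1) + b n) := by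
    nlinarith [mul_pos (sub_pos.2 xh) (by linarith : 0 < b (n + 2) + b (n + 1))]
  have e : (b (n + 1) + b n) * (b (n + 1) * x - b n) - x
      = b n * (x * (b (n + 2) + b (n + 1)) - (b (n + 1) + b n)) := by
    linear_combination x * c
  nlinarith [mul_nonneg p key]

lemma even_ineq (D : RData h lam x b) (n : ℕ) (hn : n + 1 ≤ h) :
    x / (1 + x) ≤ b (n + 1) * (b (n + 2) - b (n + 1) * x) := by
  have c := D.cassini n
  have o := D.ocagne n
  have p := D.nonneg n (by omega)
  have p1 := D.pos n (by omega)
  have l3 := D.lam3 (by omega)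
  have m : b (n + 2) ≤ b (n + 3) := D.mono' (n + 2) (by omega)
  have x0 := D.x0
  have x1 := D.x1
  have e : b (n + 1) * (b (n + 2) - b (n + 1)) = lam - 1 + b n * (b (n + 3) - b (n + 2)) := by
    linear_combination o - c
  have : b (n + 1) * (b (n + 2) - b (n + 1)) ≤ b (n + 1) * (b (n + 2) - b (n + 1) * x) := by
    apply mul_le_mul_of_nonneg_left _ p1.le
    nlinarith
  have h2 : x / (1 + x) ≤ 1 / 2 := by
    rw [div_le_div_iff₀ (by linarith) (by norm_num)]; linarith
  have := mul_nonneg p (sub_nonneg.2 m)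
  linarith

lemma Hodd (D : RData h lam x b) (n : ℕ) (hn : n ≤ h) :
    Hs lam (2 * n + 1) = (b (n + 1) + b n) / (b (n + 2) + b (n + 1)) := by
  induction n with
  | zero =>
    have := D.rec' 0
    simp only [zero_add, D.b1, D.b0] at this ⊢
    rw [this]; simp [Hs]
  | succ k ih =>
    have e : Hs lam (2 * (k + 1) + 1) = 1 / (lam - Hs lam (2 * k + 1)) := rfl
    rw [e, ih (by omega)]
    have p0 := D.nonneg k (by omega)
    have p1 := D.pos k (by omega)
    have p2 : 0 < b (k + 2) := D.pos (k + 1) (by omega)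
    have m : b (k + 2) ≤ b (k + 3) := D.mono' (k + 2) (by omega)
    have e1 := D.rec' k
    have e2 : b (k + 3) = lam * b (k + 2) - b (k + 1) := D.rec' (k + 1)
    change _ = (b (k + 2) + b (k + 1)) / (b (k + 3) + b (k + 2))
    have hA : b (k + 2) + b (k + 1) ≠ 0 := by positivity
    have : lam - (b (k + 1) + b k) / (b (k + 2) + b (k + 1))
        = (b (k + 3) + b (k + 2)) / (b (k + 2) + b (k + 1)) := by
      rw [eq_div_iff hA, sub_mul, div_mul_cancel₀ _ hA]; linarith
    rw [this, one_div_div]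

lemma Heven (D : RData h lam x b) (n : ℕ) (hn : n ≤ h) :
    Hs lam (2 * n + 2) = b (n + 1) / b (n + 2) := by
  induction n with
  | zero =>
    have := D.rec' 0
    simp only [zero_add, D.b1, D.b0] at this ⊢
    rw [this]; simp [Hs]
  | succ k ih =>
    have e : Hs lam (2 * (k + 1) + 2) = 1 / (lam - Hs lam (2 * k + 2)) := rfl
    rw [e, ih (by omega)]
    have p2 : 0 < b (k + 2) := D.pos (k + 1) (by omega)
    have e2 : b (k + 3) = lam * b (k + 2) - b (k + 1) := D.rec' (k + 1)
    change _ = b (k + 2) / b (k + 3)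
    have : lam - b (k + 1) / b (k + 2) = b (k + 3) / b (k + 2) := by
      rw [eq_div_iff p2.ne', sub_mul, div_mul_cancel₀ _ p2.ne']; linarith
    rw [this, one_div_div]

lemma D_one (D : RData h lam x b) (y : ℝ) (h1 : x ≤ 1 / |y|) (h2 : 1 / |y| - lam < x) :
    rosenD lam (x / lam) y = 1 := by
  have l0 : 0 < lam := by linarith [D.lam1]
  unfold rosenD
  have e : |1 / (lam * y)| = (1 / |y|) / lam := by
    rw [abs_div, abs_mul, abs_one, abs_of_pos l0, div_div, mul_comm]
  rw [e, Int.floor_eq_iff]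
  have e2 : 1 / |y| / lam + 1 - x / lam = (1 / |y| - x) / lam + 1 := by ring
  rw [e2]
  constructor
  · have : 0 ≤ (1 / |y| - x) / lam := div_nonneg (by linarith) l0.le
    push_cast; linarith
  · have : (1 / |y| - x) / lam < 1 := by rw [div_lt_one l0]; linarith
    push_cast; linarith

lemma T_neg (D : RData h lam x b) (y : ℝ) (hy : y < 0) (h1 : x - lam ≤ -1 / y - lam)
    (h2 : -1 / y - lam < x) : rosenT lam (x / lam) y = -1 / y - lam := by
  have e : 1 / |y| = -1 / y := by rw [abs_of_neg hy, div_neg, neg_div]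
  unfold rosenT
  rw [if_neg hy.ne, D.D_one y (by rw [e]; linarith) (by rw [e]; linarith), Real.sign_of_neg hy]
  push_cast; ring

lemma T_x (D : RData h lam x b) : rosenT lam (x / lam) x = 1 / x - lam := by
  have x0 := D.x0
  have e : 1 / |x| = 1 / x := by rw [abs_of_pos x0]
  have g := D.g
  unfold rosenT
  rw [if_neg x0.ne', D.D_one x _ _, Real.sign_of_pos x0]
  · push_cast; ring
  · rw [e, le_div_iff₀ x0]; nlinarith [D.x1]
  · rw [e, sub_lt_iff_lt_add, div_lt_iff₀ x0]; nlinarith [D.lam1]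

lemma S_ge (D : RData h lam x b) (y : ℝ) (hy : y < 0) : y ≤ -1 / y - lam := by
  have : -1 / y - lam - y = (y ^ 2 + lam * y + 1) / (-y) := by
    have hy' : y ≠ 0 := hy.ne
    have hy2 : -y ≠ 0 := neg_ne_zero.2 hy'
    rw [eq_div_iff hy2, sub_mul, sub_mul, mul_neg, div_mul_cancel₀ _ hy']; ring
  have h2 : 0 ≤ (y ^ 2 + lam * y + 1) / (-y) := by
    apply div_nonneg _ (by linarith)
    have := D.lam1; have := D.lam2
    nlinarith [sq_nonneg (y + lam / 2)]
  linarith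

lemma l_zero (D : RData h lam x b) : lseq lam (x / lam) 0 = x - lam := by
  have l0 : 0 < lam := by linarith [D.lam1]
  simp only [lseq, Function.iterate_zero, id]
  field_simp

lemma r_zero (D : RData h lam x b) : rseq lam (x / lam) 0 = x := by
  have l0 : 0 < lam := by linarith [D.lam1]
  simp only [rseq, Function.iterate_zero, id]
  field_simp

lemma l_succ (lam α : ℝ) (n : ℕ) : lseq lam α (n + 1) = rosenT lam α (lseq lam α n) := by
  simp only [lseq, Function.iterate_succ_apply']

lemma r_succ (lam α : ℝ) (n : ℕ) : rseq lam α (n + 1) = rosenT lam α (rseq lam α n) := by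
  simp only [rseq, Function.iterate_succ_apply']

lemma l_num (D : RData h lam x b) (n : ℕ) (hn : n ≤ h) : 0 ≤ b (n + 2) - b (n + 1) * x := by
  have h2 : b (n + 1) ≤ b (n + 2) := D.mono' (n + 1) (by omega)
  have h3 := mul_nonneg (D.pos n hn).le (sub_nonneg.2 D.x1)
  nlinarith

lemma l_neg_of_lt (D : RData h lam x b) (n : ℕ) (hn : n < h) :
    -(b (n + 2) - b (n + 1) * x) / (b (n + 1) - b n * x) < 0 := by
  have a1 : 0 < b (n + 2) - b (n + 1) * x := D.lden (n + 1) (by omega)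
  have a2 := D.lden n (by omega)
  rw [neg_div]
  exact neg_neg_of_pos (div_pos a1 a2)

lemma l_form (D : RData h lam x b) (n : ℕ) (hn : n ≤ h) :
    lseq lam (x / lam) n = -(b (n + 2) - b (n + 1) * x) / (b (n + 1) - b n * x) ∧
      x - lam ≤ lseq lam (x / lam) n := by
  induction n with
  | zero =>
    have := D.rec' 0
    simp only [zero_add, D.b1, D.b0] at this ⊢
    rw [D.l_zero, this]
    exact ⟨by ring, le_refl _⟩
  | succ k ih =>
    obtain ⟨i1, i2⟩ := ih (by omega)
    have hneg := D.l_neg_of_lt k (by omega)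
    rw [← i1] at hneg
    have hge := D.S_ge _ hneg
    have a1 : 0 < b (k + 2) - b (k + 1) * x := D.lden (k + 1) (by omega)
    have a2 := D.lden k (by omega)
    have a3 : 0 ≤ b (k + 3) - b (k + 2) * x := D.l_num (k + 1) hn
    have e1 := D.rec' k
    have e2 : b (k + 3) = lam * b (k + 2) - b (k + 1) := D.rec' (k + 1)
    have key : -1 / lseq lam (x / lam) k - lam
        = -(b (k + 3) - b (k + 2) * x) / (b (k + 2) - b (k + 1) * x) := by
      rw [i1, div_div_eq_mul_div, neg_mul, one_mul, neg_div_neg_eq, eq_div_iff a1.ne', sub_mul,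
        div_mul_cancel₀ _ a1.ne', e2]
      rw [e1]; ring
    have hle : -(b (k + 3) - b (k + 2) * x) / (b (k + 2) - b (k + 1) * x) ≤ 0 :=
      div_nonpos_of_nonpos_of_nonneg (by linarith) a1.le
    rw [l_succ, D.T_neg _ hneg (by linarith) (by rw [key]; linarith [D.x0])]
    exact ⟨key, by linarith⟩

lemma r_neg_of_lt (D : RData h lam x b) (n : ℕ) (hn : n < h) :
    -(b (n + 2) * x - b (n + 1)) / (b (n + 1) * x - b n) < 0 := by
  have a1 : 0 < b (n + 2) * x - b (n + 1) := D.rden (n + 1) (by omega)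
  have a2 := D.rden n (by omega)
  rw [neg_div]
  exact neg_neg_of_pos (div_pos a1 a2)

lemma r_one (D : RData h lam x b) : rseq lam (x / lam) 1 = 1 / x - lam := by
  rw [r_succ, D.r_zero, D.T_x]

lemma r_one_ge (D : RData h lam x b) : x - lam ≤ 1 / x - lam := by
  have x0 := D.x0
  have : x ≤ 1 / x := by rw [le_div_iff₀ x0]; nlinarith [D.x1]
  linarith

lemma r_form (D : RData h lam x b) (n : ℕ) (hn : n ≤ h) :
    rseq lam (x / lam) (n + 1) = -(b (n + 2) * x - b (n + 1)) / (b (n + 1) * x - b n) ∧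
      1 / x - lam ≤ rseq lam (x / lam) (n + 1) := by
  have x0 := D.x0
  have hr1 := D.r_one_ge
  induction n with
  | zero =>
    have := D.rec' 0
    simp only [zero_add, D.b1, D.b0] at this ⊢
    rw [D.r_one, this]
    refine ⟨?_, le_refl _⟩
    rw [mul_one, sub_zero, one_mul, sub_zero, eq_div_iff x0.ne', sub_mul,
      div_mul_cancel₀ _ x0.ne']
    ring
  | succ k ih =>
    obtain ⟨i1, i2⟩ := ih (by omega)
    have hneg := D.r_neg_of_lt k (by omega)
    rw [← i1] at hneg
    have hge := D.S_ge _ hneg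
    have a1 : 0 < b (k + 2) * x - b (k + 1) := D.rden (k + 1) (by omega)
    have a2 := D.rden k (by omega)
    have e1 := D.rec' k
    have e2 : b (k + 3) = lam * b (k + 2) - b (k + 1) := D.rec' (k + 1)
    have key : -1 / rseq lam (x / lam) (k + 1) - lam
        = -(b (k + 3) * x - b (k + 2)) / (b (k + 2) * x - b (k + 1)) := by
      rw [i1, div_div_eq_mul_div, neg_mul, one_mul, neg_div_neg_eq, eq_div_iff a1.ne', sub_mul,
        div_mul_cancel₀ _ a1.ne', e2]
      rw [e1]; ring
    have hlt : -(b (k + 3) * x - b (k + 2)) / (b (k + 2) * x - b (k + 1)) < x := by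
      rcases Nat.lt_or_ge (k + 1) h with h1 | h1
      · exact (D.r_neg_of_lt (k + 1) h1).trans x0
      · obtain rfl : h = k + 1 := by omega
        have s : b (k + 3) = b (k + 2) := D.sym
        have p : 0 < b (k + 2) := D.pos (k + 1) le_rfl
        have e3 : b (k + 1) = (lam - 1) * b (k + 2) := by linarith
        rw [div_lt_iff₀ a1, s, e3]
        nlinarith [mul_pos p (sub_pos.2 D.g)]
    rw [r_succ, D.T_neg _ hneg (by linarith) (by rw [key]; exact hlt)]
    exact ⟨key, by linarith⟩

lemma l_ge (D : RData h lam x b) (n : ℕ) (hn : n + 1 ≤ h) :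
    1 / x - lam ≤ lseq lam (x / lam) (n + 1) := by
  induction n with
  | zero =>
    have x0 := D.x0
    have xh := D.xhalf
    have hl := D.l_form 0 (by omega)
    have hneg := D.l_neg_of_lt 0 (by omega)
    have hl1 := D.l_form 1 (by omega)
    rw [hl1.1]
    have a1 : 0 < b 2 - b 1 * x := D.lden 1 (by omega)
    have e1 : b 2 = lam := by have := D.rec' 0; simp only [zero_add, D.b1, D.b0] at this; linarith
    have e2 : b 3 = lam * lam - 1 := by have := D.rec' 1; rw [this, D.b1]; norm_num [e1]
    simp only [zero_add, D.b1]
    norm_num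
    rw [e1, e2]
    rw [e1, D.b1] at a1
    have : (lam * x - (lam * lam - 1)) / (lam - x) = 1 / (lam - x) - lam := by
      rw [eq_sub_iff_add_eq, eq_div_iff (by linarith), add_mul, div_mul_cancel₀ _ (by linarith)]
      ring
    rw [this]
    have : x⁻¹ ≤ 1 / (lam - x) := by
      rw [← one_div]; exact one_div_le_one_div_of_le (by linarith) (by linarith)
    linarith
  | succ k ih =>
    have i := ih (by omega)
    have hneg := D.l_neg_of_lt (k + 1) (by omega)
    have i1 := D.l_form (k + 1) (by omega)
    have i2 := D.l_form (k + 2) (by omega)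
    rw [← i1.1] at hneg
    have hge := D.S_ge _ hneg
    have a1 : 0 < b (k + 3) - b (k + 2) * x := D.lden (k + 2) (by omega)
    have a2 : 0 < b (k + 2) - b (k + 1) * x := D.lden (k + 1) (by omega)
    have e : lseq lam (x / lam) (k + 2) = -1 / lseq lam (x / lam) (k + 1) - lam := by
      rw [i1.1, i2.1, div_div_eq_mul_div, neg_mul, one_mul, neg_div_neg_eq]
      change -(b (k + 4) - b (k + 3) * x) / (b (k + 3) - b (k + 2) * x) =
        (b (k + 2) - b (k + 1) * x) / (b (k + 3) - b (k + 2) * x) - lam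
      have e1 : b (k + 3) = lam * b (k + 2) - b (k + 1) := D.rec' (k + 1)
      have e2 : b (k + 4) = lam * b (k + 3) - b (k + 2) := D.rec' (k + 2)
      rw [div_eq_iff a1.ne', sub_mul, div_mul_cancel₀ _ a1.ne', e2]
      linear_combination x * e1
    rw [e]; linarith

/-- The curve for `c = x/(x+1)` stays below `H` on `t < r`. -/
lemma curve (D : RData h lam x b) (t r H : ℝ) (htx : t < x) (htr : t ≤ r) (hH : 0 < H)
    (hr : r + 1 / H ≤ 1 + 1 / x) :
    (x / (x + 1)) / (1 - x / (x + 1) * t) ∈ Set.Icc 0 H := by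
  have x0 := D.x0
  have x1 := D.x1
  have d : 0 < 1 + x - x * t := by nlinarith
  have e : (x / (x + 1)) / (1 - x / (x + 1) * t) = x / (1 + x - x * t) := by
    have : 1 - x / (x + 1) * t = (1 + x - x * t) / (x + 1) := by field_simp; ring
    rw [this, div_div_div_cancel_right₀ (by positivity)]
  rw [e]
  refine ⟨by positivity, ?_⟩
  rw [div_le_iff₀ d]
  have h1 : t + 1 / H ≤ 1 + 1 / x := by linarith
  have h2 := mul_le_mul_of_nonneg_left h1 (mul_pos hH x0).le
  have h3 : H * x * (t + 1 / H) = H * x * t + x := by field_simp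
  have h4 : H * x * (1 + 1 / x) = H * x + H := by field_simp
  rw [h3, h4] at h2
  linarith

lemma odd_bound (D : RData h lam x b) (n : ℕ) (hn : n ≤ h) :
    0 < Hs lam (2 * n + 1) ∧
    rseq lam (x / lam) (n + 1) + 1 / Hs lam (2 * n + 1) ≤ 1 + 1 / x := by
  have x0 := D.x0
  rw [D.Hodd n hn, (D.r_form n hn).1]
  have p0 := D.nonneg n (by omega)
  have p1 := D.pos n hn
  have m1 : b (n + 1) ≤ b (n + 2) := D.mono' (n + 1) (by omega)
  have p2 : 0 < b (n + 2) := by linarith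
  have c := D.cassini n
  have d := D.rden n hn
  have o := D.odd_ineq n hn
  have s : 0 < b (n + 1) + b n := by linarith
  refine ⟨by positivity, ?_⟩
  rw [one_div_div]
  have e : -(b (n + 2) * x - b (n + 1)) / (b (n + 1) * x - b n)
      + (b (n + 2) + b (n + 1)) / (b (n + 1) + b n)
      = (x + 1) / ((b (n + 1) + b n) * (b (n + 1) * x - b n)) := by
    rw [div_add_div _ _ d.ne' s.ne', mul_comm (b (n + 1) + b n)]
    congr 1
    linear_combination (x + 1) * c
  have e2 : 1 + 1 / x = (x + 1) / x := by field_simp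
  rw [e, e2]
  exact div_le_div_of_nonneg_left (by linarith) x0 o

lemma even_bound (D : RData h lam x b) (n : ℕ) (hn : n + 1 ≤ h) :
    0 < Hs lam (2 * n + 2) ∧
    lseq lam (x / lam) (n + 1) + 1 / Hs lam (2 * n + 2) ≤ 1 + 1 / x := by
  have x0 := D.x0
  rw [D.Heven n (by omega), (D.l_form (n + 1) hn).1]
  change _ ∧ -(b (n + 3) - b (n + 2) * x) / (b (n + 2) - b (n + 1) * x) + _ ≤ _
  have p1 := D.pos n (by omega)
  have p2 : 0 < b (n + 2) := D.pos (n + 1) hn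
  have c : b (n + 2) ^ 2 - b (n + 3) * b (n + 1) = 1 := D.cassini (n + 1)
  have d : 0 < b (n + 2) - b (n + 1) * x := D.lden (n + 1) hn
  have o := D.even_ineq n hn
  refine ⟨by positivity, ?_⟩
  rw [one_div_div]
  have e : -(b (n + 3) - b (n + 2) * x) / (b (n + 2) - b (n + 1) * x)
      + b (n + 2) / b (n + 1)
      = 1 / (b (n + 1) * (b (n + 2) - b (n + 1) * x)) := by
    rw [div_add_div _ _ d.ne' p1.ne', mul_comm (b (n + 1)) (b (n + 2) - b (n + 1) * x)]
    congr 1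
    linear_combination c
  have e2 : 1 + 1 / x = 1 / (x / (1 + x)) := by field_simp; ring
  rw [e, e2]
  exact one_div_le_one_div_of_le (by positivity) o

lemma H_last (D : RData h lam x b) : Hs lam (2 * h + 2) = 1 := by
  rw [D.Heven h le_rfl, D.sym, div_self (D.pos h le_rfl).ne']

lemma mem_Omega (lam α : ℝ) (h : ℕ) (t v : ℝ) : (t, v) ∈ OmegaOdd lam α h ↔
    (∃ n, n ≤ h ∧ lseq lam α n ≤ t ∧ t < rseq lam α (n + 1) ∧ v ∈ Set.Icc 0 (Hs lam (2 * n + 1))) ∨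
    (∃ n, n + 1 ≤ h ∧ rseq lam α (n + 1) ≤ t ∧ t < lseq lam α (n + 1) ∧
      v ∈ Set.Icc 0 (Hs lam (2 * n + 2))) ∨
    (rseq lam α (h + 1) ≤ t ∧ t < rseq lam α 0 ∧ v ∈ Set.Icc 0 (Hs lam (2 * h + 2))) := by
  unfold OmegaOdd
  simp only [Set.mem_union, Set.mem_iUnion, Set.mem_prod, Set.mem_Ico, Finset.mem_Icc, or_assoc]
  refine or_congr ?_ (or_congr ?_ (and_assoc))
  · constructor
    · rintro ⟨n, ⟨h1, h2⟩, ⟨h3, h4⟩, h5⟩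
      obtain ⟨m, rfl⟩ : ∃ m, n = m + 1 := ⟨n - 1, by omega⟩
      exact ⟨m, by omega, h3, h4, h5⟩
    · rintro ⟨n, h1, h2, h3, h4⟩
      exact ⟨n + 1, ⟨by omega, by omega⟩, ⟨h2, h3⟩, h4⟩
  · constructor
    · rintro ⟨n, ⟨h1, h2⟩, ⟨h3, h4⟩, h5⟩
      obtain ⟨m, rfl⟩ : ∃ m, n = m + 1 := ⟨n - 1, by omega⟩
      exact ⟨m, by omega, h3, h4, h5⟩
    · rintro ⟨n, h1, h2, h3, h4⟩
      exact ⟨n + 1, ⟨by omega, by omega⟩, ⟨h2, h3⟩, h4⟩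

lemma curve_mem (D : RData h lam x b) (t : ℝ) (h1 : x - lam ≤ t) (h2 : t < x) :
    (t, (x / (x + 1)) / (1 - x / (x + 1) * t)) ∈ OmegaOdd lam (x / lam) h := by
  have x0 := D.x0
  have x1 := D.x1
  by_contra hc
  rw [mem_Omega] at hc
  push Not at hc
  obtain ⟨c1, c2, c3⟩ := hc
  have step : ∀ n, n ≤ h → lseq lam (x / lam) n ≤ t → rseq lam (x / lam) (n + 1) ≤ t := by
    intro n hn hl
    by_contra hr
    push Not at hr
    have := D.odd_bound n hn
    exact c1 n hn hl hr (D.curve t _ _ h2 hr.le this.1 this.2)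
  have step2 : ∀ n, n + 1 ≤ h → rseq lam (x / lam) (n + 1) ≤ t → lseq lam (x / lam) (n + 1) ≤ t := by
    intro n hn hl
    by_contra hr
    push Not at hr
    have := D.even_bound n hn
    exact c2 n hn hl hr (D.curve t _ _ h2 hr.le this.1 this.2)
  have all : ∀ n, n ≤ h → lseq lam (x / lam) n ≤ t := by
    intro n
    induction n with
    | zero => intro _; rw [D.l_zero]; exact h1
    | succ k ih => intro hk; exact step2 k hk (step k (by omega) (ih (by omega)))
  refine c3 (step h le_rfl (all h le_rfl)) (by rw [D.r_zero]; exact h2) ?_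
  rw [D.H_last]
  refine D.curve t x 1 h2 h2.le one_pos ?_
  have : (1:ℝ) ≤ 1 / x := by rw [le_div_iff₀ x0]; linarith
  linarith

lemma sup_bound (c l r K : ℝ) (hc : 0 < c) (hl : l ≤ 0) (hlr : l < r) (hK : 0 < K)
    (H : ∀ t, l ≤ t → t < r → 0 ≤ c / (1 - c * t) ∧ c / (1 - c * t) ≤ 1 / K) :
    c * (K + r) ≤ 1 := by
  have hcr : c * r ≤ 1 := by
    by_contra hcr
    push Not at hcr
    have h1 : 1 / c < r := by rw [div_lt_iff₀ hc]; linarith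
    obtain ⟨t, ht1, ht2⟩ := exists_between h1
    have : 0 < 1 / c := by positivity
    have h3 := (H t (by linarith) ht2).1
    rw [div_lt_iff₀ hc] at ht1
    have := div_neg_of_pos_of_neg hc (by linarith : 1 - c * t < 0)
    linarith
  by_contra hcon
  push Not at hcon
  have h1 : max l (1 / c - K) < r := by
    refine max_lt hlr ?_
    rw [sub_lt_iff_lt_add, div_lt_iff₀ hc]; linarith
  obtain ⟨t, ht1, ht2⟩ := exists_between h1
  have hlt := (le_max_left _ _).trans ht1.le
  have hkt := lt_of_le_of_lt (le_max_right _ _) ht1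
  have h3 := (H t hlt ht2).2
  have h4 : 0 < 1 - c * t := by nlinarith
  rw [div_le_div_iff₀ h4 hK] at h3
  rw [sub_lt_iff_lt_add, div_lt_iff₀ hc] at hkt
  linarith

lemma upper (D : RData h lam x b) (c : ℝ) (hc : 0 < c)
    (H : ∀ t, x - lam ≤ t → t < x → (t, c / (1 - c * t)) ∈ OmegaOdd lam (x / lam) h) :
    c ≤ x / (x + 1) := by
  have x0 := D.x0
  have x1 := D.x1
  have l1 := D.lam1
  rw [le_div_iff₀ (by linarith)]
  rcases lt_or_eq_of_le x1 with hx | hx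
  · have hlt : x - lam < 1 / x - lam := by
      have : x < 1 / x := by rw [lt_div_iff₀ x0]; nlinarith
      linarith
    have hrx : 1 / x - lam < x := by
      rw [sub_lt_iff_lt_add, div_lt_iff₀ x0]; nlinarith [D.g]
    have := sup_bound c (x - lam) (1 / x - lam) (lam + 1) hc (by linarith) hlt (by linarith) ?_
    · have h2 := mul_le_mul_of_nonneg_right this x0.le
      have h3 : c * (lam + 1 + (1 / x - lam)) * x = c * (x + 1) := by field_simp; ring
      linarith
    · intro t t1 t2
      have m := H t t1 (by linarith)
      rw [mem_Omega] at m
      rcases m with ⟨n, hn, a1, a2, a3⟩ | ⟨n, hn, a1, a2, a3⟩ | ⟨a1, a2, a3⟩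
      · rcases n with _ | n
        · exact a3
        · have := D.l_ge n hn
          linarith
      · have := (D.r_form n (by omega)).2
        linarith
      · have := (D.r_form h le_rfl).2
        linarith
  · subst hx
    have := sup_bound c (1 - lam) 1 1 hc (by linarith) (by linarith) one_pos ?_
    · linarith
    · intro t t1 t2
      have m := H t t1 t2
      rw [mem_Omega] at m
      rcases m with ⟨n, hn, a1, a2, a3⟩ | ⟨n, hn, a1, a2, a3⟩ | ⟨a1, a2, a3⟩
      · refine ⟨a3.1, a3.2.trans ?_⟩
        rw [D.Hodd n hn, div_one]
        have p1 := D.pos n hn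
        have m0 := D.mono' n (by omega)
        have m1 : b (n + 1) ≤ b (n + 2) := D.mono' (n + 1) (by omega)
        rw [div_le_one (by linarith)]
        linarith
      · refine ⟨a3.1, a3.2.trans ?_⟩
        rw [D.Heven n (by omega), div_one]
        have p1 := D.pos n (by omega)
        have m1 : b (n + 1) ≤ b (n + 2) := D.mono' (n + 1) (by omega)
        rw [div_le_one (by linarith)]
        linarith
      · rw [D.H_last] at a3
        exact ⟨a3.1, by simpa using a3.2⟩

lemma lenstra (D : RData h lam x b) : lenstraOdd lam (x / lam) h = x / (x + 1) := by
  have l0 : 0 < lam := by linarith [D.lam1]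
  have x0 := D.x0
  have e1 : (x / lam - 1) * lam = x - lam := by field_simp
  have e2 : x / lam * lam = x := by field_simp
  unfold lenstraOdd
  rw [e1, e2]
  apply IsGreatest.csSup_eq
  refine ⟨⟨by positivity, fun t ht => D.curve_mem t ht.1 ht.2⟩, ?_⟩
  rintro c ⟨hc, H⟩
  exact D.upper c hc (fun t h1 h2 => H t ⟨h1, h2⟩)

end RData

lemma rdata_of (h : ℕ) (lam x : ℝ)
    (hlam : lam = 2 * Real.cos (Real.pi / (2 * (h : ℝ) + 3))) (x0 : 0 < x) (x1 : x ≤ 1)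
    (g : 1 < x ^ 2 + (2 - lam) * x) : ∃ b, RData h lam x b := by
  set θ := Real.pi / (2 * (h : ℝ) + 3) with hθ
  have pi0 := Real.pi_pos
  have hh : (0 : ℝ) ≤ h := Nat.cast_nonneg h
  have hq : 0 < 2 * (h : ℝ) + 3 := by positivity
  have θ0 : 0 < θ := by positivity
  have θq : (2 * (h : ℝ) + 3) * θ = Real.pi := by rw [hθ]; field_simp
  have θ1 : θ ≤ Real.pi / 3 := by rw [hθ]; gcongr; linarith
  have s0 : 0 < Real.sin θ := Real.sin_pos_of_pos_of_lt_pi θ0 (by linarith)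
  refine ⟨fun n => Real.sin (n * θ) / Real.sin θ, ?_⟩
  refine ⟨by simp, by simp [s0.ne'], ?_, ?_, ?_, ?_, ?_, ?_, x0, x1, g⟩
  · intro n
    have e : Real.sin ((n + 2 : ℕ) * θ) + Real.sin (n * θ)
        = 2 * Real.cos θ * Real.sin ((n + 1 : ℕ) * θ) := by
      have a1 : ((n + 2 : ℕ) : ℝ) * θ = (n + 1 : ℕ) * θ + θ := by push_cast; ring
      have a2 : (n : ℝ) * θ = (n + 1 : ℕ) * θ - θ := by push_cast; ring
      rw [a1, a2, Real.sin_add, Real.sin_sub]; ring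
    rw [hlam, eq_sub_iff_add_eq, ← add_div, e]; ring
  · have : ((h + 2 : ℕ) : ℝ) * θ = Real.pi - (h + 1 : ℕ) * θ := by
      push_cast; linarith
    simp only [this, Real.sin_pi_sub]
  · intro n hn
    have hn' : (n : ℝ) ≤ h := by exact_mod_cast hn
    refine div_lt_div_of_pos_right ?_ s0
    have hn0 : (0 : ℝ) ≤ n * θ := by positivity
    have hnθ : (n : ℝ) * θ ≤ h * θ := by gcongr
    apply Real.sin_lt_sin_of_lt_of_le_pi_div_two
    · linarith
    · push_cast; nlinarith
    · push_cast; nlinarith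
  · have := Real.cos_le_cos_of_nonneg_of_le_pi θ0.le (by linarith) θ1
    rw [Real.cos_pi_div_three] at this
    linarith
  · have : Real.cos θ < Real.cos 0 := Real.cos_lt_cos_of_nonneg_of_le_pi le_rfl (by linarith) θ0
    rw [Real.cos_zero] at this
    linarith
  · intro h1
    have h1' : (1 : ℝ) ≤ h := by exact_mod_cast h1
    have θ2 : θ ≤ Real.pi / 5 := by rw [hθ]; gcongr; linarith
    have := Real.cos_le_cos_of_nonneg_of_le_pi θ0.le (by linarith) θ2
    rw [Real.cos_pi_div_five] at this
    have : (2 : ℝ) ≤ √5 := Real.le_sqrt_of_sq_le (by norm_num)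
    linarith

/-- **Proposition 5.1** (Lenstra constant for odd α-Rosen fractions).  For odd
`q = 2h+3`, `λ = 2cos(π/q)`, `ρ = (λ-2+√(λ²-4λ+8))/2`, `ℋ_q = 1/√(λ²-4λ+8)` and
`α_L = ℋ_q/(λ(1-ℋ_q))`, one has `ρ/λ < α_L < 1/λ`, and for every
`α ∈ [α_L, 1/λ]` the Lenstra constant is `ℒ_α = αλ/(αλ+1)`; in particular
`ℒ_α ≥ ℋ_q`, with `ℒ_α > ℋ_q` if and only if `α > α_L`. -/
theorem lenstra_constant_odd (h : ℕ) (lam : ℝ)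
    (hlam : lam = 2 * Real.cos (Real.pi / (2 * (h : ℝ) + 3)))
    (ρ Hq αL : ℝ) (hρ : ρ = (lam - 2 + Real.sqrt (lam ^ 2 - 4 * lam + 8)) / 2)
    (hHq : Hq = 1 / Real.sqrt (lam ^ 2 - 4 * lam + 8))
    (hαL : αL = Hq / (lam * (1 - Hq))) :
    ρ / lam < αL ∧ αL < 1 / lam ∧
    ∀ α ∈ Set.Icc αL (1 / lam),
      lenstraOdd lam α h = α * lam / (α * lam + 1) ∧
      Hq ≤ lenstraOdd lam α h ∧
      (Hq < lenstraOdd lam α h ↔ αL < α) := by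
  have hl : 1 ≤ lam ∧ lam < 2 := by
    have pi0 := Real.pi_pos
    have hh : (0 : ℝ) ≤ h := Nat.cast_nonneg h
    have θ0 : 0 < Real.pi / (2 * (h : ℝ) + 3) := by positivity
    have θ1 : Real.pi / (2 * (h : ℝ) + 3) ≤ Real.pi / 3 := by gcongr; linarith
    have a := Real.cos_le_cos_of_nonneg_of_le_pi θ0.le (by linarith) θ1
    rw [Real.cos_pi_div_three] at a
    have c := Real.cos_lt_cos_of_nonneg_of_le_pi le_rfl (by linarith) θ0
    rw [Real.cos_zero] at c
    constructor <;> linarith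
  obtain ⟨l1, l2⟩ := hl
  have l0 : 0 < lam := by linarith
  set s := Real.sqrt (lam ^ 2 - 4 * lam + 8) with hs
  have ss : s ^ 2 = lam ^ 2 - 4 * lam + 8 := Real.sq_sqrt (by nlinarith)
  have s2 : 2 < s := Real.lt_sqrt_of_sq_lt (by nlinarith)
  have hαL' : αL = 1 / (s - 1) / lam := by
    have : s - 1 ≠ 0 := by linarith
    have e : 1 - Hq = (s - 1) / s := by rw [hHq]; field_simp
    rw [hαL, e, hHq]; field_simp
  have key : ρ < 1 / (s - 1) := by
    rw [lt_div_iff₀ (by linarith), hρ]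
    have h1 : (2 - lam) ^ 2 + 2 + (2 - lam) < s * (1 + (2 - lam)) := by
      apply lt_of_pow_lt_pow_left₀ 2 (by nlinarith)
      rw [mul_pow, ss]; nlinarith
    nlinarith
  have s1 : 1 / (s - 1) < 1 := by rw [div_lt_one (by linarith)]; linarith
  have ρ0 : 0 < ρ := by rw [hρ]; linarith
  have hg : ρ ^ 2 + (2 - lam) * ρ = 1 := by rw [hρ]; nlinarith
  refine ⟨?_, ?_, ?_⟩
  · rw [hαL']; exact div_lt_div_of_pos_right key l0
  · rw [hαL']; exact div_lt_div_of_pos_right s1 l0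
  rintro α ⟨ha1, ha2⟩
  obtain ⟨x, rfl⟩ : ∃ x, α = x / lam := ⟨α * lam, by field_simp⟩
  rw [hαL', div_le_div_iff_of_pos_right l0] at ha1
  rw [div_le_div_iff_of_pos_right l0] at ha2
  have x0 : 0 < x := by linarith
  obtain ⟨b, D⟩ := rdata_of h lam x hlam x0 ha2 (by nlinarith)
  have e2 : x / lam * lam = x := by field_simp
  rw [D.lenstra, e2, hαL', div_lt_div_iff_of_pos_right l0, hHq,
    div_le_div_iff₀ (by linarith) (by linarith), div_lt_div_iff₀ (by linarith) (by linarith),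
    div_lt_iff₀ (by linarith)]
  rw [div_le_iff₀ (by linarith)] at ha1
  refine ⟨rfl, by linarith, ?_, ?_⟩ <;> intro <;> linarith
end
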